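/- (Theorem 1.) In the stationary hidden Markov setting, assume (i) L(Σ_{i=1}^{S₁} Y_i | X₀ = 0) is strongly aperiodic, and (ii) there is a positive integer-valued random variable Z with E Z³ < ∞ such that max{P(Y₁ ≥ r | X₁ = l), P(Y₁ ≤ −r | X₁ = l)} ≤ P(Z ≥ r) for all r ≥ 0 and all l ∈ E. Then ‖L(W) − TP(E W, Var W)‖ ≤ 4(1 + 14 n φ(n) E τ² E Z³)/Var W, where φ(n) := β̃(n/4) + (C ∨ C̄) n ρ^{−n/4}; here τ is the length of the interval between successive times at which the two-sided stationary versions of X and an independent copy X' are simultaneously in state 0 which contains the time point 0, β̃(n) := max{β(n), β̄(n)} with β(n) := ‖P⁰[(X_n, 1+Σ_{i=1}^n Y_i) ∈ ·] − P⁰[(X_n, Σ_{i=1}^n Y_i) ∈ ·]‖ and β̄ its time-reversed analogue, and ρ > 1, C, C̄ are constants such that max_k P(next joint visit to 0 after time j occurs at time ≥ j + m | state k at time j) ≤ C ρ^{−m} for the chain and ≤ C̄ ρ^{−m} for its time reversal. -/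

import Mathlib

open MeasureTheory ProbabilityTheory

noncomputable section

variable {Ω : Type*} [MeasurableSpace Ω]

/-- The translated Poisson distribution `TP(μ, σ²)` on `ℤ`: the law of
`⌊μ - σ²⌋ + N` where `N ∼ Poisson(σ² + δ)` and `δ := μ - σ² - ⌊μ - σ²⌋`. -/
def translatedPoisson (μ σ2 : ℝ) : PMF ℤ :=
  (poissonPMF (σ2 + Int.fract (μ - σ2)).toNNReal).map
    (fun n : ℕ => ⌊μ - σ2⌋ + (n : ℤ))

/-- The total variation norm `‖Q - Q'‖ = ∑_{i ∈ ℤ} |Q(i) - Q'(i)|`. -/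
def tvNormMeasure (P Q : Measure ℤ) : ℝ :=
  ∑' i : ℤ, |(P {i}).toReal - (Q {i}).toReal|

/-- `β(m)` for a two-sided chain: the total variation distance between the `P⁰`-laws of
`(X_m, 1 + Σ_{i=1}^m Y_i)` and `(X_m, Σ_{i=1}^m Y_i)`, realized by conditioning the
stationary chain on `X₀ = 0`. -/
def betaFn2 (Pr : Measure Ω) (K : ℕ) (X : ℤ → Ω → Fin (K + 1)) (Y : ℤ → Ω → ℤ)
    (m : ℕ) : ℝ :=
  ∑' p : Fin (K + 1) × ℤ,
    |((Pr[|{ω | X 0 ω = 0}])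
        {ω | X m ω = p.1 ∧ 1 + ∑ i ∈ Finset.Icc (1 : ℤ) m, Y i ω = p.2}).toReal
      - ((Pr[|{ω | X 0 ω = 0}])
          {ω | X m ω = p.1 ∧ ∑ i ∈ Finset.Icc (1 : ℤ) m, Y i ω = p.2}).toReal|

/-- `β̄(m)`: the analogue of `β(m)` for the time-reversed chain `X̄_i := X_{-i}`,
`Ȳ_i := Y_{-i}`. -/
def betaBarFn2 (Pr : Measure Ω) (K : ℕ) (X : ℤ → Ω → Fin (K + 1)) (Y : ℤ → Ω → ℤ)
    (m : ℕ) : ℝ :=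
  betaFn2 Pr K (fun i => X (-i)) (fun i => Y (-i)) m

/-- `β̃(m) := max{β(m), β̄(m)}`. -/
def tildeBetaFn2 (Pr : Measure Ω) (K : ℕ) (X : ℤ → Ω → Fin (K + 1)) (Y : ℤ → Ω → ℤ)
    (m : ℕ) : ℝ :=
  max (betaFn2 Pr K X Y m) (betaBarFn2 Pr K X Y m)

/-- `τ`: the length of the interval between successive common visits of the two-sided
stationary chains `X`, `X'` to the state `0` which contains the time point `0`. -/
def tauRV (K : ℕ) (X X' : ℤ → Ω → Fin (K + 1)) (ω : Ω) : ℤ :=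
  sInf {k : ℤ | 0 < k ∧ X k ω = 0 ∧ X' k ω = 0}
    - sSup {k : ℤ | k ≤ 0 ∧ X k ω = 0 ∧ X' k ω = 0}

end

namespace HiddenMarkov

section Stopped

variable {S Λ V W : Type*} [Fintype S] [DecidableEq S]

/-- The expectation of `Ψ` evaluated at the list of labels `lab s s'` of the steps `s → s'` made by
the chain with transition function `P` started in a given state, stopped on reaching `z` or after
`M` steps. -/
def stopped [AddCommMonoid V] [Module ℝ V] (P : S → S → ℝ) (z : S) (lab : S → S → Λ) :
    ℕ → S → (List Λ → V) → V
  | 0, _, Ψ => Ψ []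
  | M + 1, s, Ψ => if s = z then Ψ [] else
      ∑ s', P s s' • stopped P z lab M s' (fun u => Ψ (lab s s' :: u))

/-- The probability that the chain started in a given state avoids `z` at the times `0, …, s - 1`. -/
def taboo (P : S → S → ℝ) (z : S) : ℕ → S → ℝ
  | 0, _ => 1
  | s + 1, x => if x = z then 0 else ∑ y, P x y * taboo P z s y

variable {P : S → S → ℝ} {z : S} {lab : S → S → Λ}

theorem map_stopped [AddCommMonoid V] [Module ℝ V] [AddCommMonoid W] [Module ℝ W]
    (φ : V →ₗ[ℝ] W) (M : ℕ) (s : S) (Ψ : List Λ → V) :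
    φ (stopped P z lab M s Ψ) = stopped P z lab M s (fun u => φ (Ψ u)) := by
  induction M generalizing s Ψ with
  | zero => rfl
  | succ M ih =>
    simp only [stopped]
    split_ifs
    · rfl
    · simp [map_sum, ih]

theorem stopped_add [AddCommMonoid V] [Module ℝ V] (M : ℕ) (s : S) (Ψ Φ : List Λ → V) :
    stopped P z lab M s (fun u => Ψ u + Φ u) =
      stopped P z lab M s Ψ + stopped P z lab M s Φ := by
  induction M generalizing s Ψ Φ with
  | zero => rfl
  | succ M ih =>
    simp only [stopped]
    split_ifs
    · rfl
    · simp [ih, Finset.sum_add_distrib]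

theorem stopped_sub [AddCommGroup V] [Module ℝ V] (M : ℕ) (s : S) (Ψ Φ : List Λ → V) :
    stopped P z lab M s (fun u => Ψ u - Φ u) =
      stopped P z lab M s Ψ - stopped P z lab M s Φ := by
  induction M generalizing s Ψ Φ with
  | zero => rfl
  | succ M ih =>
    simp only [stopped]
    split_ifs
    · rfl
    · simp [ih, Finset.sum_sub_distrib, smul_sub]

theorem stopped_sum {ι : Type*} [AddCommMonoid V] [Module ℝ V] (I : Finset ι) (M : ℕ) (s : S)
    (Ψ : ι → List Λ → V) :
    stopped P z lab M s (fun u => ∑ i ∈ I, Ψ i u) = ∑ i ∈ I, stopped P z lab M s (Ψ i) := by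
  induction M generalizing s Ψ with
  | zero => rfl
  | succ M ih =>
    simp only [stopped]
    split_ifs
    · rfl
    · simp only [ih, Finset.smul_sum]
      exact Finset.sum_comm

theorem stopped_const_mul (c : ℝ) (M : ℕ) (s : S) (Ψ : List Λ → ℝ) :
    stopped P z lab M s (fun u => c * Ψ u) = c * stopped P z lab M s Ψ :=
  (map_stopped (LinearMap.mulLeft ℝ c) M s Ψ).symm

theorem mul_stopped {A : Type*} [Ring A] [Algebra ℝ A] (c : A) (M : ℕ) (s : S) (Ψ : List Λ → A) :
    c * stopped P z lab M s Ψ = stopped P z lab M s (fun u => c * Ψ u) :=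
  map_stopped (LinearMap.mulLeft ℝ c) M s Ψ

theorem stopped_mul {A : Type*} [Ring A] [Algebra ℝ A] (c : A) (M : ℕ) (s : S) (Ψ : List Λ → A) :
    stopped P z lab M s Ψ * c = stopped P z lab M s (fun u => Ψ u * c) :=
  map_stopped (LinearMap.mulRight ℝ c) M s Ψ

theorem smul_stopped [AddCommMonoid V] [Module ℝ V] (c : ℝ) (M : ℕ) (s : S) (Ψ : List Λ → V) :
    c • stopped P z lab M s Ψ = stopped P z lab M s (fun u => c • Ψ u) :=
  map_stopped (LinearMap.lsmul ℝ V c) M s Ψ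

theorem stopped_congr [AddCommMonoid V] [Module ℝ V] (M : ℕ) (s : S) {Ψ Φ : List Λ → V}
    (h : ∀ u, u.length ≤ M → Ψ u = Φ u) :
    stopped P z lab M s Ψ = stopped P z lab M s Φ := by
  induction M generalizing s Ψ Φ with
  | zero => exact h [] (by simp)
  | succ M ih =>
    simp only [stopped]
    split_ifs
    · exact h [] (by simp)
    · refine Finset.sum_congr rfl fun s' _ => ?_
      rw [ih s' fun u hu => h _ (by simpa using hu)]

theorem stopped_const [AddCommMonoid V] [Module ℝ V] (hP : ∀ s, ∑ s', P s s' = 1) (M : ℕ) (s : S)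
    (c : V) : stopped P z lab M s (fun _ => c) = c := by
  induction M generalizing s with
  | zero => rfl
  | succ M ih =>
    simp only [stopped]
    split_ifs
    · rfl
    · simp [ih, ← Finset.sum_smul, hP]

theorem stopped_mono (hP : ∀ s s', 0 ≤ P s s') (M : ℕ) (s : S) {Ψ Φ : List Λ → ℝ}
    (h : ∀ u, u.length ≤ M → Ψ u ≤ Φ u) :
    stopped P z lab M s Ψ ≤ stopped P z lab M s Φ := by
  induction M generalizing s Ψ Φ with
  | zero => exact h [] (by simp)
  | succ M ih =>
    simp only [stopped]
    split_ifs
    · exact h [] (by simp)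
    · refine Finset.sum_le_sum fun s' _ => ?_
      exact mul_le_mul_of_nonneg_left (ih s' fun u hu => h _ (by simpa using hu)) (hP _ _)

theorem norm_stopped_le [SeminormedAddCommGroup V] [NormedSpace ℝ V]
    (hP : ∀ s s', 0 ≤ P s s') (M : ℕ) (s : S)
    {Ψ : List Λ → V} {Φ : List Λ → ℝ} (h : ∀ u, u.length ≤ M → ‖Ψ u‖ ≤ Φ u) :
    ‖stopped P z lab M s Ψ‖ ≤ stopped P z lab M s Φ := by
  induction M generalizing s Ψ Φ with
  | zero => exact h [] (by simp)
  | succ M ih =>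
    simp only [stopped]
    split_ifs
    · exact h [] (by simp)
    · refine (norm_sum_le _ _).trans (Finset.sum_le_sum fun s' _ => ?_)
      rw [norm_smul, Real.norm_of_nonneg (hP _ _)]
      exact mul_le_mul_of_nonneg_left (ih s' fun u hu => h _ (by simpa using hu)) (hP _ _)

theorem taboo_nonneg (hP : ∀ s s', 0 ≤ P s s') (s : ℕ) (x : S) : 0 ≤ taboo P z s x := by
  induction s generalizing x with
  | zero => exact zero_le_one
  | succ s ih =>
    simp only [taboo]
    split_ifs
    · exact le_rfl
    · exact Finset.sum_nonneg fun y _ => mul_nonneg (hP _ _) (ih y)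

theorem taboo_succ_le (hP : ∀ s s', 0 ≤ P s s') (hP1 : ∀ s, ∑ s', P s s' = 1) (s : ℕ) (x : S) :
    taboo P z (s + 1) x ≤ taboo P z s x := by
  induction s generalizing x with
  | zero =>
    simp only [taboo]
    split_ifs
    · exact zero_le_one
    · simp [hP1]
  | succ s ih =>
    rw [taboo, taboo]
    split_ifs
    · exact le_rfl
    · exact Finset.sum_le_sum fun y _ => mul_le_mul_of_nonneg_left (ih y) (hP _ _)

theorem taboo_antitone (hP : ∀ s s', 0 ≤ P s s') (hP1 : ∀ s, ∑ s', P s s' = 1) (x : S) :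
    Antitone fun s => taboo P z s x :=
  antitone_nat_of_succ_le fun s => taboo_succ_le hP hP1 s x

theorem stopped_indicator (hP1 : ∀ s, ∑ s', P s s' = 1) (M r : ℕ) (hr : r ≤ M) (s : S) :
    stopped P z lab M s (fun u => if r ≤ u.length then (1 : ℝ) else 0) = taboo P z r s := by
  induction M generalizing r s with
  | zero =>
    obtain rfl : r = 0 := by omega
    simp [stopped, taboo]
  | succ M ih =>
    rcases r with _ | r
    · simp [stopped_const hP1, taboo]
    · simp only [stopped, taboo]
      split_ifs with h1 h2
      · simp at h2
      · rfl
      · refine Finset.sum_congr rfl fun s' _ => ?_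
        rw [← ih r (by omega) s']
        simp [smul_eq_mul]

theorem stopped_indicator_le (hP : ∀ s s', 0 ≤ P s s') (hP1 : ∀ s, ∑ s', P s s' = 1) (M r : ℕ)
    (s : S) :
    stopped P z lab M s (fun u => if r ≤ u.length then (1 : ℝ) else 0) ≤ taboo P z r s := by
  rcases le_or_gt r M with h | h
  · exact (stopped_indicator hP1 M r h s).le
  · rw [stopped_congr (Φ := fun _ => (0 : ℝ)) M s fun u hu => if_neg (by omega),
      stopped_const hP1]
    exact taboo_nonneg hP r s

theorem sum_indicator_length (M : ℕ) (u : List Λ) (hu : u.length ≤ M) :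
    ∑ r ∈ Finset.range M, (if r + 1 ≤ u.length then (1 : ℝ) else 0) = u.length := by
  rw [Finset.sum_boole]
  congr 1
  rw [show {r ∈ Finset.range M | r + 1 ≤ u.length} = Finset.range u.length by
    ext r; simp; omega]
  simp

theorem stopped_length (hP1 : ∀ s, ∑ s', P s s' = 1) (M : ℕ) (s : S) :
    stopped P z lab M s (fun u => (u.length : ℝ)) =
      ∑ r ∈ Finset.range M, taboo P z (r + 1) s := by
  rw [stopped_congr (Φ := fun u => ∑ r ∈ Finset.range M, if r + 1 ≤ u.length then (1 : ℝ) else 0)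
    M s fun u hu => (sum_indicator_length M u hu).symm, stopped_sum]
  exact Finset.sum_congr rfl fun r hr =>
    stopped_indicator hP1 M (r + 1) (by simpa using hr) s

end Stopped

/-- A stationary Markov chain on a finite state space, together with its time reversal. -/
structure RevChain (E : Type*) [Fintype E] where
  P : E → E → ℝ
  Pb : E → E → ℝ
  π : E → ℝ
  P_nonneg : ∀ k l, 0 ≤ P k l
  Pb_nonneg : ∀ k l, 0 ≤ Pb k l
  P_row : ∀ k, ∑ l, P k l = 1
  Pb_row : ∀ k, ∑ l, Pb k l = 1
  π_nonneg : ∀ k, 0 ≤ π k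
  π_sum : ∑ k, π k = 1
  rev : ∀ k l, π k * P k l = π l * Pb l k

namespace RevChain

section Basic

variable {E : Type*} [Fintype E] (R : RevChain E)

/-- The time reversal of a stationary chain. -/
def symm : RevChain E where
  P := R.Pb
  Pb := R.P
  π := R.π
  P_nonneg := R.Pb_nonneg
  Pb_nonneg := R.P_nonneg
  P_row := R.Pb_row
  Pb_row := R.P_row
  π_nonneg := R.π_nonneg
  π_sum := R.π_sum
  rev k l := (R.rev l k).symm

/-- Two independent copies of a stationary chain. -/
def pair : RevChain (E × E) where
  P x y := R.P x.1 y.1 * R.P x.2 y.2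
  Pb x y := R.Pb x.1 y.1 * R.Pb x.2 y.2
  π x := R.π x.1 * R.π x.2
  P_nonneg x y := mul_nonneg (R.P_nonneg _ _) (R.P_nonneg _ _)
  Pb_nonneg x y := mul_nonneg (R.Pb_nonneg _ _) (R.Pb_nonneg _ _)
  P_row x := by
    rw [Fintype.sum_prod_type, ← Finset.sum_mul_sum, R.P_row, R.P_row, one_mul]
  Pb_row x := by
    rw [Fintype.sum_prod_type, ← Finset.sum_mul_sum, R.Pb_row, R.Pb_row, one_mul]
  π_nonneg x := mul_nonneg (R.π_nonneg _) (R.π_nonneg _)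
  π_sum := by
    rw [Fintype.sum_prod_type, ← Finset.sum_mul_sum, R.π_sum, one_mul]
  rev x y := by
    have h1 := R.rev x.1 y.1
    have h2 := R.rev x.2 y.2
    calc _ = (R.π x.1 * R.P x.1 y.1) * (R.π x.2 * R.P x.2 y.2) := by ring
      _ = _ := by rw [h1, h2]; ring

theorem sum_π_smul_sum {V : Type*} [AddCommMonoid V] [Module ℝ V] (f : E → E → V) :
    ∑ k, R.π k • ∑ l, R.P k l • f k l = ∑ l, R.π l • ∑ k, R.Pb l k • f k l := by
  simp only [Finset.smul_sum, smul_smul, R.rev]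
  exact Finset.sum_comm

theorem stationary_smul {V : Type*} [AddCommMonoid V] [Module ℝ V] (f : E → V) :
    ∑ k, R.π k • ∑ l, R.P k l • f l = ∑ l, R.π l • f l := by
  rw [R.sum_π_smul_sum fun _ l => f l]
  simp [← Finset.sum_smul, R.Pb_row]

theorem sum_π_le {f : E → ℝ} {c : ℝ} (h : ∀ k, f k ≤ c) : ∑ k, R.π k * f k ≤ c := by
  calc ∑ k, R.π k * f k ≤ ∑ k, R.π k * c :=
        Finset.sum_le_sum fun k _ => mul_le_mul_of_nonneg_left (h k) (R.π_nonneg k)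
    _ = c := by rw [← Finset.sum_mul, R.π_sum, one_mul]

theorem norm_sum_π_le {V : Type*} [SeminormedAddCommGroup V] [NormedSpace ℝ V] {f : E → V}
    {g : E → ℝ} (h : ∀ k, ‖f k‖ ≤ g k) : ‖∑ k, R.π k • f k‖ ≤ ∑ k, R.π k * g k := by
  refine (norm_sum_le _ _).trans (Finset.sum_le_sum fun k _ => ?_)
  rw [norm_smul, Real.norm_of_nonneg (R.π_nonneg k)]
  exact mul_le_mul_of_nonneg_left (h k) (R.π_nonneg k)

theorem norm_sum_P_le {V : Type*} [SeminormedAddCommGroup V] [NormedSpace ℝ V] {f : E → V}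
    {c : ℝ} (k : E) (h : ∀ l, ‖f l‖ ≤ c) : ‖∑ l, R.P k l • f l‖ ≤ c := by
  refine (norm_sum_le _ _).trans ?_
  calc ∑ l, ‖R.P k l • f l‖ ≤ ∑ l, R.P k l * c := Finset.sum_le_sum fun l _ => by
        rw [norm_smul, Real.norm_of_nonneg (R.P_nonneg k l)]
        exact mul_le_mul_of_nonneg_left (h l) (R.P_nonneg k l)
    _ = c := by rw [← Finset.sum_mul, R.P_row, one_mul]

end Basic

section Taboo

variable {S : Type*} [Fintype S] [DecidableEq S] (D : RevChain S) (z : S)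

/-- The stationary probability of avoiding `z` at `s` consecutive times. -/
def avoid (s : ℕ) : ℝ := ∑ x, D.π x * taboo D.P z s x

theorem sum_taboo_mul_taboo (s s' : ℕ) :
    ∑ x, D.π x * (taboo D.Pb z s x * ∑ y, D.P x y * taboo D.P z s' y) = D.avoid z (s + s') := by
  induction s generalizing s' with
  | zero =>
    simpa [taboo, avoid] using D.stationary_smul (fun y => taboo D.P z s' y)
  | succ s ih =>
    rw [show s + 1 + s' = s + (s' + 1) by ring, ← ih]
    have h1 : ∀ x, taboo D.Pb z (s + 1) x * ∑ y, D.P x y * taboo D.P z s' y =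
        ∑ w, D.Pb x w * (taboo D.Pb z s w * taboo D.P z (s' + 1) x) := by
      intro x
      simp only [taboo]
      split_ifs
      · simp
      · rw [Finset.sum_mul]
        exact Finset.sum_congr rfl fun w _ => by ring
    simp_rw [h1]
    have h2 := D.sum_π_smul_sum fun w x => taboo D.Pb z s w * taboo D.P z (s' + 1) x
    simp only [smul_eq_mul] at h2
    rw [← h2]
    refine Finset.sum_congr rfl fun x _ => ?_
    congr 1
    rw [Finset.mul_sum]
    exact Finset.sum_congr rfl fun w _ => by ring

theorem avoid_symm (s : ℕ) : D.symm.avoid z s = D.avoid z s := by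
  have := D.sum_taboo_mul_taboo z s 0
  simpa [taboo, D.P_row, avoid, symm] using this

theorem avoid_le {s : ℕ} {c : ℝ} (h : ∀ x, taboo D.P z s x ≤ c) : D.avoid z s ≤ c :=
  D.sum_π_le h

theorem avoid_antitone : Antitone (D.avoid z) := fun _ _ h =>
  Finset.sum_le_sum fun x _ => mul_le_mul_of_nonneg_left
    (taboo_antitone D.P_nonneg D.P_row x h) (D.π_nonneg x)

/-- The expectation of a function of a stationary state, of the states met by the reversed chain
up to its visit to `z` (or `M₁` steps), and of those met by the chain at positive times before its
visit to `z` (or `M₂` steps). -/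
def joint {V : Type*} [AddCommMonoid V] [Module ℝ V] (M₁ M₂ : ℕ) (F : S → List S → List S → V) :
    V :=
  ∑ x, D.π x • stopped D.Pb z (fun _ s' => s') M₁ x fun u =>
    ∑ y, D.P x y • stopped D.P z (fun s _ => s) M₂ y fun v => F x u v

variable {V W : Type*} {M₁ M₂ : ℕ}

theorem joint_congr [AddCommMonoid V] [Module ℝ V] {F G : S → List S → List S → V}
    (h : ∀ x u v, u.length ≤ M₁ → v.length ≤ M₂ → F x u v = G x u v) :
    D.joint z M₁ M₂ F = D.joint z M₁ M₂ G := by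
  unfold joint
  refine Finset.sum_congr rfl fun x _ => ?_
  rw [stopped_congr]
  intro u hu
  refine Finset.sum_congr rfl fun y _ => ?_
  rw [stopped_congr]
  exact fun v hv => h x u v hu hv

theorem map_joint [AddCommMonoid V] [Module ℝ V] [AddCommMonoid W] [Module ℝ W] (φ : V →ₗ[ℝ] W)
    (F : S → List S → List S → V) :
    φ (D.joint z M₁ M₂ F) = D.joint z M₁ M₂ fun x u v => φ (F x u v) := by
  simp [joint, map_stopped]

theorem joint_add [AddCommMonoid V] [Module ℝ V] (F G : S → List S → List S → V) :
    D.joint z M₁ M₂ (fun x u v => F x u v + G x u v) =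
      D.joint z M₁ M₂ F + D.joint z M₁ M₂ G := by
  simp [joint, stopped_add, Finset.sum_add_distrib]

theorem joint_sub [AddCommGroup V] [Module ℝ V] (F G : S → List S → List S → V) :
    D.joint z M₁ M₂ (fun x u v => F x u v - G x u v) =
      D.joint z M₁ M₂ F - D.joint z M₁ M₂ G := by
  simp [joint, stopped_sub, smul_sub]

theorem joint_sum {ι : Type*} (I : Finset ι) [AddCommMonoid V] [Module ℝ V]
    (F : ι → S → List S → List S → V) :
    D.joint z M₁ M₂ (fun x u v => ∑ i ∈ I, F i x u v) = ∑ i ∈ I, D.joint z M₁ M₂ (F i) := by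
  unfold joint
  refine Eq.trans (Finset.sum_congr rfl fun x _ => ?_) Finset.sum_comm
  rw [← Finset.smul_sum, ← stopped_sum]
  congr 1
  refine stopped_congr _ _ fun u _ => ?_
  simp only [stopped_sum, Finset.smul_sum]
  exact Finset.sum_comm

theorem joint_const_mul (c : ℝ) (F : S → List S → List S → ℝ) :
    D.joint z M₁ M₂ (fun x u v => c * F x u v) = c * D.joint z M₁ M₂ F :=
  (D.map_joint z (LinearMap.mulLeft ℝ c) F).symm

theorem norm_joint_le [SeminormedAddCommGroup V] [NormedSpace ℝ V] {F : S → List S → List S → V}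
    {G : S → List S → List S → ℝ}
    (h : ∀ x u v, u.length ≤ M₁ → v.length ≤ M₂ → ‖F x u v‖ ≤ G x u v) :
    ‖D.joint z M₁ M₂ F‖ ≤ D.joint z M₁ M₂ G := by
  refine D.norm_sum_π_le fun x => ?_
  refine norm_stopped_le D.Pb_nonneg _ _ fun u hu => ?_
  refine (norm_sum_le _ _).trans (Finset.sum_le_sum fun y _ => ?_)
  rw [norm_smul, Real.norm_of_nonneg (D.P_nonneg x y)]
  exact mul_le_mul_of_nonneg_left
    (norm_stopped_le D.P_nonneg _ _ fun v hv => h x u v hu hv) (D.P_nonneg x y)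

theorem joint_const [AddCommMonoid V] [Module ℝ V] (c : V) :
    D.joint z M₁ M₂ (fun _ _ _ => c) = c := by
  simp [joint, stopped_const D.P_row, stopped_const D.Pb_row, ← Finset.sum_smul, D.P_row, D.π_sum]

theorem joint_mul_ite (s s' : ℕ) :
    D.joint z M₁ M₂ (fun _ u v => (if s ≤ u.length then (1 : ℝ) else 0) *
      if s' ≤ v.length then (1 : ℝ) else 0) =
    ∑ x, D.π x * (stopped D.Pb z (fun _ s' => s') M₁ x
      (fun u => if s ≤ u.length then (1 : ℝ) else 0) *
      ∑ y, D.P x y * stopped D.P z (fun s _ => s) M₂ y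
      (fun v => if s' ≤ v.length then (1 : ℝ) else 0)) := by
  unfold joint
  refine Finset.sum_congr rfl fun x _ => ?_
  rw [smul_eq_mul, stopped_mul]
  congr 1
  refine stopped_congr _ _ fun u _ => ?_
  rw [Finset.mul_sum]
  refine Finset.sum_congr rfl fun y _ => ?_
  rw [stopped_const_mul, smul_eq_mul]
  ring

theorem joint_ite_le (s s' : ℕ) :
    D.joint z M₁ M₂ (fun _ u v => (if s ≤ u.length then (1 : ℝ) else 0) *
      if s' ≤ v.length then (1 : ℝ) else 0) ≤ D.avoid z (s + s') := by
  rw [joint_mul_ite, ← sum_taboo_mul_taboo]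
  refine Finset.sum_le_sum fun x _ => mul_le_mul_of_nonneg_left ?_ (D.π_nonneg x)
  refine mul_le_mul (stopped_indicator_le D.Pb_nonneg D.Pb_row _ _ _) ?_ ?_
    (taboo_nonneg D.Pb_nonneg _ _)
  · exact Finset.sum_le_sum fun y _ => mul_le_mul_of_nonneg_left
      (stopped_indicator_le D.P_nonneg D.P_row _ _ _) (D.P_nonneg x y)
  · refine Finset.sum_nonneg fun y _ => mul_nonneg (D.P_nonneg x y) ?_
    rw [← stopped_const (P := D.P) (z := z) (lab := fun s _ => s) D.P_row M₂ y (0 : ℝ)]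
    exact stopped_mono D.P_nonneg _ _ fun v _ => by
      rw [stopped_const D.P_row]
      split_ifs <;> simp

end Taboo

section PairTaboo

variable {E : Type*} [Fintype E] [DecidableEq E] (R : RevChain E) (o : E)

theorem sum_π_taboo_pair_le (s : ℕ) (k' : E) :
    ∑ k, R.π k * taboo R.pair.P (o, o) s (o, k) ≤ ∑ k, R.π k * taboo R.pair.P (o, o) s (k', k) := by
  induction s generalizing k' with
  | zero => simp [taboo]
  | succ s ih =>
    by_cases hk : k' = o
    · rw [hk]
    · calc ∑ k, R.π k * taboo R.pair.P (o, o) (s + 1) (o, k)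
          ≤ ∑ k, R.π k * taboo R.pair.P (o, o) s (o, k) :=
            Finset.sum_le_sum fun k _ => mul_le_mul_of_nonneg_left
              (taboo_succ_le R.pair.P_nonneg R.pair.P_row _ _) (R.π_nonneg k)
        _ = ∑ l', R.P k' l' * ∑ k, R.π k * taboo R.pair.P (o, o) s (o, k) := by
            rw [← Finset.sum_mul, R.P_row, one_mul]
        _ ≤ ∑ l', R.P k' l' * ∑ k, R.π k * taboo R.pair.P (o, o) s (l', k) :=
            Finset.sum_le_sum fun l' _ => mul_le_mul_of_nonneg_left (ih l') (R.P_nonneg _ _)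
        _ = ∑ k, R.π k * taboo R.pair.P (o, o) (s + 1) (k', k) := by
            have h1 : ∀ l', ∑ k, R.π k * taboo R.pair.P (o, o) s (l', k) =
                ∑ k, R.π k * ∑ l, R.P k l * taboo R.pair.P (o, o) s (l', l) := fun l' =>
              (R.stationary_smul (fun l => taboo R.pair.P (o, o) s (l', l))).symm
            simp_rw [h1]
            have h2 : ∀ k, taboo R.pair.P (o, o) (s + 1) (k', k) =
                ∑ l', ∑ l, R.P k' l' * R.P k l * taboo R.pair.P (o, o) s (l', l) := by
              intro k
              rw [taboo, if_neg (by simp [hk]), Fintype.sum_prod_type]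
              rfl
            simp_rw [h2, Finset.mul_sum]
            rw [Finset.sum_comm]
            refine Finset.sum_congr rfl fun k _ => Finset.sum_congr rfl fun l' _ =>
              Finset.sum_congr rfl fun l _ => by ring

theorem sum_π_taboo_le_avoid (s : ℕ) :
    ∑ k, R.π k * taboo R.pair.P (o, o) s (o, k) ≤ R.pair.avoid (o, o) s := by
  have h : R.pair.avoid (o, o) s =
      ∑ k', R.π k' * ∑ k, R.π k * taboo R.pair.P (o, o) s (k', k) := by
    rw [avoid, Fintype.sum_prod_type]
    refine Finset.sum_congr rfl fun k' _ => ?_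
    rw [Finset.mul_sum]
    exact Finset.sum_congr rfl fun k _ => mul_assoc _ _ _
  rw [h]
  calc _ = ∑ k', R.π k' * ∑ k, R.π k * taboo R.pair.P (o, o) s (o, k) := by
        rw [← Finset.sum_mul, R.π_sum, one_mul]
    _ ≤ _ := Finset.sum_le_sum fun k' _ => mul_le_mul_of_nonneg_left
        (R.sum_π_taboo_pair_le o s k') (R.π_nonneg k')

end PairTaboo

section Columns

variable {E A : Type*} [Fintype E] [CommRing A] [Algebra ℝ A] (R : RevChain E)

/-- The expected product of the weights `w k l` of the first `M` transitions `k → l`. -/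
def ecol (w : E → E → A) : ℕ → E → A
  | 0, _ => 1
  | M + 1, k => ∑ l, R.P k l • (w k l * ecol w M l)

/-- The expected product of the weights of the `M` states following a given one. -/
def ret (N : E → A) : ℕ → E → A := R.ecol fun _ l => N l

/-- The expected product of the weights of `M` successive states, a given one being the first. -/
def fwd (N : E → A) : ℕ → E → A := R.ecol fun k _ => N k

variable (N : E → A)

theorem ret_zero (k : E) : R.ret N 0 k = 1 := rfl

theorem fwd_zero (k : E) : R.fwd N 0 k = 1 := rfl

theorem ret_succ (M : ℕ) (k : E) : R.ret N (M + 1) k = ∑ l, R.P k l • (N l * R.ret N M l) := rfl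

theorem sum_P_fwd (M : ℕ) (k : E) : ∑ l, R.P k l • R.fwd N M l = R.ret N M k := by
  induction M generalizing k with
  | zero => simp [ret_zero, fwd_zero, ← Finset.sum_smul, R.P_row]
  | succ M ih =>
    rw [ret_succ]
    refine Finset.sum_congr rfl fun l _ => ?_
    rw [← ih, Finset.mul_sum]
    simp_rw [mul_smul_comm]
    rfl

theorem fwd_succ (M : ℕ) (k : E) : R.fwd N (M + 1) k = N k * R.ret N M k := by
  rw [← sum_P_fwd, Finset.mul_sum]
  simp_rw [mul_smul_comm]
  rfl

/-- Moving one site from the past to the future. -/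
theorem sum_π_ret_symm_succ (t : ℕ) (G : E → A) :
    ∑ k, R.π k • (R.symm.ret N (t + 1) k * G k) =
      ∑ l, R.π l • (R.symm.ret N t l * (N l * ∑ k, R.P l k • G k)) := by
  have h := R.sum_π_smul_sum fun l k => R.symm.ret N t l * (N l * G k)
  simp_rw [Finset.mul_sum, mul_smul_comm] 
  rw [h]
  refine Finset.sum_congr rfl fun k _ => ?_
  rw [ret_succ, Finset.sum_mul]
  congr 1
  refine Finset.sum_congr rfl fun l _ => ?_
  rw [smul_mul_assoc]
  congr 1
  ring

theorem sum_π_ret_symm_mul_fwd (t M : ℕ) :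
    ∑ k, R.π k • (R.symm.ret N t k * R.fwd N M k) = ∑ k, R.π k • R.fwd N (t + M) k := by
  induction t generalizing M with
  | zero => simp [ret_zero]
  | succ t ih =>
    rw [R.sum_π_ret_symm_succ, show t + 1 + M = t + (M + 1) by ring, ← ih]
    simp_rw [sum_P_fwd, fwd_succ]

variable {S Λ : Type*} [Fintype S] [DecidableEq S]

theorem ecol_eq_stopped (Pt : S → S → ℝ) (z : S) (p : S → E)
    (hp : ∀ s (f : E → A), ∑ s', Pt s s' • f (p s') = ∑ l, R.P (p s) l • f l)
    (lab : S → S → Λ) (c : Λ → A) (w : E → E → A) (hc : ∀ s s', c (lab s s') = w (p s) (p s'))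
    (M : ℕ) (s : S) :
    R.ecol w M (p s) = stopped Pt z lab M s fun u =>
      (u.map c).prod * R.ecol w (M - u.length) (p z) := by
  induction M generalizing s with
  | zero => simp [stopped, ecol]
  | succ M ih =>
    rw [stopped]
    split_ifs with h
    · simp [h]
    · rw [ecol, ← hp s fun l => w (p s) l * R.ecol w M l]
      refine Finset.sum_congr rfl fun s' _ => ?_
      rw [ih, mul_stopped]
      congr 1
      refine stopped_congr _ _ fun u _ => ?_
      simp [hc, mul_assoc]

theorem sum_pair_fst {V : Type*} [AddCommMonoid V] [Module ℝ V] (s : E × E) (f : E → V) :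
    ∑ s', R.pair.P s s' • f s'.1 = ∑ l, R.P s.1 l • f l := by
  rw [Fintype.sum_prod_type]
  refine Finset.sum_congr rfl fun l _ => ?_
  change ∑ i, (R.P s.1 l * R.P s.2 i) • f l = _
  rw [← Finset.sum_smul]
  rw [← Finset.mul_sum, R.P_row, mul_one]

theorem sum_pair_snd {V : Type*} [AddCommMonoid V] [Module ℝ V] (s : E × E) (f : E → V) :
    ∑ s', R.pair.P s s' • f s'.2 = ∑ l, R.P s.2 l • f l := by
  rw [Fintype.sum_prod_type, Finset.sum_comm]
  refine Finset.sum_congr rfl fun l _ => ?_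
  change ∑ i, (R.P s.1 i * R.P s.2 l) • f l = _
  rw [← Finset.sum_smul]
  rw [← Finset.sum_mul, R.P_row, one_mul]

variable [DecidableEq E] (o : E)

theorem ret_eq_stopped_fst (M : ℕ) (s : E × E) :
    R.ret N M s.1 = stopped R.pair.P (o, o) (fun _ s' => s') M s fun u =>
      (u.map fun a => N a.1).prod * R.ret N (M - u.length) o :=
  R.ecol_eq_stopped R.pair.P (o, o) Prod.fst (R.sum_pair_fst) _ _ _ (fun _ _ => rfl) M s

theorem ret_eq_stopped_snd (M : ℕ) (s : E × E) :
    R.ret N M s.2 = stopped R.pair.P (o, o) (fun _ s' => s') M s fun u =>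
      (u.map fun a => N a.2).prod * R.ret N (M - u.length) o :=
  R.ecol_eq_stopped R.pair.P (o, o) Prod.snd (R.sum_pair_snd) _ _ _ (fun _ _ => rfl) M s

theorem fwd_eq_stopped_fst (M : ℕ) (s : E × E) :
    R.fwd N M s.1 = stopped R.pair.P (o, o) (fun s _ => s) M s fun u =>
      (u.map fun a => N a.1).prod * R.fwd N (M - u.length) o :=
  R.ecol_eq_stopped R.pair.P (o, o) Prod.fst (R.sum_pair_fst) _ _ _ (fun _ _ => rfl) M s

theorem fwd_eq_stopped_snd (M : ℕ) (s : E × E) :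
    R.fwd N M s.2 = stopped R.pair.P (o, o) (fun s _ => s) M s fun u =>
      (u.map fun a => N a.2).prod * R.fwd N (M - u.length) o :=
  R.ecol_eq_stopped R.pair.P (o, o) Prod.snd (R.sum_pair_snd) _ _ _ (fun _ _ => rfl) M s

theorem joint_fst (M₁ M₂ : ℕ) (b : E → A) :
    ∑ k, R.π k • (R.symm.ret N M₁ k * b k * R.ret N M₂ k) =
      R.pair.joint (o, o) M₁ M₂ fun x u v =>
        (u.map fun a => N a.1).prod * R.symm.ret N (M₁ - u.length) o * b x.1 *
          ((v.map fun a => N a.1).prod * R.fwd N (M₂ - v.length) o) := by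
  have h0 : ∀ f : E → A, ∑ k, R.π k • f k = ∑ x, R.pair.π x • f x.1 := by
    intro f
    rw [Fintype.sum_prod_type]
    refine Finset.sum_congr rfl fun k _ => ?_
    change _ = ∑ i, (R.π k * R.π i) • f k
    rw [← Finset.sum_smul]
    rw [← Finset.mul_sum, R.π_sum, mul_one]
  rw [h0, joint]
  refine Finset.sum_congr rfl fun x _ => ?_
  rw [R.symm.ret_eq_stopped_fst N o M₁ x, ← sum_P_fwd, ← R.sum_pair_fst, mul_assoc, stopped_mul]
  congr 1
  refine stopped_congr _ _ fun u _ => ?_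
  rw [Finset.mul_sum, Finset.mul_sum]
  refine Finset.sum_congr rfl fun y _ => ?_
  rw [R.fwd_eq_stopped_fst N o, mul_smul_comm, mul_smul_comm, mul_stopped, mul_stopped]
  congr 1
  exact stopped_congr _ _ fun v _ => by ring

theorem joint_snd (M₁ M₂ : ℕ) (m : E → ℝ) :
    (∑ k, R.π k * m k) • ∑ k, R.π k • (R.symm.ret N M₁ k * N k * R.ret N M₂ k) =
      R.pair.joint (o, o) M₁ M₂ fun x u v =>
        m x.1 • ((u.map fun a => N a.2).prod * R.symm.ret N (M₁ - u.length) o * N x.2 *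
          ((v.map fun a => N a.2).prod * R.fwd N (M₂ - v.length) o)) := by
  have h0 : ∀ f : E → A, (∑ k, R.π k * m k) • ∑ k, R.π k • f k =
      ∑ x, R.pair.π x • (m x.1 • f x.2) := by
    intro f
    rw [Fintype.sum_prod_type, Finset.sum_smul]
    refine Finset.sum_congr rfl fun k _ => ?_
    rw [Finset.smul_sum]
    refine Finset.sum_congr rfl fun l _ => ?_
    rw [smul_smul, smul_smul]
    congr 1
    change _ = R.π k * R.π l * _
    ring
  rw [h0, joint]
  refine Finset.sum_congr rfl fun x _ => ?_
  rw [R.symm.ret_eq_stopped_snd N o M₁ x, ← sum_P_fwd, ← R.sum_pair_snd, mul_assoc, stopped_mul,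
    smul_stopped]
  congr 1
  refine stopped_congr _ _ fun u _ => ?_
  rw [Finset.mul_sum, Finset.mul_sum, Finset.smul_sum]
  refine Finset.sum_congr rfl fun y _ => ?_
  rw [R.fwd_eq_stopped_snd N o, mul_smul_comm, mul_smul_comm, mul_stopped, mul_stopped, smul_comm,
    smul_stopped]
  congr 1
  exact stopped_congr _ _ fun v _ => by congr 1; ring

end Columns

end RevChain

/-- Second-order expansions in powers of `D` of the transforms `N k` of the conditional laws of the
hidden variables, and first-order ones of their derivatives `N' k`. -/
structure JetData (E A : Type*) [CommRing A] [Algebra ℝ A] where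
  D : A
  N : E → A
  I : E → A
  I₂ : E → A
  N' : E → A
  J : E → A
  J₂ : E → A
  m : E → ℝ
  s : E → ℝ
  N_eq : ∀ k, N k = 1 + D * I k
  I_eq : ∀ k, I k = algebraMap ℝ A (m k) + D * I₂ k
  N'_eq : ∀ k, N' k = algebraMap ℝ A (m k) + D * J k
  J_eq : ∀ k, J k = algebraMap ℝ A (s k) + D * J₂ k

namespace JetData

section Algebra

variable {E A : Type*} [CommRing A] [Algebra ℝ A] (T : JetData E A)

/-- The first-order remainder of a product of transforms. -/
def listI : List E → A
  | [] => 0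
  | a :: w => T.I a + T.N a * listI w

/-- The second-order remainder of a product of transforms. -/
def listI₂ : List E → A
  | [] => 0
  | a :: w => T.I₂ a + T.I a * T.listI w + listI₂ w

theorem prod_eq (w : List E) : (w.map T.N).prod = 1 + T.D * T.listI w := by
  induction w with
  | nil => simp [listI]
  | cons a w ih =>
    rw [List.map_cons, List.prod_cons, ih, listI]
    linear_combination T.N_eq a

theorem listI_eq (w : List E) :
    T.listI w = algebraMap ℝ A (w.map T.m).sum + T.D * T.listI₂ w := by
  induction w with
  | nil => simp [listI, listI₂]
  | cons a w ih =>
    rw [List.map_cons, List.sum_cons, listI, listI₂, map_add]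
    linear_combination T.I_eq a + T.N_eq a * T.listI w + ih

/-- The first-order remainder of the effect of exchanging two lists of sites. -/
def swapA (k : E) (w₁ w₂ : List E) : A :=
  T.J k + T.N' k * T.listI w₁ - T.m k • T.listI w₂

/-- The second-order remainder of the effect of exchanging two lists of sites. -/
def swapA₂ (k : E) (w₁ w₂ : List E) : A :=
  T.J₂ k + T.J k * T.listI w₁ + T.m k • (T.listI₂ w₁ - T.listI₂ w₂)

/-- The leading coefficient of the effect of exchanging two lists of sites. -/
def swapC (k : E) (w₁ w₂ : List E) : ℝ :=
  T.s k + T.m k * ((w₁.map T.m).sum - (w₂.map T.m).sum)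

theorem bracket_eq (k : E) (w₁ w₂ : List E) :
    (w₁.map T.N).prod * T.N' k - T.m k • (w₂.map T.N).prod = T.D * T.swapA k w₁ w₂ := by
  rw [prod_eq, prod_eq, swapA, Algebra.smul_def, Algebra.smul_def]
  linear_combination T.N'_eq k

theorem swapA_eq (k : E) (w₁ w₂ : List E) :
    T.swapA k w₁ w₂ = algebraMap ℝ A (T.swapC k w₁ w₂) + T.D * T.swapA₂ k w₁ w₂ := by
  rw [swapA, swapA₂, swapC, Algebra.smul_def, Algebra.smul_def]
  simp only [map_add, map_mul, map_sub]
  linear_combination T.J_eq k + T.N'_eq k * T.listI w₁ +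
    algebraMap ℝ A (T.m k) * T.listI_eq w₁ - algebraMap ℝ A (T.m k) * T.listI_eq w₂

variable [Fintype E] (R : RevChain E) (o : E)

/-- The contribution of the sites lying outside a joint excursion. -/
def tails (M₁ M₂ : ℕ) (u v : List (E × E)) : A :=
  R.symm.ret T.N (M₁ - u.length) o * R.fwd T.N (M₂ - v.length) o

/-- The sites of the first chain met in a joint excursion, apart from the reference one. -/
def sites₁ (u v : List (E × E)) : List E := (u ++ v).map Prod.fst

/-- The sites of the second chain met in a joint excursion. -/
def sites₂ (x : E × E) (u v : List (E × E)) : List E := x.2 :: (u ++ v).map Prod.snd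

/-- The transform of the law of the sum of `M₁ + 1 + M₂` hidden variables. -/
def total (M₁ M₂ : ℕ) : A :=
  ∑ k, R.π k • (R.symm.ret T.N M₁ k * T.N k * R.ret T.N M₂ k)

/-- The transform of the law of the sum of `M₁ + 1 + M₂` hidden variables, weighted by the value of
that of index `M₁ + 1`. -/
def marked (M₁ M₂ : ℕ) : A :=
  ∑ k, R.π k • (R.symm.ret T.N M₁ k * T.N' k * R.ret T.N M₂ k)

/-- The mean of a hidden variable. -/
def mean : ℝ := ∑ k, R.π k * T.m k

theorem total_eq (M₁ M₂ t : ℕ) (ht : t ≤ M₁ + M₂ + 1) :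
    T.total R M₁ M₂ =
      ∑ k, R.π k • (R.symm.ret T.N t k * R.fwd T.N (M₁ + M₂ + 1 - t) k) := by
  rw [R.sum_π_ret_symm_mul_fwd, show t + (M₁ + M₂ + 1 - t) = M₁ + (M₂ + 1) by omega,
    ← R.sum_π_ret_symm_mul_fwd, total]
  simp_rw [R.fwd_succ, mul_assoc]

variable [DecidableEq E]

/-- The covariance of the hidden variable of index `M₁ + 1` with the sum of `M₁ + 1 + M₂` hidden
variables. -/
def cov (M₁ M₂ : ℕ) : ℝ :=
  R.pair.joint (o, o) M₁ M₂ fun x u v => T.swapC x.1 (sites₁ u v) (sites₂ x u v)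

/-- The remainder in the first-order comparison of `marked` and `total`. -/
def rem (M₁ M₂ : ℕ) : A :=
  R.pair.joint (o, o) M₁ M₂ fun x u v =>
    T.swapA x.1 (sites₁ u v) (sites₂ x u v) * T.tails R o M₁ M₂ u v -
      T.swapC x.1 (sites₁ u v) (sites₂ x u v) • T.total R M₁ M₂

theorem marked_sub (M₁ M₂ : ℕ) :
    T.marked R M₁ M₂ - T.mean R • T.total R M₁ M₂ =
      T.D * R.pair.joint (o, o) M₁ M₂ fun x u v =>
        T.swapA x.1 (sites₁ u v) (sites₂ x u v) * T.tails R o M₁ M₂ u v := by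
  rw [marked, total, mean, R.joint_fst T.N o, R.joint_snd T.N o, ← RevChain.joint_sub,
    ← LinearMap.mulLeft_apply (R := ℝ), RevChain.map_joint]
  refine RevChain.joint_congr _ _ fun x u v _ _ => ?_
  rw [LinearMap.mulLeft_apply, ← mul_assoc T.D, ← bracket_eq, tails, sites₁, sites₂,
    Algebra.smul_def, Algebra.smul_def]
  simp only [List.map_append, List.prod_append, List.map_cons, List.prod_cons, List.map_map]
  simp only [Function.comp_def]
  ring

theorem marked_sub_sub (M₁ M₂ : ℕ) :
    T.marked R M₁ M₂ - T.mean R • T.total R M₁ M₂ - T.cov R o M₁ M₂ • (T.D * T.total R M₁ M₂) =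
      T.D * T.rem R o M₁ M₂ := by
  rw [marked_sub _ _ o, rem, RevChain.joint_sub, mul_sub]
  congr 1
  rw [cov, ← mul_smul_comm]
  congr 1
  have := R.pair.map_joint (M₁ := M₁) (M₂ := M₂) (o, o)
    ((LinearMap.id : ℝ →ₗ[ℝ] ℝ).smulRight (T.total R M₁ M₂))
    (fun x u v => T.swapC x.1 (sites₁ u v) (sites₂ x u v))
  simpa using this

end Algebra

end JetData

/-- Bounds in terms of powers of `θ` for the coefficients of the expansions in `JetData`. -/
structure JetBound {E A : Type*} [NormedCommRing A] [NormedAlgebra ℝ A] (T : JetData E A)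
    (θ : ℝ) : Prop where
  one_le : 1 ≤ θ
  N : ∀ k, ‖T.N k‖ ≤ 1
  I : ∀ k, ‖T.I k‖ ≤ θ
  I₂ : ∀ k, ‖T.I₂ k‖ ≤ θ ^ 2
  N' : ∀ k, ‖T.N' k‖ ≤ θ
  J : ∀ k, ‖T.J k‖ ≤ θ ^ 2
  J₂ : ∀ k, ‖T.J₂ k‖ ≤ θ ^ 3
  m : ∀ k, |T.m k| ≤ θ
  s : ∀ k, |T.s k| ≤ θ ^ 2
  D_le : ‖T.D‖ ≤ 2
  le_D : 1 ≤ ‖T.D‖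

namespace JetBound

variable {E A : Type*} [NormedCommRing A] [NormedAlgebra ℝ A] {T : JetData E A}
  {θ : ℝ}

theorem norm_listI_le (B : JetBound T θ) (w : List E) : ‖T.listI w‖ ≤ θ * w.length := by
  induction w with
  | nil => simp [JetData.listI]
  | cons a w ih =>
    rw [JetData.listI, List.length_cons]
    push_cast
    have h1 : ‖T.N a * T.listI w‖ ≤ 1 * (θ * w.length) :=
      (norm_mul_le _ _).trans (mul_le_mul (B.N a) ih (norm_nonneg _) zero_le_one)
    linarith [norm_add_le (T.I a) (T.N a * T.listI w), B.I a]

theorem norm_listI₂_le (B : JetBound T θ) (w : List E) :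
    ‖T.listI₂ w‖ ≤ θ ^ 2 * (w.length * (w.length + 1) / 2) := by
  have h0 := B.one_le
  induction w with
  | nil => simp [JetData.listI₂]
  | cons a w ih =>
    rw [JetData.listI₂, List.length_cons]
    push_cast
    have h1 : ‖T.I a * T.listI w‖ ≤ θ * (θ * w.length) :=
      (norm_mul_le _ _).trans
        (mul_le_mul (B.I a) (B.norm_listI_le w) (norm_nonneg _) (by linarith))
    have h2 := norm_add₃_le (a := T.I₂ a) (b := T.I a * T.listI w) (c := T.listI₂ w)
    nlinarith [B.I₂ a]

theorem abs_sum_m_le (B : JetBound T θ) (w : List E) : |(w.map T.m).sum| ≤ θ * w.length := by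
  induction w with
  | nil => simp
  | cons a w ih =>
    rw [List.map_cons, List.sum_cons, List.length_cons]
    push_cast
    linarith [abs_add_le (T.m a) (w.map T.m).sum, B.m a]

theorem norm_swapA_le (B : JetBound T θ) (k : E) (w₁ w₂ : List E) :
    ‖T.swapA k w₁ w₂‖ ≤ θ ^ 2 * (1 + w₁.length + w₂.length) := by
  have h0 := B.one_le
  have h1 : ‖T.N' k * T.listI w₁‖ ≤ θ * (θ * w₁.length) :=
    (norm_mul_le _ _).trans
      (mul_le_mul (B.N' k) (B.norm_listI_le w₁) (norm_nonneg _) (by linarith))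
  have h2 : ‖T.m k • T.listI w₂‖ ≤ θ * (θ * w₂.length) := by
    rw [norm_smul]
    exact mul_le_mul (B.m k) (B.norm_listI_le w₂) (norm_nonneg _) (by linarith)
  have h3 := norm_sub_le (T.J k + T.N' k * T.listI w₁) (T.m k • T.listI w₂)
  have h4 := norm_add_le (T.J k) (T.N' k * T.listI w₁)
  rw [JetData.swapA]
  nlinarith [B.J k]

theorem norm_swapA₂_le (B : JetBound T θ) (k : E) (w₁ w₂ : List E) :
    ‖T.swapA₂ k w₁ w₂‖ ≤ θ ^ 3 * (1 + w₁.length + w₁.length * (w₁.length + 1) / 2 +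
      w₂.length * (w₂.length + 1) / 2) := by
  have h0 := B.one_le
  have h1 : ‖T.J k * T.listI w₁‖ ≤ θ ^ 2 * (θ * w₁.length) :=
    (norm_mul_le _ _).trans
      (mul_le_mul (B.J k) (B.norm_listI_le w₁) (norm_nonneg _) (by positivity))
  have h2 : ‖T.m k • (T.listI₂ w₁ - T.listI₂ w₂)‖ ≤
      θ * (θ ^ 2 * (w₁.length * (w₁.length + 1) / 2) +
        θ ^ 2 * (w₂.length * (w₂.length + 1) / 2)) := by
    rw [norm_smul]
    refine mul_le_mul (B.m k) ((norm_sub_le _ _).trans ?_) (norm_nonneg _) (by linarith)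
    exact add_le_add (B.norm_listI₂_le _) (B.norm_listI₂_le _)
  have h3 := norm_add₃_le (a := T.J₂ k) (b := T.J k * T.listI w₁)
    (c := T.m k • (T.listI₂ w₁ - T.listI₂ w₂))
  rw [JetData.swapA₂]
  have h4 := B.J₂ k
  linarith

theorem abs_swapC_le (B : JetBound T θ) (k : E) (w₁ w₂ : List E) :
    |T.swapC k w₁ w₂| ≤ θ ^ 2 * (1 + w₁.length + w₂.length) := by
  have h0 := B.one_le
  rw [JetData.swapC]
  have h1 := abs_add_le (T.s k) (T.m k * ((w₁.map T.m).sum - (w₂.map T.m).sum))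
  have h2 : |T.m k * ((w₁.map T.m).sum - (w₂.map T.m).sum)| ≤
      θ * (θ * w₁.length + θ * w₂.length) := by
    rw [abs_mul]
    refine mul_le_mul (B.m k) ((abs_sub _ _).trans ?_) (abs_nonneg _) (by linarith)
    exact add_le_add (B.abs_sum_m_le _) (B.abs_sum_m_le _)
  have h3 := B.s k
  linarith

theorem norm_prod_sub_prod_le (B : JetBound T θ) (w₁ w₂ : List E) (x : A) (b : ℝ) (hx : ‖T.D * x‖ ≤ b) :
    ‖((w₁.map T.N).prod - (w₂.map T.N).prod) * x‖ ≤ θ * (w₁.length + w₂.length) * b := by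
  rw [T.prod_eq, T.prod_eq, show (1 + T.D * T.listI w₁ - (1 + T.D * T.listI w₂)) * x =
    (T.listI w₁ - T.listI w₂) * (T.D * x) by ring]
  refine (norm_mul_le _ _).trans (mul_le_mul ?_ hx (norm_nonneg _) ?_)
  · linarith [norm_sub_le (T.listI w₁) (T.listI w₂), B.norm_listI_le w₁, B.norm_listI_le w₂]
  · have := B.one_le
    positivity

variable [NormOneClass A]

theorem norm_prod_le (B : JetBound T θ) (w : List E) : ‖(w.map T.N).prod‖ ≤ 1 := by
  induction w with
  | nil => simp
  | cons a w ih =>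
    rw [List.map_cons, List.prod_cons]
    exact (norm_mul_le _ _).trans (mul_le_one₀ (B.N a) (norm_nonneg _) ih)

variable [Fintype E] (R : RevChain E)

theorem norm_ret_le (B : JetBound T θ) (M : ℕ) (k : E) : ‖R.ret T.N M k‖ ≤ 1 := by
  induction M generalizing k with
  | zero => simp [R.ret_zero]
  | succ M ih =>
    rw [R.ret_succ]
    exact R.norm_sum_P_le k fun l =>
      (norm_mul_le _ _).trans (mul_le_one₀ (B.N l) (norm_nonneg _) (ih l))

theorem norm_fwd_le (B : JetBound T θ) (M : ℕ) (k : E) : ‖R.fwd T.N M k‖ ≤ 1 := by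
  cases M with
  | zero => simp [R.fwd_zero]
  | succ M =>
    rw [R.fwd_succ]
    exact (norm_mul_le _ _).trans (mul_le_one₀ (B.N k) (norm_nonneg _) (B.norm_ret_le R M k))

theorem norm_total_le (B : JetBound T θ) (M₁ M₂ : ℕ) : ‖T.total R M₁ M₂‖ ≤ 1 := by
  have h := R.norm_sum_π_le (f := fun k => R.symm.ret T.N M₁ k * T.N k * R.ret T.N M₂ k)
    (g := fun _ => 1) fun k => by
      refine (norm_mul_le _ _).trans (mul_le_one₀ ?_ (norm_nonneg _) (B.norm_ret_le R _ _))
      exact (norm_mul_le _ _).trans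
        (mul_le_one₀ (B.norm_ret_le R.symm _ _) (norm_nonneg _) (B.N k))
  simpa [R.π_sum, JetData.total] using h

end JetBound

/-- Quantitative smoothness and recurrence properties of a hidden Markov chain, at time scale
`n / 4`. -/
structure Mixing {E A : Type*} [Fintype E] [DecidableEq E] [NormedCommRing A] [NormedAlgebra ℝ A]
    (T : JetData E A) (R : RevChain E) (o : E) (n : ℕ) (β q t₁ t₂ : ℝ) : Prop where
  smooth : ∀ M, n / 4 ≤ M → ‖T.D * R.ret T.N M o‖ ≤ β
  smooth_symm : ∀ M, n / 4 ≤ M → ‖T.D * R.symm.ret T.N M o‖ ≤ β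
  taboo_le : ∀ s x, (n + 3) / 4 ≤ s → taboo R.pair.P (o, o) s x ≤ q
  taboo_symm_le : ∀ s x, (n + 3) / 4 ≤ s → taboo R.symm.pair.P (o, o) s x ≤ q
  sum_avoid : ∀ M, M ≤ n → ∑ s ∈ Finset.range M, R.pair.avoid (o, o) (s + 1) ≤ t₁
  joint_sq : ∀ M₁ M₂, M₁ + M₂ + 1 = n → R.pair.joint (o, o) M₁ M₂
    (fun _ u v => ((u.length : ℝ) + v.length + 1) ^ 2) ≤ t₂
  one_le : 1 ≤ t₁
  sq_le : t₁ ^ 2 ≤ t₂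

namespace RevChain

theorem sum_π_smul_sub {E A : Type*} [Fintype E] [AddCommGroup A] [Module ℝ A] (R : RevChain E)
    (x : A) (f : E → A) :
    x - ∑ k, R.π k • f k = ∑ k, R.π k • (x - f k) := by
  simp_rw [smul_sub]
  rw [Finset.sum_sub_distrib, ← Finset.sum_smul, R.π_sum, one_smul]

variable {E : Type*} [Fintype E] [DecidableEq E]

theorem sum_π_stopped_le (R : RevChain E) (o : E) (lab : E × E → E × E → E × E) (M r : ℕ)
    {a c q t₁ : ℝ} (ha : 0 ≤ a) (hc : 0 ≤ c)
    (ht : ∑ s ∈ Finset.range M, R.pair.avoid (o, o) (s + 1) ≤ t₁)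
    (hr : c = 0 ∨ ∀ k, taboo R.pair.P (o, o) r (o, k) ≤ q) :
    ∑ k, R.π k * stopped R.pair.P (o, o) lab M (o, k)
      (fun u => a * u.length + c * if r ≤ u.length then (1 : ℝ) else 0) ≤ a * t₁ + c * q := by
  have h1 : ∀ k, stopped R.pair.P (o, o) lab M (o, k)
      (fun u => a * u.length + c * if r ≤ u.length then (1 : ℝ) else 0) ≤
      a * ∑ s ∈ Finset.range M, taboo R.pair.P (o, o) (s + 1) (o, k) + c * q := by
    intro k
    rw [stopped_add, stopped_const_mul, ← stopped_length (lab := lab) R.pair.P_row,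
      stopped_const_mul]
    refine add_le_add le_rfl ?_
    rcases hr with rfl | hr
    · simp
    · exact mul_le_mul_of_nonneg_left ((stopped_indicator_le R.pair.P_nonneg
        R.pair.P_row M r (o, k)).trans (hr k)) hc
  have h2 : ∑ k, R.π k * ∑ s ∈ Finset.range M, taboo R.pair.P (o, o) (s + 1) (o, k) ≤ t₁ := by
    refine le_trans ?_ ht
    simp_rw [Finset.mul_sum]
    rw [Finset.sum_comm]
    exact Finset.sum_le_sum fun s _ => R.sum_π_taboo_le_avoid o (s + 1)
  calc _ ≤ ∑ k, R.π k *
        (a * ∑ s ∈ Finset.range M, taboo R.pair.P (o, o) (s + 1) (o, k) + c * q) :=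
      Finset.sum_le_sum fun k _ => mul_le_mul_of_nonneg_left (h1 k) (R.π_nonneg k)
    _ = a * (∑ k, R.π k * ∑ s ∈ Finset.range M, taboo R.pair.P (o, o) (s + 1) (o, k)) +
        c * q := by
      simp_rw [mul_add]
      rw [Finset.sum_add_distrib, ← Finset.sum_mul, R.π_sum, one_mul, Finset.mul_sum]
      congr 1
      exact Finset.sum_congr rfl fun k _ => by ring
    _ ≤ a * t₁ + c * q := by
      linarith [mul_le_mul_of_nonneg_left h2 ha]

end RevChain

namespace Mixing

variable {E A : Type*} [Fintype E] [DecidableEq E] [NormedCommRing A] [NormedAlgebra ℝ A]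
  {T : JetData E A} {R : RevChain E} {o : E} {n : ℕ} {β q t₁ t₂ θ : ℝ}

theorem beta_nonneg (H : Mixing T R o n β q t₁ t₂) : 0 ≤ β :=
  (norm_nonneg _).trans (H.smooth _ le_rfl)

theorem q_nonneg (H : Mixing T R o n β q t₁ t₂) : 0 ≤ q :=
  (taboo_nonneg R.pair.P_nonneg _ _).trans (H.taboo_le _ (o, o) le_rfl)

theorem smooth_fwd (H : Mixing T R o n β q t₁ t₂) (B : JetBound T θ) (M : ℕ) (hM : n / 4 + 1 ≤ M) :
    ‖T.D * R.fwd T.N M o‖ ≤ β := by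
  obtain ⟨M, rfl⟩ : ∃ M', M = M' + 1 := ⟨M - 1, by omega⟩
  rw [R.fwd_succ, mul_left_comm]
  refine (norm_mul_le _ _).trans ?_
  have h1 := H.smooth M (by omega)
  have h2 := B.N o
  nlinarith [norm_nonneg (T.N o), norm_nonneg (T.D * R.ret T.N M o)]

variable [NormOneClass A]

theorem smooth_fwd_of_le (H : Mixing T R o n β q t₁ t₂) (B : JetBound T θ) (M : ℕ) (l : E)
    (hM : n / 4 + (n + 3) / 4 ≤ M) :
    ‖T.D * R.fwd T.N M l‖ ≤ β + 2 * q := by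
  rw [R.fwd_eq_stopped_fst T.N o M (l, o), mul_stopped]
  refine (norm_stopped_le (Φ := fun u => β + 2 * if M - n / 4 ≤ u.length then (1 : ℝ) else 0)
    R.pair.P_nonneg M (l, o) fun u hu => ?_).trans ?_
  · have h1 : ‖(u.map fun a => T.N a.1).prod‖ ≤ 1 := by
      simpa [List.map_map, Function.comp_def] using B.norm_prod_le (u.map Prod.fst)
    rw [mul_left_comm]
    split_ifs with h
    · have h2 : ‖T.D * R.fwd T.N (M - u.length) o‖ ≤ 2 * 1 :=
        (norm_mul_le _ _).trans
          (mul_le_mul B.D_le (B.norm_fwd_le R _ _) (norm_nonneg _) zero_le_two)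
      have h3 := (norm_mul_le _ _).trans (mul_le_mul h1 h2 (norm_nonneg _) zero_le_one)
      linarith [H.beta_nonneg]
    · have h2 := H.smooth_fwd B (M - u.length) (by omega)
      have h3 := (norm_mul_le _ _).trans (mul_le_mul h1 h2 (norm_nonneg _) zero_le_one)
      linarith
  · rw [stopped_add, stopped_const R.pair.P_row, stopped_const_mul]
    have := stopped_indicator_le (lab := fun s (_ : E × E) => s) (z := (o, o)) R.pair.P_nonneg
      R.pair.P_row M (M - n / 4) (l, o)
    linarith [H.taboo_le (M - n / 4) (l, o) (by omega)]

/-- Replacing the state `o` at the start of the future by a stationary one. -/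
theorem norm_start_le (H : Mixing T R o n β q t₁ t₂) (B : JetBound T θ) (M : ℕ) (hM : M ≤ n) (a : A)
    (ha : ‖a‖ ≤ 1) (h : ‖T.D * a‖ ≤ β ∨ n / 4 + (n + 3) / 4 ≤ M) :
    ‖a * (R.fwd T.N M o - ∑ k, R.π k • R.fwd T.N M k)‖ ≤ 2 * θ * t₁ * β + 2 * q := by
  have hβ := H.beta_nonneg
  have hq := H.q_nonneg
  have hθ := B.one_le
  rw [R.sum_π_smul_sub, Finset.mul_sum]
  simp_rw [mul_smul_comm]
  obtain ⟨c, hc0, hc2, hc, hcc⟩ : ∃ c : ℝ, 0 ≤ c ∧ c ≤ 2 ∧ (c = 0 ∨ ∀ k, taboo R.pair.P (o, o) (M - n / 4) (o, k) ≤ q) ∧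
      (‖T.D * a‖ ≤ β ∨ c = 2) := by
    rcases h with h | h
    · exact ⟨0, le_rfl, zero_le_two, Or.inl rfl, Or.inl h⟩
    · exact ⟨2, zero_le_two, le_rfl, Or.inr fun k => H.taboo_le _ _ (by omega), Or.inr rfl⟩
  refine le_trans (R.norm_sum_π_le fun k => ?_)
    ((R.sum_π_stopped_le o (fun s _ => s) M (M - n / 4) (a := 2 * θ * β) (by positivity) hc0
      (H.sum_avoid M hM) hc).trans (by linarith [mul_le_mul_of_nonneg_right hc2 hq]))
  rw [R.fwd_eq_stopped_fst T.N o M (o, k), R.fwd_eq_stopped_snd T.N o M (o, k), ← stopped_sub,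
    mul_stopped]
  refine norm_stopped_le R.pair.P_nonneg M _ fun u hu => ?_
  have e1 : (u.map fun a => T.N a.1).prod = ((u.map Prod.fst).map T.N).prod := by
    simp [List.map_map, Function.comp_def]
  have e2 : (u.map fun a => T.N a.2).prod = ((u.map Prod.snd).map T.N).prod := by
    simp [List.map_map, Function.comp_def]
  rw [e1, e2, ← sub_mul, mul_left_comm]
  have hf := B.norm_fwd_le R (M - u.length) o
  have hpos : 0 ≤ c * if M - n / 4 ≤ u.length then (1 : ℝ) else 0 := by
    split_ifs <;> simp [hc0]
  have key : ‖T.D * (a * R.fwd T.N (M - u.length) o)‖ ≤ β →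
      ‖((List.map T.N (u.map Prod.fst)).prod - (List.map T.N (u.map Prod.snd)).prod) *
      (a * R.fwd T.N (M - u.length) o)‖ ≤ 2 * θ * β * u.length +
      c * if M - n / 4 ≤ u.length then (1 : ℝ) else 0 := by
    intro h
    have := B.norm_prod_sub_prod_le (u.map Prod.fst) (u.map Prod.snd) _ β h
    simp only [List.length_map] at this
    linarith
  rcases hcc with h | h
  · refine key ?_
    rw [← mul_assoc]
    exact (norm_mul_le _ _).trans
      ((mul_le_mul h hf (norm_nonneg _) hβ).trans (mul_one β).le)
  · by_cases hl : M - n / 4 ≤ u.length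
    · rw [if_pos hl, h]
      have h1 : ‖((List.map T.N (u.map Prod.fst)).prod - (List.map T.N (u.map Prod.snd)).prod)‖ ≤
          2 := by
        linarith [norm_sub_le (List.map T.N (u.map Prod.fst)).prod
          (List.map T.N (u.map Prod.snd)).prod, B.norm_prod_le (u.map Prod.fst),
          B.norm_prod_le (u.map Prod.snd)]
      have h2 : ‖a * R.fwd T.N (M - u.length) o‖ ≤ 1 :=
        (norm_mul_le _ _).trans (mul_le_one₀ ha (norm_nonneg _) hf)
      have h3 := (norm_mul_le _ _).trans (mul_le_mul h1 h2 (norm_nonneg _) zero_le_two)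
      have : 0 ≤ 2 * θ * β * u.length := by positivity
      linarith
    · refine key ?_
      rw [mul_left_comm]
      have h1 := H.smooth_fwd B (M - u.length) (by omega)
      exact (norm_mul_le _ _).trans
        ((mul_le_mul ha h1 (norm_nonneg _) zero_le_one).trans (one_mul β).le)

/-- Changing the number of sites in the future. -/
theorem norm_extend_le (H : Mixing T R o n β q t₁ t₂) (B : JetBound T θ) (M j : ℕ) (a : A)
    (ha : ‖a‖ ≤ 1) (h : ‖T.D * a‖ ≤ β ∨ n / 4 + (n + 3) / 4 ≤ M) :
    ‖a * (∑ k, R.π k • R.fwd T.N (M + j) k - ∑ k, R.π k • R.fwd T.N M k)‖ ≤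
      j * (θ * (β + 2 * q)) := by
  have hβ := H.beta_nonneg
  have hq := H.q_nonneg
  have hθ := B.one_le
  induction j with
  | zero => simp
  | succ j ih =>
    have h1 : ∑ k, R.π k • R.fwd T.N (M + (j + 1)) k - ∑ k, R.π k • R.fwd T.N (M + j) k =
        ∑ k, R.π k • (T.I k * (T.D * R.ret T.N (M + j) k)) := by
      rw [← R.stationary_smul fun k => R.fwd T.N (M + j) k]
      simp_rw [R.sum_P_fwd]
      rw [← Finset.sum_sub_distrib]
      refine Finset.sum_congr rfl fun k _ => ?_
      rw [← add_assoc, R.fwd_succ, ← smul_sub, T.N_eq]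
      congr 1
      ring
    have h2 : ‖a * ∑ k, R.π k • (T.I k * (T.D * R.ret T.N (M + j) k))‖ ≤ θ * (β + 2 * q) := by
      rw [Finset.mul_sum]
      simp_rw [mul_smul_comm]
      refine (R.norm_sum_π_le (g := fun _ => θ * (β + 2 * q)) fun k => ?_).trans
        (R.sum_π_le fun _ => le_rfl)
      rw [mul_left_comm]
      refine (norm_mul_le _ _).trans
        (mul_le_mul (B.I k) ?_ (norm_nonneg _) (by linarith))
      rcases h with h | h
      · rw [mul_left_comm, ← mul_assoc]
        refine (norm_mul_le _ _).trans
          ((mul_le_mul h (B.norm_ret_le R _ k) (norm_nonneg _) hβ).trans (by linarith))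
      · refine (norm_mul_le _ _).trans
          ((mul_le_mul ha (d := β + 2 * q) ?_ (norm_nonneg _) zero_le_one).trans (one_mul _).le)
        rw [← R.sum_P_fwd, Finset.mul_sum]
        simp_rw [mul_smul_comm]
        exact R.norm_sum_P_le k fun l => H.smooth_fwd_of_le B _ l (by omega)
    have h3 : a * (∑ k, R.π k • R.fwd T.N (M + (j + 1)) k - ∑ k, R.π k • R.fwd T.N M k) =
        a * (∑ k, R.π k • R.fwd T.N (M + (j + 1)) k - ∑ k, R.π k • R.fwd T.N (M + j) k) +
        a * (∑ k, R.π k • R.fwd T.N (M + j) k - ∑ k, R.π k • R.fwd T.N M k) := by ring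
    rw [h3, h1]
    refine (norm_add_le _ _).trans ((add_le_add h2 ih).trans (le_of_eq ?_))
    push_cast
    ring

/-- Replacing the state `o` at the end of the past by that at the start of the future. -/
theorem norm_past_le (H : Mixing T R o n β q t₁ t₂) (B : JetBound T θ) (t M : ℕ) (ht : t ≤ n)
    (h : n / 4 + (n + 3) / 4 ≤ t + 1 ∨ n / 4 + (n + 3) / 4 ≤ M) :
    ‖∑ k, R.π k • ((R.symm.ret T.N t o - R.symm.ret T.N t k) * R.fwd T.N M k)‖ ≤
      2 * θ * t₁ * (β + 2 * q) + 2 * q := by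
  have hβ := H.beta_nonneg
  have hq := H.q_nonneg
  have hθ := B.one_le
  have ha : ∀ s, R.symm.pair.avoid (o, o) s = R.pair.avoid (o, o) s :=
    fun s => R.pair.avoid_symm (o, o) s
  obtain ⟨c, hc0, hc2, hc, hcc⟩ : ∃ c : ℝ, 0 ≤ c ∧ c ≤ 2 ∧
      (c = 0 ∨ ∀ k, taboo R.symm.pair.P (o, o) (t + 1 - n / 4) (o, k) ≤ q) ∧
      (n / 4 + (n + 3) / 4 ≤ M ∨ c = 2) := by
    rcases h with h | h
    · exact ⟨2, zero_le_two, le_rfl, Or.inr fun k => H.taboo_symm_le _ _ (by omega), Or.inr rfl⟩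
    · exact ⟨0, le_rfl, zero_le_two, Or.inl rfl, Or.inl h⟩
  refine le_trans (R.norm_sum_π_le fun k => ?_)
    ((R.symm.sum_π_stopped_le o (fun _ s => s) t (t + 1 - n / 4) (a := 2 * θ * (β + 2 * q))
      (by positivity) hc0 (by simpa only [ha] using H.sum_avoid t ht) hc).trans
      (by linarith [mul_le_mul_of_nonneg_right hc2 hq]))
  rw [R.symm.ret_eq_stopped_fst T.N o t (o, k), R.symm.ret_eq_stopped_snd T.N o t (o, k),
    ← stopped_sub, stopped_mul]
  refine norm_stopped_le R.symm.pair.P_nonneg t _ fun u hu => ?_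
  have e1 : (u.map fun a => T.N a.1).prod = ((u.map Prod.fst).map T.N).prod := by
    simp [List.map_map, Function.comp_def]
  have e2 : (u.map fun a => T.N a.2).prod = ((u.map Prod.snd).map T.N).prod := by
    simp [List.map_map, Function.comp_def]
  rw [e1, e2, ← sub_mul, mul_assoc]
  have hf := B.norm_fwd_le R M k
  have hg := B.norm_ret_le R.symm (t - u.length) o
  have hpos : 0 ≤ c * if t + 1 - n / 4 ≤ u.length then (1 : ℝ) else 0 := by
    split_ifs <;> simp [hc0]
  have key : ‖T.D * (R.symm.ret T.N (t - u.length) o * R.fwd T.N M k)‖ ≤ β + 2 * q →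
      ‖((List.map T.N (u.map Prod.fst)).prod - (List.map T.N (u.map Prod.snd)).prod) *
      (R.symm.ret T.N (t - u.length) o * R.fwd T.N M k)‖ ≤ 2 * θ * (β + 2 * q) * u.length +
      c * if t + 1 - n / 4 ≤ u.length then (1 : ℝ) else 0 := by
    intro h
    have := B.norm_prod_sub_prod_le (u.map Prod.fst) (u.map Prod.snd) _ (β + 2 * q) h
    simp only [List.length_map] at this
    linarith
  rcases hcc with h | h
  · refine key ?_
    rw [mul_left_comm]
    have h1 := H.smooth_fwd_of_le B M k h
    exact (norm_mul_le _ _).trans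
      ((mul_le_mul hg h1 (norm_nonneg _) zero_le_one).trans (one_mul _).le)
  · by_cases hl : t + 1 - n / 4 ≤ u.length
    · rw [if_pos hl, h]
      have h1 : ‖((List.map T.N (u.map Prod.fst)).prod - (List.map T.N (u.map Prod.snd)).prod)‖ ≤
          2 := by
        linarith [norm_sub_le (List.map T.N (u.map Prod.fst)).prod
          (List.map T.N (u.map Prod.snd)).prod, B.norm_prod_le (u.map Prod.fst),
          B.norm_prod_le (u.map Prod.snd)]
      have h2 : ‖R.symm.ret T.N (t - u.length) o * R.fwd T.N M k‖ ≤ 1 :=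
        (norm_mul_le _ _).trans (mul_le_one₀ hg (norm_nonneg _) hf)
      have h3 := (norm_mul_le _ _).trans (mul_le_mul h1 h2 (norm_nonneg _) zero_le_two)
      have : 0 ≤ 2 * θ * (β + 2 * q) * u.length := by positivity
      linarith
    · refine key ?_
      rw [← mul_assoc]
      have h1 := H.smooth_symm (t - u.length) (by omega)
      have h2 := (norm_mul_le _ _).trans (mul_le_mul h1 hf (norm_nonneg _) hβ)
      linarith

/-- Decoupling the past, the future and the joint excursion. -/
theorem norm_tails_sub_total_le (H : Mixing T R o n β q t₁ t₂) (B : JetBound T θ) (hn : 2 ≤ n)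
    (M₁ M₂ : ℕ) (hM : M₁ + M₂ + 1 = n) (u v : List (E × E)) (hu : u.length ≤ M₁)
    (hv : v.length ≤ M₂)
    (h : n / 4 ≤ M₁ - u.length ∨ n - (n / 4 + (n + 3) / 4) + 1 ≤ M₂ - v.length) :
    ‖T.tails R o M₁ M₂ u v - T.total R M₁ M₂‖ ≤
      4 * θ * t₁ * (β + q) + 4 * q + (u.length + v.length + 1) * (θ * (β + 2 * q)) := by
  set t := M₁ - u.length with ht
  set t' := M₂ - v.length with ht'
  have ha := B.norm_ret_le R.symm t o
  have hc : ‖T.D * R.symm.ret T.N t o‖ ≤ β ∨ n / 4 + (n + 3) / 4 ≤ t' := by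
    rcases h with h | h
    · exact Or.inl (H.smooth_symm t h)
    · exact Or.inr (by omega)
  have h1 := H.norm_start_le B t' (by omega) _ ha hc
  have h2 := H.norm_extend_le B t' (u.length + v.length + 1) _ ha hc
  have h3 := H.norm_past_le B t (n - t) (by omega) (by omega)
  have e : t' + (u.length + v.length + 1) = n - t := by omega
  rw [e] at h2
  have e2 : T.tails R o M₁ M₂ u v - T.total R M₁ M₂ =
      R.symm.ret T.N t o * (R.fwd T.N t' o - ∑ k, R.π k • R.fwd T.N t' k) +
      (-(R.symm.ret T.N t o * (∑ k, R.π k • R.fwd T.N (n - t) k -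
        ∑ k, R.π k • R.fwd T.N t' k))) +
      ∑ k, R.π k • ((R.symm.ret T.N t o - R.symm.ret T.N t k) * R.fwd T.N (n - t) k) := by
    rw [T.total_eq R M₁ M₂ t (by omega), hM, JetData.tails]
    simp_rw [sub_mul, smul_sub]
    rw [Finset.sum_sub_distrib]
    simp_rw [← mul_smul_comm (R.π _) (R.symm.ret T.N t o)]
    rw [← Finset.mul_sum]
    ring
  rw [e2]
  refine (norm_add₃_le).trans ?_
  rw [norm_neg]
  push_cast at h2
  linarith

end Mixing

namespace Mixing

variable {E A : Type*} [Fintype E] [DecidableEq E] [NormedCommRing A] [NormedAlgebra ℝ A]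
  [NormOneClass A]
  {T : JetData E A} {R : RevChain E} {o : E} {n : ℕ} {β q t₁ t₂ θ : ℝ}

theorem norm_rem_summand_le (B : JetBound T θ) (M₁ M₂ : ℕ) (x : E × E) (u v : List (E × E)) :
    ‖T.swapA x.1 (JetData.sites₁ u v) (JetData.sites₂ x u v) * T.tails R o M₁ M₂ u v -
      T.swapC x.1 (JetData.sites₁ u v) (JetData.sites₂ x u v) • T.total R M₁ M₂‖ ≤
    4 * θ ^ 2 * (u.length + v.length + 1) := by
  have hA := B.norm_swapA_le x.1 (JetData.sites₁ u v) (JetData.sites₂ x u v)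
  have hC := B.abs_swapC_le x.1 (JetData.sites₁ u v) (JetData.sites₂ x u v)
  have h1 : ((JetData.sites₁ u v).length : ℝ) = u.length + v.length := by
    simp [JetData.sites₁]
  have h2 : ((JetData.sites₂ x u v).length : ℝ) = u.length + v.length + 1 := by
    simp [JetData.sites₂]
  rw [h1, h2] at hA hC
  have ht : ‖T.tails R o M₁ M₂ u v‖ ≤ 1 :=
    (norm_mul_le _ _).trans (mul_le_one₀ (B.norm_ret_le R.symm _ _) (norm_nonneg _)
      (B.norm_fwd_le R _ _))
  have hL := B.norm_total_le R M₁ M₂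
  refine (norm_sub_le _ _).trans ?_
  have h3 := (norm_mul_le (T.swapA x.1 (JetData.sites₁ u v) (JetData.sites₂ x u v))
    (T.tails R o M₁ M₂ u v)).trans (mul_le_of_le_one_right (norm_nonneg _) ht)
  have h4 : ‖T.swapC x.1 (JetData.sites₁ u v) (JetData.sites₂ x u v) • T.total R M₁ M₂‖ ≤
      |T.swapC x.1 (JetData.sites₁ u v) (JetData.sites₂ x u v)| := by
    rw [norm_smul]
    exact mul_le_of_le_one_right (norm_nonneg _) hL
  linarith

theorem norm_rem_summand_le_of_smooth (H : Mixing T R o n β q t₁ t₂) (B : JetBound T θ)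
    (hn : 2 ≤ n) (M₁ M₂ : ℕ) (hM : M₁ + M₂ + 1 = n) (x : E × E) (u v : List (E × E))
    (hu : u.length ≤ M₁) (hv : v.length ≤ M₂)
    (h : n / 4 ≤ M₁ - u.length ∨ n - (n / 4 + (n + 3) / 4) + 1 ≤ M₂ - v.length) :
    ‖T.swapA x.1 (JetData.sites₁ u v) (JetData.sites₂ x u v) * T.tails R o M₁ M₂ u v -
      T.swapC x.1 (JetData.sites₁ u v) (JetData.sites₂ x u v) • T.total R M₁ M₂‖ ≤
    4 * θ ^ 3 * (t₁ ^ 2 + (u.length + v.length + 1) ^ 2) * (β + q) +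
      4 * θ ^ 3 * (u.length + v.length + 1) ^ 2 * (β + 3 * q) := by
  have hθ := B.one_le
  have hβ := H.beta_nonneg
  have hq := H.q_nonneg
  have ht1 := H.one_le
  have hC := B.abs_swapC_le x.1 (JetData.sites₁ u v) (JetData.sites₂ x u v)
  have hA := B.norm_swapA₂_le x.1 (JetData.sites₁ u v) (JetData.sites₂ x u v)
  have h1 : ((JetData.sites₁ u v).length : ℝ) = u.length + v.length := by
    simp [JetData.sites₁]
  have h2 : ((JetData.sites₂ x u v).length : ℝ) = u.length + v.length + 1 := by
    simp [JetData.sites₂]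
  rw [h1, h2] at hC hA
  have hN : (1 : ℝ) ≤ u.length + v.length + 1 := by
    have : (0 : ℝ) ≤ (u.length : ℝ) + v.length := by positivity
    linarith
  have hS := H.norm_tails_sub_total_le B hn M₁ M₂ hM u v hu hv h
  have hD : ‖T.D * T.tails R o M₁ M₂ u v‖ ≤ β := by
    rw [JetData.tails]
    rcases h with h | h
    · rw [← mul_assoc]
      have h3 := H.smooth_symm _ h
      exact (norm_mul_le _ _).trans
        ((mul_le_mul h3 (B.norm_fwd_le R _ _) (norm_nonneg _) hβ).trans (mul_one _).le)
    · rw [mul_left_comm]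
      have h3 := H.smooth_fwd B (M₂ - v.length) (by omega)
      exact (norm_mul_le _ _).trans
        ((mul_le_mul (B.norm_ret_le R.symm _ _) h3 (norm_nonneg _) zero_le_one).trans
          (one_mul _).le)
  rw [T.swapA_eq]
  set c := T.swapC x.1 (JetData.sites₁ u v) (JetData.sites₂ x u v)
  set a := T.swapA₂ x.1 (JetData.sites₁ u v) (JetData.sites₂ x u v)
  set N : ℝ := (u.length : ℝ) + v.length + 1 with hNdef
  have e : (algebraMap ℝ A c + T.D * a) * T.tails R o M₁ M₂ u v - c • T.total R M₁ M₂ =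
      c • (T.tails R o M₁ M₂ u v - T.total R M₁ M₂) + a * (T.D * T.tails R o M₁ M₂ u v) := by
    rw [Algebra.smul_def, Algebra.smul_def]
    ring
  rw [e]
  have h5 : ‖c • (T.tails R o M₁ M₂ u v - T.total R M₁ M₂)‖ ≤
      (2 * θ ^ 2 * N) * (4 * θ * t₁ * (β + q) + 4 * q + N * (θ * (β + 2 * q))) := by
    rw [norm_smul]
    refine mul_le_mul (hC.trans (by linarith)) hS (norm_nonneg _) (by positivity)
  have h6 : ‖a * (T.D * T.tails R o M₁ M₂ u v)‖ ≤ (2 * θ ^ 3 * N ^ 2) * β := by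
    refine (norm_mul_le _ _).trans (mul_le_mul (hA.trans ?_) hD (norm_nonneg _) (by positivity))
    rw [show (u.length : ℝ) + v.length = N - 1 by rw [hNdef]; ring]
    have h3 : 0 ≤ θ ^ 3 := by positivity
    have hNN : 1 + (N - 1) + (N - 1) * N / 2 + N * (N + 1) / 2 ≤ 2 * N ^ 2 := by nlinarith
    have := mul_le_mul_of_nonneg_left hNN h3
    linarith
  have h7 : 2 * t₁ * N ≤ t₁ ^ 2 + N ^ 2 := by nlinarith [sq_nonneg (t₁ - N)]
  have h8 : 8 * θ ^ 2 * N * q ≤ 8 * θ ^ 3 * N ^ 2 * q := by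
    have : θ ^ 2 * N ≤ θ ^ 3 * N ^ 2 := by
      have e1 : θ ^ 2 * 1 ≤ θ ^ 2 * θ := mul_le_mul_of_nonneg_left hθ (by positivity)
      have e2 : N * 1 ≤ N * N := mul_le_mul_of_nonneg_left hN (by positivity)
      calc θ ^ 2 * N ≤ (θ ^ 2 * θ) * (N * N) :=
            mul_le_mul (by linarith) (by linarith) (by positivity) (by positivity)
        _ = _ := by ring
    nlinarith [mul_le_mul_of_nonneg_right this hq]
  have h9 : 4 * θ ^ 3 * (2 * t₁ * N) * (β + q) ≤ 4 * θ ^ 3 * (t₁ ^ 2 + N ^ 2) * (β + q) :=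
    mul_le_mul_of_nonneg_right (mul_le_mul_of_nonneg_left h7 (by positivity)) (by positivity)
  refine (norm_add_le _ _).trans ((add_le_add h5 h6).trans ?_)
  nlinarith

theorem norm_rem_le (H : Mixing T R o n β q t₁ t₂) (B : JetBound T θ) (M₁ M₂ : ℕ)
    (hM : M₁ + M₂ + 1 = n) :
    ‖T.rem R o M₁ M₂‖ ≤ 14 * θ ^ 3 * t₂ * (β + n * q) := by
  have hθ := B.one_le
  have hβ := H.beta_nonneg
  have hq := H.q_nonneg
  have ht1 := H.one_le
  have ht2 : 1 ≤ t₂ := by nlinarith [H.sq_le]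
  have hθ3 : θ ^ 2 ≤ θ ^ 3 := by nlinarith [sq_nonneg θ]
  have hθ1 : 1 ≤ θ ^ 2 := one_le_pow₀ hθ
  rcases Nat.lt_or_ge n 2 with hn | hn
  · obtain rfl : n = 1 := by omega
    obtain rfl : M₁ = 0 := by omega
    obtain rfl : M₂ = 0 := by omega
    have h1 : ‖T.rem R o 0 0‖ ≤ 4 * θ ^ 2 := by
      refine (RevChain.norm_joint_le (G := fun _ _ _ => 4 * θ ^ 2) _ _
        fun x u v hu hv => ?_).trans (RevChain.joint_const _ _ _).le
      have := norm_rem_summand_le (R := R) (o := o) B 0 0 x u v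
      have hu' : (u.length : ℝ) = 0 := by exact_mod_cast Nat.le_zero.mp hu
      have hv' : (v.length : ℝ) = 0 := by exact_mod_cast Nat.le_zero.mp hv
      rw [hu', hv'] at this
      linarith
    have h2 : 1 ≤ β := by
      have := H.smooth 0 (by norm_num)
      rw [R.ret_zero, mul_one] at this
      exact B.le_D.trans this
    have h3 : 1 ≤ θ ^ 3 * t₂ := by nlinarith
    have h4 : θ ^ 3 * 1 ≤ θ ^ 3 * t₂ := mul_le_mul_of_nonneg_left ht2 (by positivity)
    have h5 : θ ^ 3 * t₂ * 1 ≤ θ ^ 3 * t₂ * (β + (1 : ℕ) * q) :=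
      mul_le_mul_of_nonneg_left (by push_cast; linarith) (by positivity)
    nlinarith
  · set s := M₁ + 1 - n / 4 with hs
    set s' := M₂ - (n - (n / 4 + (n + 3) / 4)) with hs'
    have h1 : ‖T.rem R o M₁ M₂‖ ≤ R.pair.joint (o, o) M₁ M₂ fun _ u v =>
        4 * θ ^ 2 * n * ((if s ≤ u.length then (1 : ℝ) else 0) *
          (if s' ≤ v.length then (1 : ℝ) else 0)) +
        (4 * θ ^ 3 * t₁ ^ 2 * (β + q) +
          (8 * θ ^ 3 * β + 16 * θ ^ 3 * q) * ((u.length : ℝ) + v.length + 1) ^ 2) := by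
      refine RevChain.norm_joint_le _ _ fun x u v hu hv => ?_
      by_cases h : n / 4 ≤ M₁ - u.length ∨ n - (n / 4 + (n + 3) / 4) + 1 ≤ M₂ - v.length
      · refine (H.norm_rem_summand_le_of_smooth B hn M₁ M₂ hM x u v hu hv h).trans ?_
        have : 0 ≤ 4 * θ ^ 2 * n * ((if s ≤ u.length then (1 : ℝ) else 0) *
          (if s' ≤ v.length then (1 : ℝ) else 0)) := by
          split_ifs <;> simp; positivity
        nlinarith
      · rw [if_pos (by omega), if_pos (by omega)]
        refine (norm_rem_summand_le B M₁ M₂ x u v).trans ?_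
        have hN : (u.length : ℝ) + v.length + 1 ≤ n := by
          rw [← hM]
          push_cast
          have h1 : (u.length : ℝ) ≤ M₁ := by exact_mod_cast hu
          have h2 : (v.length : ℝ) ≤ M₂ := by exact_mod_cast hv
          linarith
        have h2 := mul_le_mul_of_nonneg_left hN (show 0 ≤ 4 * θ ^ 2 by positivity)
        have h3 : 0 ≤ 4 * θ ^ 3 * t₁ ^ 2 * (β + q) := by positivity
        have h4 : 0 ≤ (8 * θ ^ 3 * β + 16 * θ ^ 3 * q) * ((u.length : ℝ) + v.length + 1) ^ 2 := by
          positivity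
        linarith
    have h2 := R.pair.joint_ite_le (M₁ := M₁) (M₂ := M₂) (o, o) s s'
    have h3 : R.pair.avoid (o, o) (s + s') ≤ q :=
      RevChain.avoid_le _ _ fun x => H.taboo_le _ x (by omega)
    rw [RevChain.joint_add, RevChain.joint_add, RevChain.joint_const, RevChain.joint_const_mul,
      RevChain.joint_const_mul] at h1
    have h4 := H.joint_sq M₁ M₂ hM
    have h5 := mul_le_mul_of_nonneg_left (h2.trans h3) (show 0 ≤ 4 * θ ^ 2 * n by positivity)
    have h6 := mul_le_mul_of_nonneg_left h4
      (show 0 ≤ 8 * θ ^ 3 * β + 16 * θ ^ 3 * q by positivity)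
    have h7 := mul_le_mul_of_nonneg_left H.sq_le (show 0 ≤ 4 * θ ^ 3 * (β + q) by positivity)
    have h8 : 4 * θ ^ 2 * n * q ≤ 4 * θ ^ 3 * t₂ * (n * q) := by
      have : θ ^ 2 * 1 ≤ θ ^ 3 * t₂ := mul_le_mul hθ3 ht2 zero_le_one (by positivity)
      have hnq : 0 ≤ (n : ℝ) * q := by positivity
      nlinarith [mul_le_mul_of_nonneg_right this hnq]
    have hn' : (2 : ℝ) ≤ n := by exact_mod_cast hn
    have h9 : 0 ≤ θ ^ 3 * t₂ := by positivity
    have h10 : 20 * q ≤ 10 * (n * q) := by nlinarith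
    have h11 : θ ^ 3 * t₂ * (20 * q) ≤ θ ^ 3 * t₂ * (10 * (n * q)) :=
      mul_le_mul_of_nonneg_left h10 h9
    have h12 : 0 ≤ θ ^ 3 * t₂ * β := by positivity
    refine h1.trans ?_
    linarith

end Mixing

/-- A probability mass function on `ℕ` satisfying the recursion of the Poisson distribution. -/
structure PoissonSeq (lam : ℝ) (p : ℕ → ℝ) : Prop where
  lam_pos : 0 < lam
  pos : ∀ k, 0 < p k
  hasSum : HasSum p 1
  recur : ∀ k, lam * p k = (k + 1) * p (k + 1)

/-- The solution of Stein's equation for the Poisson distribution with test function `h`. -/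
noncomputable def steinSol (p h : ℕ → ℝ) (k : ℕ) : ℝ :=
  (∑ i ∈ Finset.range k, p i * (h i - ∑' j, p j * h j)) / (k * p k)

namespace PoissonSeq

variable {lam : ℝ} {p h : ℕ → ℝ}

theorem steinSol_eq (H : PoissonSeq lam p) (h : ℕ → ℝ) (j : ℕ) :
    lam * steinSol p h (j + 1) - j * steinSol p h j = h j - ∑' i, p i * h i := by
  have hj := (H.pos j).ne'
  have hj1 := (H.pos (j + 1)).ne'
  have hr := H.recur j
  have hl := H.lam_pos.ne'
  have e1 : lam * steinSol p h (j + 1) =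
      (∑ i ∈ Finset.range (j + 1), p i * (h i - ∑' j, p j * h j)) / p j := by
    rw [steinSol]
    push_cast
    rw [← hr]
    field_simp
  have e2 : j * steinSol p h j =
      (∑ i ∈ Finset.range j, p i * (h i - ∑' j, p j * h j)) / p j := by
    rw [steinSol]
    rcases Nat.eq_zero_or_pos j with rfl | h0
    · simp
    · have : (j : ℝ) ≠ 0 := by positivity
      field_simp
  rw [e1, e2, Finset.sum_range_succ]
  field_simp
  ring

theorem cross_le (H : PoissonSeq lam p) {i k : ℕ} (hik : i ≤ k) :
    p (k + 1) * p i ≤ p k * p (i + 1) := by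
  have h1 := H.recur k
  have h2 := H.recur i
  have hk := H.pos k
  have hi := H.pos i
  have e1 : p (k + 1) = lam * p k / (k + 1) := by field_simp; linarith
  have e2 : p (i + 1) = lam * p i / (i + 1) := by field_simp; linarith
  rw [e1, e2, div_mul_eq_mul_div, mul_div_assoc', div_le_div_iff₀ (by positivity) (by positivity)]
  have : (i : ℝ) ≤ k := by exact_mod_cast hik
  have hl := H.lam_pos
  have : 0 ≤ lam * p k * p i * (k - i) := by
    apply mul_nonneg (by positivity); linarith
  nlinarith

theorem head_le (H : PoissonSeq lam p) (k : ℕ) :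
    p (k + 1) * ∑ i ∈ Finset.range (k + 1), p i ≤ p k * ∑ i ∈ Finset.range (k + 2), p i := by
  rw [Finset.sum_range_succ' _ (k + 1), Finset.mul_sum, mul_add, Finset.mul_sum]
  have : ∑ i ∈ Finset.range (k + 1), p (k + 1) * p i ≤
      ∑ i ∈ Finset.range (k + 1), p k * p (i + 1) :=
    Finset.sum_le_sum fun i hi => H.cross_le (by simp at hi; omega)
  have := mul_pos (H.pos k) (H.pos 0)
  linarith

theorem summable_shift (H : PoissonSeq lam p) (k : ℕ) : Summable fun i => p (i + k) :=
  (summable_nat_add_iff k).2 H.hasSum.summable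

theorem tail_le (H : PoissonSeq lam p) (k : ℕ) :
    p k * ∑' i, p (i + (k + 2)) ≤ p (k + 1) * ∑' i, p (i + (k + 1)) := by
  rw [← tsum_mul_left, ← tsum_mul_left]
  refine Summable.tsum_le_tsum (fun i => ?_) ((H.summable_shift _).mul_left _)
    ((H.summable_shift _).mul_left _)
  have := H.cross_le (show k ≤ i + (k + 1) by omega)
  rw [show i + (k + 2) = i + (k + 1) + 1 by ring]
  linarith

theorem summable_mul (H : PoissonSeq lam p) (h0 : ∀ i, 0 ≤ h i) (h1 : ∀ i, h i ≤ 1) :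
    Summable fun i => p i * h i :=
  H.hasSum.summable.of_nonneg_of_le (fun i => mul_nonneg (H.pos i).le (h0 i))
    fun i => mul_le_of_le_one_right (H.pos i).le (h1 i)

theorem tsum_tail_mul_le (H : PoissonSeq lam p) (h0 : ∀ i, 0 ≤ h i) (h1 : ∀ i, h i ≤ 1) (k : ℕ) :
    ∑' i, p (i + k) * h (i + k) ≤ ∑' i, p (i + k) := by
  refine Summable.tsum_le_tsum (fun i => mul_le_of_le_one_right (H.pos _).le (h1 _))
    ((summable_nat_add_iff k).2 (H.summable_mul h0 h1)) (H.summable_shift k)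

theorem sum_centred (H : PoissonSeq lam p) (h0 : ∀ i, 0 ≤ h i) (h1 : ∀ i, h i ≤ 1) (k : ℕ) :
    ∑ i ∈ Finset.range k, p i * (h i - ∑' j, p j * h j) =
      (∑ i ∈ Finset.range k, p i * h i) * (∑' i, p (i + k)) -
      (∑' i, p (i + k) * h (i + k)) * ∑ i ∈ Finset.range k, p i := by
  have e1 := (H.summable_mul h0 h1).sum_add_tsum_nat_add k
  have e2 := H.hasSum.summable.sum_add_tsum_nat_add k
  rw [H.hasSum.tsum_eq] at e2
  simp only [mul_sub, Finset.sum_sub_distrib, ← Finset.sum_mul]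
  rw [← e1]
  linear_combination (-∑ i ∈ Finset.range k, p i * h i) * e2

theorem tail_ratio_le (H : PoissonSeq lam p) (k : ℕ) :
    (∑' i, p (i + (k + 1))) * p 0 ≤ p k := by
  induction k with
  | zero =>
    have e2 := H.hasSum.summable.sum_add_tsum_nat_add 1
    rw [H.hasSum.tsum_eq] at e2
    simp at e2
    have := H.pos 0
    simp only [zero_add]
    nlinarith
  | succ k ih =>
    have h1 := H.tail_le k
    have hk := H.pos k
    have hk1 := H.pos (k + 1)
    have h0 := H.pos 0
    have := mul_le_mul_of_nonneg_left ih hk1.le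
    have := mul_le_mul_of_nonneg_right h1 h0.le
    refine le_of_mul_le_mul_left ?_ hk
    calc p k * ((∑' i, p (i + (k + 1 + 1))) * p 0) = p k * (∑' i, p (i + (k + 2))) * p 0 := by
          rw [show k + 1 + 1 = k + 2 by ring]; ring
      _ ≤ _ := by nlinarith

theorem abs_steinSol_le (H : PoissonSeq lam p) (h0 : ∀ i, 0 ≤ h i) (h1 : ∀ i, h i ≤ 1) (k : ℕ) :
    |steinSol p h k| ≤ 1 / (lam * p 0) := by
  have hl := H.lam_pos
  have hp0 := H.pos 0
  rcases k with _ | k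
  · simp only [steinSol, Finset.range_zero, Finset.sum_empty, zero_div, abs_zero]
    positivity
  have hk := H.pos k
  rw [steinSol, H.sum_centred h0 h1]
  push_cast
  rw [← H.recur k, abs_div, abs_of_pos (mul_pos hl hk), div_le_div_iff₀ (by positivity)
    (by positivity), one_mul]
  have e2 := H.hasSum.summable.sum_add_tsum_nat_add (k + 1)
  rw [H.hasSum.tsum_eq] at e2
  have hT : 0 ≤ ∑' i, p (i + (k + 1)) := tsum_nonneg fun i => (H.pos _).le
  have hc := H.tsum_tail_mul_le h0 h1 (k + 1)
  have hc0 : 0 ≤ ∑' i, p (i + (k + 1)) * h (i + (k + 1)) :=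
    tsum_nonneg fun i => mul_nonneg (H.pos _).le (h0 _)
  have ha : ∑ i ∈ Finset.range (k + 1), p i * h i ≤ ∑ i ∈ Finset.range (k + 1), p i :=
    Finset.sum_le_sum fun i _ => mul_le_of_le_one_right (H.pos _).le (h1 _)
  have ha0 : 0 ≤ ∑ i ∈ Finset.range (k + 1), p i * h i :=
    Finset.sum_nonneg fun i _ => mul_nonneg (H.pos _).le (h0 _)
  have hr := H.tail_ratio_le k
  generalize (∑ i ∈ Finset.range (k + 1), p i * h i) = a at *
  generalize (∑ i ∈ Finset.range (k + 1), p i) = F at *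
  generalize (∑' i, p (i + (k + 1)) * h (i + (k + 1))) = c at *
  generalize (∑' i, p (i + (k + 1))) = T at *
  have : |a * T - c * F| ≤ T := by
    rw [abs_le]
    constructor <;> nlinarith [mul_nonneg ha0 hT, mul_nonneg hc0 (ha0.trans ha)]
  calc |a * T - c * F| * (lam * p 0) ≤ T * (lam * p 0) := by gcongr
    _ = lam * (T * p 0) := by ring
    _ ≤ _ := by gcongr

theorem steinSol_sub_le (H : PoissonSeq lam p) (h0 : ∀ i, 0 ≤ h i) (h1 : ∀ i, h i ≤ 1) (k : ℕ) :
    steinSol p h (k + 1) - steinSol p h k ≤ 1 / lam := by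
  have hl := H.lam_pos
  rcases k with _ | k
  · have e := H.steinSol_eq h 0
    have : 0 ≤ ∑' i, p i * h i := tsum_nonneg fun i => mul_nonneg (H.pos _).le (h0 _)
    have z : steinSol p h 0 = 0 := by simp [steinSol]
    rw [z, sub_zero, le_div_iff₀ hl]
    have := h1 0
    simp only [Nat.cast_zero, zero_mul, sub_zero] at e
    linarith
  have hp := H.pos k
  have hp1 := H.pos (k + 1)
  rw [steinSol, steinSol, H.sum_centred h0 h1, H.sum_centred h0 h1, Finset.sum_range_succ _ (k + 1),
    Finset.sum_range_succ _ (k + 1)]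
  have hr := H.recur k
  have hr1 := H.recur (k + 1)
  push_cast at hr1 ⊢
  rw [← hr, ← hr1]
  have e2 := H.hasSum.summable.sum_add_tsum_nat_add (k + 1)
  rw [H.hasSum.tsum_eq] at e2
  have hT1 : ∑' i, p (i + (k + 1)) = p (k + 1) + ∑' i, p (i + (k + 1 + 1)) := by
    rw [(H.summable_shift _).tsum_eq_zero_add]
    congr 1
    · simp
    · exact tsum_congr fun i => by congr 1; ring
  have hc1 : ∑' i, p (i + (k + 1)) * h (i + (k + 1)) =
      p (k + 1) * h (k + 1) + ∑' i, p (i + (k + 1 + 1)) * h (i + (k + 1 + 1)) := by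
    rw [((summable_nat_add_iff (k + 1)).2 (H.summable_mul h0 h1)).tsum_eq_zero_add]
    congr 1
    · simp
    · exact tsum_congr fun i => by rw [show i + 1 + (k + 1) = i + (k + 1 + 1) by ring]
  rw [hT1] at e2 ⊢
  rw [hc1]
  have hT : 0 ≤ ∑' i, p (i + (k + 1 + 1)) := tsum_nonneg fun i => (H.pos _).le
  have hc0 : 0 ≤ ∑' i, p (i + (k + 1 + 1)) * h (i + (k + 1 + 1)) :=
    tsum_nonneg fun i => mul_nonneg (H.pos _).le (h0 _)
  have ha0 : 0 ≤ ∑ i ∈ Finset.range (k + 1), p i * h i :=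
    Finset.sum_nonneg fun i _ => mul_nonneg (H.pos _).le (h0 _)
  have hF0 : 0 ≤ ∑ i ∈ Finset.range (k + 1), p i := Finset.sum_nonneg fun i _ => (H.pos _).le
  have hhead := H.head_le k
  rw [Finset.sum_range_succ _ (k + 1)] at hhead
  have htail := H.tail_le k
  rw [hT1, show k + 2 = k + 1 + 1 by ring] at htail
  have hb0 := mul_nonneg hp1.le (h0 (k + 1))
  have hb1 := mul_le_of_le_one_right hp1.le (h1 (k + 1))
  generalize (∑ i ∈ Finset.range (k + 1), p i * h i) = a at *
  generalize (∑ i ∈ Finset.range (k + 1), p i) = F at *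
  generalize (∑' i, p (i + (k + 1 + 1)) * h (i + (k + 1 + 1))) = c at *
  generalize (∑' i, p (i + (k + 1 + 1))) = T at *
  generalize p (k + 1) * h (k + 1) = b at *
  generalize p (k + 1) = P at *
  generalize p k = Q at *
  rw [div_sub_div _ _ (by positivity) (by positivity), div_le_div_iff₀ (by positivity) hl]
  have key : ((a + b) * T - c * (F + P)) * Q - P * (a * (P + T) - (b + c) * F) ≤ P * Q := by
    have k1 : a * (T * Q - P * (P + T)) ≤ 0 := by nlinarith
    have k2 : c * (P * F - Q * (F + P)) ≤ 0 := by nlinarith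
    have k3 : b * (T * Q + P * F) ≤ P * (T * Q + Q * (F + P)) := by
      have : 0 ≤ T * Q + P * F := by positivity
      nlinarith
    have k4 : T * Q + Q * (F + P) = Q := by linear_combination Q * e2
    rw [k4] at k3
    nlinarith
  have := mul_le_mul_of_nonneg_left key (sq_nonneg lam)
  nlinarith

theorem steinSol_one_sub (H : PoissonSeq lam p) (h0 : ∀ i, 0 ≤ h i) (h1 : ∀ i, h i ≤ 1) (k : ℕ) :
    steinSol p (fun i => 1 - h i) k = -steinSol p h k := by
  have : ∑' j, p j * (1 - h j) = 1 - ∑' j, p j * h j := by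
    simp only [mul_sub, mul_one]
    rw [H.hasSum.summable.tsum_sub (H.summable_mul h0 h1), H.hasSum.tsum_eq]
  rw [steinSol, steinSol, this, ← neg_div, ← Finset.sum_neg_distrib]
  congr 1
  exact Finset.sum_congr rfl fun i _ => by ring

theorem abs_steinSol_sub_le (H : PoissonSeq lam p) (h0 : ∀ i, 0 ≤ h i) (h1 : ∀ i, h i ≤ 1)
    (k : ℕ) : |steinSol p h (k + 1) - steinSol p h k| ≤ 1 / lam := by
  rw [abs_le]
  refine ⟨?_, H.steinSol_sub_le h0 h1 k⟩
  have := H.steinSol_sub_le (h := fun i => 1 - h i) (fun i => by linarith [h1 i])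
    (fun i => by linarith [h0 i]) k
  rw [H.steinSol_one_sub h0 h1, H.steinSol_one_sub h0 h1] at this
  linarith

end PoissonSeq

theorem hasSum_indicator_real {α : Type*} [MeasurableSpace α] [Countable α]
    [MeasurableSingletonClass α] (μ : Measure α) [IsFiniteMeasure μ] (s : Set α) :
    HasSum (s.indicator fun i => (μ {i}).toReal) (μ s).toReal := by
  have h := Measure.tsum_indicator_apply_singleton μ s s.to_countable.measurableSet
  have e : (s.indicator fun i => (μ {i}).toReal) =
      fun i => (s.indicator (fun i => μ {i}) i).toReal := by
    ext i
    by_cases hi : i ∈ s <;> simp [hi]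
  have h' := ENNReal.hasSum_toReal (h ▸ measure_ne_top μ s)
  rwa [← ENNReal.tsum_toReal_eq (ENNReal.ne_top_of_tsum_ne_top (h ▸ measure_ne_top μ s)), h,
    ← e] at h'

theorem tvNormMeasure_le {P Q : Measure ℤ} [IsProbabilityMeasure P] [IsProbabilityMeasure Q]
    {B : ℝ} (h : ∀ A : Set ℤ, (P A).toReal - (Q A).toReal ≤ B) : tvNormMeasure P Q ≤ 2 * B := by
  set A : Set ℤ := {i | (Q {i}).toReal < (P {i}).toReal} with hA
  have h1 := ((hasSum_indicator_real P A).sub (hasSum_indicator_real Q A)).mul_left 2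
  have h2 := (hasSum_indicator_real P Set.univ).sub (hasSum_indicator_real Q Set.univ)
  have h3 := h1.sub h2
  have e : tvNormMeasure P Q = 2 * ((P A).toReal - (Q A).toReal) := by
    rw [tvNormMeasure, ← sub_zero (2 * _),
      show (0 : ℝ) = (P Set.univ).toReal - (Q Set.univ).toReal by simp, ← h3.tsum_eq]
    refine tsum_congr fun i => ?_
    by_cases hi : (Q {i}).toReal < (P {i}).toReal
    · have hi' : i ∈ A := hi
      simp only [Set.indicator_of_mem hi', Set.indicator_univ]
      rw [abs_of_pos (by linarith)]
      ring
    · have hi' : i ∉ A := hi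
      simp only [Set.indicator_of_notMem hi', Set.indicator_univ]
      rw [abs_of_nonpos (by linarith)]
      ring
  rw [e]
  linarith [h A]

/-- The point probabilities of the Poisson distribution. -/
noncomputable def poissonWeight (lam : ℝ) (k : ℕ) : ℝ :=
  Real.exp (-lam) * lam ^ k / k.factorial

theorem poissonSeq_poissonWeight {lam : ℝ} (h : 0 < lam) : PoissonSeq lam (poissonWeight lam) where
  lam_pos := h
  pos k := by unfold poissonWeight; positivity
  hasSum := by
    have := ProbabilityTheory.hasSum_one_poissonMeasure lam.toNNReal
    rwa [Real.coe_toNNReal _ h.le] at this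
  recur k := by
    unfold poissonWeight
    rw [Nat.factorial_succ]
    push_cast
    have : ((k : ℝ) + 1) ≠ 0 := by positivity
    field_simp
    ring

theorem translatedPoisson_apply {μ σ2 : ℝ} (hσ : 0 ≤ σ2) (A : Set ℤ) :
    ((translatedPoisson μ σ2).toMeasure A).toReal =
      ∑' k : ℕ, poissonWeight (σ2 + Int.fract (μ - σ2)) k *
        A.indicator 1 (⌊μ - σ2⌋ + (k : ℤ)) := by
  have hl : 0 ≤ σ2 + Int.fract (μ - σ2) := add_nonneg hσ (Int.fract_nonneg _)
  rw [translatedPoisson, ← PMF.toMeasure_map _ _ (Measurable.of_discrete),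
    Measure.map_apply Measurable.of_discrete A.to_countable.measurableSet,
    PMF.toMeasure_apply_eq_tsum, ENNReal.tsum_toReal_eq]
  · refine tsum_congr fun k => ?_
    by_cases hk : (⌊μ - σ2⌋ + (k : ℤ)) ∈ A
    · rw [Set.indicator_of_mem (by exact hk), Set.indicator_of_mem hk,
        ← poissonPMFReal_ofReal_eq_poissonPMF, ENNReal.toReal_ofReal poissonPMFReal_nonneg,
        poissonPMFReal, Real.coe_toNNReal _ hl]
      simp [poissonWeight]
    · rw [Set.indicator_of_notMem (by exact hk), Set.indicator_of_notMem hk]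
      simp
  · intro k
    by_cases hk : k ∈ (fun n : ℕ => ⌊μ - σ2⌋ + (n : ℤ)) ⁻¹' A
    · rw [Set.indicator_of_mem hk]; exact PMF.apply_ne_top _ _
    · rw [Set.indicator_of_notMem hk]; simp

theorem sub_translatedPoisson_le {Ω : Type*} [MeasurableSpace Ω] (Pr : Measure Ω)
    [IsProbabilityMeasure Pr] {W : Ω → ℤ} (hW : Measurable W) {μ σ2 κ : ℝ}
    (hW1 : Integrable (fun ω => (W ω : ℝ)) Pr)
    (hW2 : Integrable (fun ω => ((W ω : ℝ) - μ) ^ 2) Pr)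
    (hσ : ∫ ω, ((W ω : ℝ) - μ) ^ 2 ∂Pr = σ2) (hpos : 0 < σ2) (hκ : 0 ≤ κ)
    (hmain : ∀ f : ℤ → ℝ, (∃ B, ∀ j, |f j| ≤ B) → ∀ L, (∀ j, |f (j + 1) - f j| ≤ L) →
      |∫ ω, ((W ω : ℝ) - μ) * f (W ω) ∂Pr - σ2 * ∫ ω, (f (W ω + 1) - f (W ω)) ∂Pr| ≤ κ * L)
    (A : Set ℤ) :
    ((Pr.map W) A).toReal - ((translatedPoisson μ σ2).toMeasure A).toReal ≤ (2 + κ) / σ2 := by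
  rw [translatedPoisson_apply hpos.le]
  set δ := Int.fract (μ - σ2) with hδ
  set γ := ⌊μ - σ2⌋ with hγ
  have hδ0 : 0 ≤ δ := Int.fract_nonneg _
  have hδ1 : δ < 1 := Int.fract_lt_one _
  have hμ : μ = γ + (σ2 + δ) := by
    have := Int.floor_add_fract (μ - σ2)
    linarith
  set lam := σ2 + δ with hlam
  have hl : 0 < lam := by positivity
  have H := poissonSeq_poissonWeight hl
  set p := poissonWeight lam
  set h : ℕ → ℝ := fun k => A.indicator 1 (γ + (k : ℤ)) with hh
  have h0 : ∀ k, 0 ≤ h k := fun k => Set.indicator_nonneg (fun _ _ => zero_le_one) _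
  have h1 : ∀ k, h k ≤ 1 := fun k => Set.indicator_le_self' (fun _ _ => zero_le_one) _
  set T := ∑' k, p k * h k with hT
  have hT0 : 0 ≤ T := tsum_nonneg fun i => mul_nonneg (H.pos i).le (h0 i)
  set f : ℤ → ℝ := fun w => steinSol p h (w - γ).toNat with hf
  have hfB : ∀ w, |f w| ≤ 1 / (lam * p 0) := fun w => H.abs_steinSol_le h0 h1 _
  have hfL : ∀ w, |f (w + 1) - f w| ≤ 1 / lam := by
    intro w
    rcases lt_or_ge w γ with hw | hw
    · rw [hf]
      simp only
      rw [show (w + 1 - γ).toNat = 0 by omega, show (w - γ).toNat = 0 by omega, sub_self, abs_zero]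
      positivity
    · simp only [hf]
      rw [show (w + 1 - γ).toNat = (w - γ).toNat + 1 by omega]
      exact H.abs_steinSol_sub_le h0 h1 _
  have key : ∀ w : ℤ, A.indicator 1 w - T ≤ σ2 * (f (w + 1) - f w) - ((w : ℝ) - μ) * f w + 1 / lam
      + ((w : ℝ) - μ) ^ 2 / lam ^ 2 := by
    intro w
    have hd : δ * (f (w + 1) - f w) ≤ 1 / lam := by
      have := (abs_le.1 (hfL w)).2
      have : δ * (f (w + 1) - f w) ≤ δ * (1 / lam) := mul_le_mul_of_nonneg_left this hδ0
      have : δ * (1 / lam) ≤ 1 * (1 / lam) := mul_le_mul_of_nonneg_right hδ1.le (by positivity)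
      linarith
    rcases lt_or_ge w γ with hw | hw
    · have e1 : f w = 0 := by
        simp only [hf]; rw [show (w - γ).toNat = 0 by omega]; simp [steinSol]
      have e2 : f (w + 1) = 0 := by
        simp only [hf]; rw [show (w + 1 - γ).toNat = 0 by omega]; simp [steinSol]
      rw [e1, e2]
      have hw' : (w : ℝ) ≤ γ := by exact_mod_cast hw.le
      have h3 : 1 ≤ ((w : ℝ) - μ) ^ 2 / lam ^ 2 := by
        rw [one_le_div (by positivity)]
        nlinarith
      have h4 : A.indicator (1 : ℤ → ℝ) w ≤ 1 :=
        Set.indicator_le_self' (fun _ _ => zero_le_one) _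
      have : 0 < 1 / lam := by positivity
      simp only [sub_self, mul_zero]
      linarith
    · obtain ⟨k, rfl⟩ : ∃ k : ℕ, w = γ + k := ⟨(w - γ).toNat, by omega⟩
      have e1 : f (γ + k) = steinSol p h k := by
        simp only [hf]; rw [show (γ + (k : ℤ) - γ).toNat = k by omega]
      have e2 : f (γ + k + 1) = steinSol p h (k + 1) := by
        simp only [hf]; rw [show (γ + (k : ℤ) + 1 - γ).toNat = k + 1 by omega]
      have e3 := H.steinSol_eq h k
      rw [e1, e2] at hd ⊢
      have h3 : 0 ≤ (((γ + (k : ℤ) : ℤ) : ℝ) - μ) ^ 2 / lam ^ 2 := by positivity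
      have : A.indicator 1 (γ + (k : ℤ)) - T = lam * steinSol p h (k + 1) - k * steinSol p h k :=
        e3.symm
      rw [this]
      push_cast at h3 ⊢
      have : lam * steinSol p h (k + 1) - k * steinSol p h k =
        σ2 * (steinSol p h (k + 1) - steinSol p h k) - ((γ : ℝ) + k - μ) * steinSol p h k +
          δ * (steinSol p h (k + 1) - steinSol p h k) := by rw [hμ]; ring
      rw [this]
      linarith
  have mW : ∀ g : ℤ → ℝ, Measurable fun ω => g (W ω) := fun g => Measurable.of_discrete.comp hW
  have i1 : Integrable (fun ω => A.indicator (1 : ℤ → ℝ) (W ω)) Pr :=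
    Integrable.of_bound (mW _).aestronglyMeasurable 1 <| .of_forall fun ω => by
      have h2 : 0 ≤ A.indicator (1 : ℤ → ℝ) (W ω) :=
        Set.indicator_nonneg (fun _ _ => zero_le_one) _
      rw [Real.norm_of_nonneg h2]
      exact Set.indicator_le_self' (fun _ _ => zero_le_one) _
  have i2 : Integrable (fun ω => f (W ω + 1) - f (W ω)) Pr :=
    Integrable.of_bound (mW fun w => f (w + 1) - f w).aestronglyMeasurable (1 / lam) <|
      .of_forall fun ω => hfL _
  have i3 : Integrable (fun ω => ((W ω : ℝ) - μ) * f (W ω)) Pr :=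
    (hW1.sub (integrable_const μ)).mul_bdd (c := 1 / (lam * p 0)) (mW f).aestronglyMeasurable
      (.of_forall fun ω => hfB _)
  have e0 : ((Pr.map W) A).toReal = ∫ ω, A.indicator (1 : ℤ → ℝ) (W ω) ∂Pr := by
    rw [← integral_map (f := A.indicator (1 : ℤ → ℝ)) hW.aemeasurable
      (Measurable.of_discrete.aestronglyMeasurable),
      integral_indicator_one A.to_countable.measurableSet]
    rfl
  have i4 : Integrable (fun ω => σ2 * (f (W ω + 1) - f (W ω)) - ((W ω : ℝ) - μ) * f (W ω)) Pr :=
    (i2.const_mul σ2).sub i3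
  have i5 : Integrable (fun ω => σ2 * (f (W ω + 1) - f (W ω)) - ((W ω : ℝ) - μ) * f (W ω)
      + 1 / lam) Pr := i4.add (integrable_const _)
  have := integral_mono (μ := Pr) (i1.sub (integrable_const T))
    (i5.add (hW2.div_const (lam ^ 2))) fun ω => key (W ω)
  simp only [Pi.add_apply, Pi.sub_apply] at this
  rw [integral_sub i1 (integrable_const T), integral_add i5 (hW2.div_const (lam ^ 2)),
    integral_add i4 (integrable_const (1 / lam)),
    integral_sub (i2.const_mul σ2) i3, integral_const_mul, integral_div, integral_div, hσ] at this
  simp only [integral_const, probReal_univ, one_smul] at this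
  rw [e0]
  have hm := (abs_le.1 (hmain f ⟨_, hfB⟩ _ hfL)).1
  have a1 : 1 / lam ≤ 1 / σ2 := one_div_le_one_div_of_le hpos (by linarith)
  have a2 : σ2 / lam ^ 2 ≤ 1 / σ2 := by
    rw [div_le_div_iff₀ (by positivity) hpos]
    nlinarith
  have a3 : κ * (1 / lam) ≤ κ * (1 / σ2) := mul_le_mul_of_nonneg_left a1 hκ
  have a4 : (2 + κ) / σ2 = 1 / σ2 + 1 / σ2 + κ * (1 / σ2) := by ring
  rw [a4]
  linarith

/-- Translated Poisson approximation reduces to an approximate covariance identity. -/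
theorem tvNorm_translatedPoisson_le {Ω : Type*} [MeasurableSpace Ω] (Pr : Measure Ω)
    [IsProbabilityMeasure Pr] {W : Ω → ℤ} (hW : Measurable W) {μ σ2 κ : ℝ}
    (hW1 : Integrable (fun ω => (W ω : ℝ)) Pr)
    (hW2 : Integrable (fun ω => ((W ω : ℝ) - μ) ^ 2) Pr)
    (hσ : ∫ ω, ((W ω : ℝ) - μ) ^ 2 ∂Pr = σ2) (hκ : 0 ≤ κ)
    (hmain : ∀ f : ℤ → ℝ, (∃ B, ∀ j, |f j| ≤ B) → ∀ L, (∀ j, |f (j + 1) - f j| ≤ L) →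
      |∫ ω, ((W ω : ℝ) - μ) * f (W ω) ∂Pr - σ2 * ∫ ω, (f (W ω + 1) - f (W ω)) ∂Pr| ≤ κ * L) :
    tvNormMeasure (Pr.map W) (translatedPoisson μ σ2).toMeasure ≤ 2 * ((2 + κ) / σ2) := by
  have : IsProbabilityMeasure (Pr.map W) := Measure.isProbabilityMeasure_map hW.aemeasurable
  refine tvNormMeasure_le fun A => ?_
  have h0 : 0 ≤ σ2 := hσ ▸ integral_nonneg fun ω => sq_nonneg _
  rcases h0.eq_or_lt with h0 | hpos
  · have h1 : ∀ᵐ ω ∂Pr, ((W ω : ℝ) - μ) ^ 2 = 0 := by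
      have := (integral_eq_zero_iff_of_nonneg (fun ω => sq_nonneg _) hW2).1 (hσ.trans h0.symm)
      filter_upwards [this] with ω h using h
    obtain ⟨ω₀, h2⟩ := h1.exists
    have h3 : μ = W ω₀ := by nlinarith
    have h4 : ∀ᵐ ω ∂Pr, W ω = W ω₀ := by
      filter_upwards [h1] with ω h
      rw [h3] at h
      have := pow_eq_zero_iff (two_ne_zero) |>.1 h
      exact_mod_cast sub_eq_zero.1 this
    have e1 : (Pr.map W) A = A.indicator 1 (W ω₀) := by
      rw [Measure.map_congr (g := fun _ => W ω₀) h4, Measure.map_const]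
      simp
    rw [translatedPoisson_apply h0.le, e1, ← h0, h3, tsum_eq_single 0]
    · by_cases hA : W ω₀ ∈ A <;> simp [hA, poissonWeight]
    · intro k hk
      simp [poissonWeight, hk]
  · exact sub_translatedPoisson_le Pr hW hW1 hW2 hσ hpos hκ hmain A

theorem integral_pi_prod {A : Type*} [NormedCommRing A] [NormedAlgebra ℝ A] [CompleteSpace A]
    {G : Type*} [MeasurableSpace G] (M : ℕ) (μ : Fin M → Measure G)
    [∀ i, IsProbabilityMeasure (μ i)] (f : Fin M → G → A) (hf : ∀ i, Integrable (f i) (μ i)) :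
    ∫ y, ∏ i, f i (y i) ∂Measure.pi μ = ∏ i, ∫ y, f i y ∂μ i := by
  induction M with
  | zero => simp
  | succ M ih =>
    have h1 := ((measurePreserving_piFinSuccAbove μ 0).symm).integral_comp'
      (g := fun y : Fin (M + 1) → G => ∏ i, f i (y i))
    rw [← h1]
    have hI : Integrable (fun z : G × (Fin M → G) => f 0 z.1 * ∏ i : Fin M, f i.succ (z.2 i))
        ((μ 0).prod (Measure.pi fun j => μ (Fin.succAbove 0 j))) :=
      (hf 0).mul_prod (Integrable.fin_nat_prod (f := fun i : Fin M => f i.succ)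
        fun i => hf i.succ)
    have h3 : ∀ z : G × (Fin M → G),
        ∏ i, f i ((MeasurableEquiv.piFinSuccAbove (fun _ => G) 0).symm z i) =
          f 0 z.1 * ∏ i : Fin M, f i.succ (z.2 i) := fun z => Fin.prod_univ_succ _
    simp only [h3]
    rw [integral_prod _ hI, Fin.prod_univ_succ]
    have h2 : ∀ x, ∫ y : Fin M → G, f 0 x * ∏ i : Fin M, f i.succ (y i)
        ∂(Measure.pi fun j => μ (Fin.succAbove 0 j)) = f 0 x * ∏ i : Fin M, ∫ y, f i.succ y ∂μ i.succ := by
      intro x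
      have hh : Integrable (fun y : Fin M → G => ∏ i : Fin M, f i.succ (y i))
          (Measure.pi fun j => μ (Fin.succAbove 0 j)) :=
        Integrable.fin_nat_prod (f := fun i : Fin M => f i.succ) fun i => hf i.succ
      rw [integral_const_mul_of_integrable hh]
      congr 1
      exact ih _ _ fun i => hf i.succ
    simp only [h2]
    rw [integral_mul_const_of_integrable (hf 0)]

namespace RevChain

variable {E : Type*} [Fintype E] (R : RevChain E)

/-- The probability of a finite path of the stationary chain. -/
def weight {M : ℕ} (x : Fin (M + 1) → E) : ℝ :=
  R.π (x 0) * ∏ i : Fin M, R.P (x i.castSucc) (x i.succ)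

theorem weight_nonneg {M : ℕ} (x : Fin (M + 1) → E) : 0 ≤ R.weight x :=
  mul_nonneg (R.π_nonneg _) (Finset.prod_nonneg fun _ _ => R.P_nonneg _ _)

theorem weight_symm_aux (M : ℕ) (x : Fin (M + 1) → E) :
    R.π (x 0) * ∏ i : Fin M, R.Pb (x i.castSucc) (x i.succ) =
      R.π (x (Fin.last M)) * ∏ i : Fin M, R.P (x i.succ) (x i.castSucc) := by
  induction M with
  | zero => simp
  | succ M ih =>
    have h := ih fun i => x i.succ
    rw [Fin.prod_univ_succ, Fin.prod_univ_succ, ← mul_assoc, ← mul_left_comm]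
    simp only [Fin.succ_last, Fin.castSucc_zero, Fin.succ_castSucc] at h ⊢
    rw [← h]
    have := R.rev (x (Fin.succ 0)) (x 0)
    rw [← this]
    ring

theorem weight_symm {M : ℕ} (x : Fin (M + 1) → E) :
    R.symm.weight x = R.weight fun i => x i.rev := by
  rw [weight, weight]
  refine (R.weight_symm_aux M x).trans ?_
  rw [Fin.rev_zero]
  congr 1
  refine Fintype.prod_equiv Fin.revPerm _ _ fun i => ?_
  simp [Fin.rev_castSucc, Fin.rev_succ]

variable {A : Type*} [CommRing A] [Algebra ℝ A]

/-- The conditional expectation of a product of functions along the chain started at `k`. -/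
def pathE (R : RevChain E) : ℕ → (ℕ → E → A) → E → A
  | 0, a, k => a 0 k
  | M + 1, a, k => a 0 k * ∑ l, R.P k l • pathE R M (fun i => a (i + 1)) l

theorem sum_weight_aux (M : ℕ) (a : ℕ → E → A) (c : E → ℝ) :
    ∑ x : Fin (M + 1) → E, (c (x 0) * ∏ i : Fin M, R.P (x i.castSucc) (x i.succ)) •
      ∏ i : Fin (M + 1), a i (x i) = ∑ k, c k • R.pathE M a k := by
  induction M generalizing a c with
  | zero =>
    refine Fintype.sum_equiv (Equiv.funUnique (Fin 1) E) _ _ fun x => ?_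
    simp [pathE]
  | succ M ih =>
    rw [← (Fin.consEquiv fun _ : Fin (M + 2) => E).sum_comp, Fintype.sum_prod_type]
    refine Finset.sum_congr rfl fun k _ => ?_
    have h := ih (fun i => a (i + 1)) (fun l => R.P k l)
    rw [pathE, ← h, Finset.mul_sum, Finset.smul_sum]
    refine Finset.sum_congr rfl fun x _ => ?_
    rw [Fin.prod_univ_succ (n := M + 1), Fin.prod_univ_succ (n := M)]
    simp only [Fin.consEquiv_apply, Fin.cons_zero, Fin.cons_succ, Fin.castSucc_zero,
      ← Fin.succ_castSucc, Fin.val_zero, Fin.val_succ, mul_smul_comm, smul_smul]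

theorem sum_weight_smul (M : ℕ) (a : ℕ → E → A) :
    ∑ x : Fin (M + 1) → E, R.weight x • ∏ i : Fin (M + 1), a i (x i) = ∑ k, R.π k • R.pathE M a k :=
  R.sum_weight_aux M a R.π

end RevChain

/-- A two-sided stationary hidden Markov chain. -/
structure IsHMM {Ω S G : Type*} [MeasurableSpace Ω] [MeasurableSpace S] [MeasurableSpace G]
    [Fintype S] (Pr : Measure Ω) (R : RevChain S) (ν : S → Measure G)
    (X : ℤ → Ω → S) (Y : ℤ → Ω → G) : Prop where
  meas_X : ∀ i, Measurable (X i)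
  meas_Y : ∀ i, Measurable (Y i)
  path : ∀ (a : ℤ) (M : ℕ) (x : Fin (M + 1) → S) (y : Fin (M + 1) → G),
    Pr.real {ω | ∀ i : Fin (M + 1), X (a + (i : ℕ)) ω = x i ∧ Y (a + (i : ℕ)) ω = y i} =
      R.weight x * ∏ i, (ν (x i)).real {y i}

namespace IsHMM

variable {Ω S G : Type*} [MeasurableSpace Ω] [MeasurableSpace S] [MeasurableSpace G]
  [Fintype S] {Pr : Measure Ω} {R : RevChain S} {ν : S → Measure G}
  {X : ℤ → Ω → S} {Y : ℤ → Ω → G}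

theorem symm (H : IsHMM Pr R ν X Y) :
    IsHMM Pr R.symm ν (fun i => X (-i)) (fun i => Y (-i)) where
  meas_X i := H.meas_X _
  meas_Y i := H.meas_Y _
  path a M x y := by
    have h := H.path (-a - M) M (fun i => x i.rev) (fun i => y i.rev)
    rw [R.weight_symm, ← Equiv.prod_comp Fin.revPerm fun i => (ν (x i)).real {y i}]
    simp only [Fin.revPerm_apply]
    rw [← h]
    congr 1
    ext ω
    simp only [Set.mem_ofPred_eq]
    refine Fin.revPerm.forall_congr fun {i} => ?_
    simp only [Fin.revPerm_apply, Fin.rev_rev]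
    rw [show -(a + ((i : ℕ) : ℤ)) = -a - M + ((i.rev : ℕ) : ℤ) by
      rw [Fin.val_rev]; omega]

variable [MeasurableSingletonClass S] [MeasurableSingletonClass G] [Countable G]
  [IsFiniteMeasure Pr] [∀ k, IsProbabilityMeasure (ν k)]

theorem map_restrict (H : IsHMM Pr R ν X Y) (a : ℤ) (M : ℕ) (x : Fin (M + 1) → S) :
    (Pr.restrict {ω | ∀ i : Fin (M + 1), X (a + (i : ℕ)) ω = x i}).map
      (fun ω (i : Fin (M + 1)) => Y (a + (i : ℕ)) ω) =
    ENNReal.ofReal (R.weight x) • Measure.pi fun i => ν (x i) := by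
  have hV : Measurable fun ω (i : Fin (M + 1)) => Y (a + (i : ℕ)) ω :=
    measurable_pi_lambda _ fun i => H.meas_Y _
  refine Measure.ext_of_singleton fun y => ?_
  rw [Measure.map_apply hV (measurableSet_singleton y),
    Measure.restrict_apply (hV (measurableSet_singleton y)), Measure.smul_apply,
    Measure.pi_singleton]
  have h := H.path a M x y
  have e : (fun ω (i : Fin (M + 1)) => Y (a + (i : ℕ)) ω) ⁻¹' {y} ∩
      {ω | ∀ i : Fin (M + 1), X (a + (i : ℕ)) ω = x i} =
      {ω | ∀ i : Fin (M + 1), X (a + (i : ℕ)) ω = x i ∧ Y (a + (i : ℕ)) ω = y i} := by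
    ext ω
    simp only [Set.mem_inter_iff, Set.mem_preimage, Set.mem_singleton_iff, Set.mem_ofPred_eq,
      funext_iff]
    exact ⟨fun h i => ⟨h.2 i, h.1 i⟩, fun h => ⟨fun i => (h i).2, fun i => (h i).1⟩⟩
  rw [e, ← ENNReal.ofReal_toReal (measure_ne_top Pr _)]
  change ENNReal.ofReal (Pr.real _) = _
  rw [h, ENNReal.ofReal_mul (R.weight_nonneg x), ENNReal.ofReal_prod_of_nonneg
    (fun _ _ => measureReal_nonneg)]
  simp

variable {A : Type*} [NormedCommRing A] [NormedAlgebra ℝ A] [CompleteSpace A]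

theorem integral_prod_aux (H : IsHMM Pr R ν X Y) (a : ℤ) (M : ℕ) (ψ : ℕ → S → G → A)
    (hψ : ∀ i k, Integrable (ψ i k) (ν k)) :
    Integrable (fun ω => ∏ i : Fin (M + 1), ψ i (X (a + (i : ℕ)) ω) (Y (a + (i : ℕ)) ω)) Pr ∧
    ∫ ω, ∏ i : Fin (M + 1), ψ i (X (a + (i : ℕ)) ω) (Y (a + (i : ℕ)) ω) ∂Pr =
      ∑ k, R.π k • R.pathE M (fun i k => ∫ y, ψ i k y ∂ν k) k := by
  classical
  have hV : Measurable fun ω (i : Fin (M + 1)) => Y (a + (i : ℕ)) ω :=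
    measurable_pi_lambda _ fun i => H.meas_Y _
  set s : (Fin (M + 1) → S) → Set Ω := fun x => {ω | ∀ i : Fin (M + 1), X (a + (i : ℕ)) ω = x i}
  set f : Ω → A := fun ω => ∏ i : Fin (M + 1), ψ i (X (a + (i : ℕ)) ω) (Y (a + (i : ℕ)) ω)
  have hs : ∀ x, MeasurableSet (s x) := by
    intro x
    simp only [s, Set.ofPred_forall]
    exact MeasurableSet.iInter fun i => H.meas_X _ (measurableSet_singleton (x i))
  have hU : ⋃ x, s x = Set.univ :=
    Set.eq_univ_of_forall fun ω => Set.mem_iUnion.2 ⟨fun i => X (a + (i : ℕ)) ω, fun i => rfl⟩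
  have hd : Pairwise (Function.onFun Disjoint s) := by
    intro x x' hx
    refine Set.disjoint_left.2 fun ω h h' => hx (funext fun i => (h i).symm.trans (h' i))
  have hpi : ∀ x : Fin (M + 1) → S, Integrable (fun y : Fin (M + 1) → G => ∏ i : Fin (M + 1), ψ i (x i) (y i))
      (ENNReal.ofReal (R.weight x) • Measure.pi fun i => ν (x i)) := fun x =>
    (Integrable.fin_nat_prod (f := fun (i : Fin (M + 1)) y => ψ i (x i) y)
      fun i => hψ i (x i)).smul_measure ENNReal.ofReal_ne_top
  have hx : ∀ x, IntegrableOn f (s x) Pr ∧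
      ∫ ω in s x, f ω ∂Pr = R.weight x • ∏ i : Fin (M + 1), ∫ y, ψ i (x i) y ∂ν (x i) := by
    intro x
    have h1 := hpi x
    rw [← H.map_restrict a M x] at h1
    have h2 := h1.comp_measurable hV
    have h3 : ∀ ω ∈ s x, (∏ i : Fin (M + 1), ψ i (x i) (Y (a + (i : ℕ)) ω)) = f ω := by
      intro ω hω
      exact Finset.prod_congr rfl fun i _ => by rw [← hω i]
    refine ⟨(integrableOn_congr_fun h3 (hs x)).1 h2, ?_⟩
    rw [← setIntegral_congr_fun (hs x) h3]
    have h4 := integral_map hV.aemeasurable h1.aestronglyMeasurable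
    rw [← h4, H.map_restrict, integral_smul_measure, ENNReal.toReal_ofReal (R.weight_nonneg x)]
    congr 1
    exact integral_pi_prod _ _ (fun (i : Fin (M + 1)) y => ψ i (x i) y) fun i => hψ i (x i)
  constructor
  · rw [← integrableOn_univ, ← hU]
    exact integrableOn_finite_iUnion.2 fun x => (hx x).1
  · rw [← setIntegral_univ, ← hU, integral_iUnion_fintype hs hd fun x => (hx x).1,
      ← R.sum_weight_smul]
    exact Finset.sum_congr rfl fun x _ => (hx x).2

theorem integrable_prod (H : IsHMM Pr R ν X Y) (a : ℤ) (M : ℕ) (ψ : ℕ → S → G → A)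
    (hψ : ∀ i k, Integrable (ψ i k) (ν k)) :
    Integrable (fun ω => ∏ i ∈ Finset.range (M + 1), ψ i (X (a + i) ω) (Y (a + i) ω)) Pr := by
  simp only [Finset.prod_range]
  exact (H.integral_prod_aux a M ψ hψ).1

theorem integral_prod_eq (H : IsHMM Pr R ν X Y) (a : ℤ) (M : ℕ) (ψ : ℕ → S → G → A)
    (hψ : ∀ i k, Integrable (ψ i k) (ν k)) :
    ∫ ω, ∏ i ∈ Finset.range (M + 1), ψ i (X (a + i) ω) (Y (a + i) ω) ∂Pr =
      ∑ k, R.π k • R.pathE M (fun i k => ∫ y, ψ i k y ∂ν k) k := by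
  simp only [Finset.prod_range]
  exact (H.integral_prod_aux a M ψ hψ).2

end IsHMM

/-- Second-order expansions in powers of `D` of a family `t` indexed by the integers. -/
structure Jet (A : Type*) [NormedCommRing A] [NormedAlgebra ℝ A] where
  D : A
  t : ℤ → A
  S : ℤ → A
  S₂ : ℤ → A
  t_eq : ∀ y, t y = 1 + D * S y
  S_eq : ∀ y, S y = algebraMap ℝ A y + D * S₂ y
  norm_S : ∀ y, ‖S y‖ ≤ |(y : ℝ)|
  norm_S₂ : ∀ y, ‖S₂ y‖ ≤ |(y : ℝ)| ^ 2

section Moments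

theorem abs_pow_le_of_cube {a θ : ℝ} (ha : 0 ≤ a) (hθ : 0 < θ) :
    a ≤ (a ^ 3 + 2 * θ ^ 3) / (3 * θ ^ 2) ∧ a ^ 2 ≤ (2 * a ^ 3 + θ ^ 3) / (3 * θ) := by
  constructor
  · rw [le_div_iff₀ (by positivity)]
    nlinarith [mul_nonneg (sq_nonneg (a - θ)) (by linarith : 0 ≤ a + 2 * θ)]
  · rw [le_div_iff₀ (by positivity)]
    nlinarith [mul_nonneg (sq_nonneg (a - θ)) (by linarith : 0 ≤ 2 * a + θ)]

variable {μ : Measure ℤ} [IsProbabilityMeasure μ]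

theorem integrable_of_cube (h : Integrable (fun y : ℤ => |(y : ℝ)| ^ 3) μ) :
    Integrable (fun y : ℤ => |(y : ℝ)|) μ ∧ Integrable (fun y : ℤ => |(y : ℝ)| ^ 2) μ := by
  constructor
  · refine ((h.add (integrable_const (2 * 1 ^ 3))).div_const (3 * 1 ^ 2)).mono'
      AEStronglyMeasurable.of_discrete (Filter.Eventually.of_forall fun y => ?_)
    simpa using (abs_pow_le_of_cube (abs_nonneg (y : ℝ)) one_pos).1
  · refine (((h.const_mul 2).add (integrable_const (1 ^ 3))).div_const (3 * 1)).mono'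
      AEStronglyMeasurable.of_discrete (Filter.Eventually.of_forall fun y => ?_)
    simpa using (abs_pow_le_of_cube (abs_nonneg (y : ℝ)) one_pos).2

theorem integral_abs_le {θ : ℝ} (hθ : 0 < θ) (h : Integrable (fun y : ℤ => |(y : ℝ)| ^ 3) μ)
    (h3 : ∫ y : ℤ, |(y : ℝ)| ^ 3 ∂μ ≤ θ ^ 3) : ∫ y : ℤ, |(y : ℝ)| ∂μ ≤ θ := by
  have h1 := integral_mono (integrable_of_cube h).1
    ((h.add (integrable_const (2 * θ ^ 3))).div_const (3 * θ ^ 2))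
    fun y => (abs_pow_le_of_cube (abs_nonneg (y : ℝ)) hθ).1
  simp only [Pi.add_apply] at h1
  rw [integral_div, integral_add h (integrable_const _), integral_const, probReal_univ,
    one_smul] at h1
  refine h1.trans ?_
  rw [div_le_iff₀ (by positivity)]
  nlinarith

theorem integral_sq_le {θ : ℝ} (hθ : 0 < θ) (h : Integrable (fun y : ℤ => |(y : ℝ)| ^ 3) μ)
    (h3 : ∫ y : ℤ, |(y : ℝ)| ^ 3 ∂μ ≤ θ ^ 3) : ∫ y : ℤ, |(y : ℝ)| ^ 2 ∂μ ≤ θ ^ 2 := by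
  have h1 := integral_mono (integrable_of_cube h).2
    (((h.const_mul 2).add (integrable_const (θ ^ 3))).div_const (3 * θ))
    fun y => (abs_pow_le_of_cube (abs_nonneg (y : ℝ)) hθ).2
  simp only [Pi.add_apply] at h1
  rw [integral_div, integral_add (h.const_mul 2) (integrable_const _), integral_const,
    probReal_univ, one_smul, integral_const_mul] at h1
  refine h1.trans ?_
  rw [div_le_iff₀ (by positivity)]
  nlinarith

theorem lintegral_cube {Ω : Type*} [MeasurableSpace Ω] (μ : Measure Ω) {f : Ω → ℕ}
    (hf : Measurable f) :
    ∫⁻ ω, (f ω : ENNReal) ^ 3 ∂μ =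
      ∑' r : ℕ, (3 * r ^ 2 + 3 * r + 1 : ℕ) * μ {ω | r + 1 ≤ f ω} := by
  have hm : ∀ r : ℕ, MeasurableSet {ω | r + 1 ≤ f ω} := fun r => hf measurableSet_Ici
  have h1 : ∀ m : ℕ, ((m : ENNReal)) ^ 3 =
      ∑' r : ℕ, if r + 1 ≤ m then ((3 * r ^ 2 + 3 * r + 1 : ℕ) : ENNReal) else 0 := by
    intro m
    rw [tsum_eq_sum (s := Finset.range m) fun r hr => if_neg (by simpa using hr)]
    rw [Finset.sum_congr rfl fun r hr => if_pos (by simpa using hr)]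
    induction m with
    | zero => simp
    | succ m ih =>
      rw [Finset.sum_range_succ, ← ih]
      norm_cast
      ring
  simp_rw [h1]
  rw [lintegral_tsum fun r => (Measurable.ite (hm r) measurable_const
    measurable_const).aemeasurable]
  refine tsum_congr fun r => ?_
  rw [← lintegral_indicator_const (hm r)]
  exact lintegral_congr fun ω => by simp [Set.indicator_apply]

theorem moment_le {Ω : Type*} [MeasurableSpace Ω] {Pr : Measure Ω} [IsProbabilityMeasure Pr]
    {Z : Ω → ℕ} (hmZ : Measurable Z) (hZ3 : Integrable (fun ω => ((Z ω : ℝ)) ^ 3) Pr)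
    (hdom : ∀ r : ℕ, (μ {y : ℤ | (r : ℤ) ≤ y}).toReal ≤ (Pr {ω | r ≤ Z ω}).toReal ∧
      (μ {y : ℤ | y ≤ -(r : ℤ)}).toReal ≤ (Pr {ω | r ≤ Z ω}).toReal) :
    Integrable (fun y : ℤ => |(y : ℝ)| ^ 3) μ ∧
      ∫ y : ℤ, |(y : ℝ)| ^ 3 ∂μ ≤ 2 * ∫ ω, ((Z ω : ℝ)) ^ 3 ∂Pr := by
  have h1 : ∫⁻ y : ℤ, (y.natAbs : ENNReal) ^ 3 ∂μ ≤ 2 * ∫⁻ ω, (Z ω : ENNReal) ^ 3 ∂Pr := by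
    rw [lintegral_cube μ (f := Int.natAbs) (measurable_of_countable _), lintegral_cube Pr hmZ,
      ← ENNReal.tsum_mul_left]
    refine ENNReal.tsum_le_tsum fun r => ?_
    rw [mul_left_comm]
    refine mul_le_mul_right ?_ _
    have h2 : {y : ℤ | r + 1 ≤ y.natAbs} ⊆
        {y : ℤ | ((r + 1 : ℕ) : ℤ) ≤ y} ∪ {y : ℤ | y ≤ -((r + 1 : ℕ) : ℤ)} := by
      intro y hy
      simp only [Set.mem_ofPred_eq, Set.mem_union] at hy ⊢
      omega
    refine (measure_mono h2).trans ((measure_union_le _ _).trans ?_)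
    rw [two_mul]
    exact add_le_add ((ENNReal.toReal_le_toReal (measure_ne_top _ _) (measure_ne_top _ _)).1
      (hdom _).1) ((ENNReal.toReal_le_toReal (measure_ne_top _ _) (measure_ne_top _ _)).1
      (hdom _).2)
  have h3 : ∀ y : ℤ, ENNReal.ofReal (|(y : ℝ)| ^ 3) = (y.natAbs : ENNReal) ^ 3 := by
    intro y
    rw [ENNReal.ofReal_pow (abs_nonneg _), ← Int.cast_abs, Int.abs_eq_natAbs, Int.cast_natCast,
      ENNReal.ofReal_natCast]
  have h4 : ∀ ω, ENNReal.ofReal ((Z ω : ℝ) ^ 3) = (Z ω : ENNReal) ^ 3 := by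
    intro ω
    rw [ENNReal.ofReal_pow (Nat.cast_nonneg _), ENNReal.ofReal_natCast]
  have h5 : ENNReal.ofReal (∫ ω, ((Z ω : ℝ)) ^ 3 ∂Pr) = ∫⁻ ω, (Z ω : ENNReal) ^ 3 ∂Pr := by
    rw [ofReal_integral_eq_lintegral_ofReal hZ3 (Filter.Eventually.of_forall fun ω => by positivity)]
    simp_rw [h4]
  rw [← h5] at h1
  have hI : Integrable (fun y : ℤ => |(y : ℝ)| ^ 3) μ := by
    refine ⟨AEStronglyMeasurable.of_discrete, ?_⟩
    rw [hasFiniteIntegral_iff_ofReal (Filter.Eventually.of_forall fun y => by positivity)]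
    simp_rw [h3]
    exact h1.trans_lt (ENNReal.mul_lt_top (by simp) ENNReal.ofReal_lt_top)
  refine ⟨hI, ?_⟩
  have h0 : 0 ≤ ∫ ω, ((Z ω : ℝ)) ^ 3 ∂Pr := integral_nonneg fun ω => by positivity
  rw [← ENNReal.ofReal_le_ofReal_iff (by positivity),
    ofReal_integral_eq_lintegral_ofReal hI (Filter.Eventually.of_forall fun y => by positivity)]
  simp_rw [h3]
  refine h1.trans_eq ?_
  rw [ENNReal.ofReal_mul (by norm_num)]
  simp

end Moments

namespace Jet

variable {A : Type*} [NormedCommRing A] [NormedAlgebra ℝ A] (J : Jet A)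

section

variable {μ : Measure ℤ} [IsProbabilityMeasure μ]

theorem integrable_S (h : Integrable (fun y : ℤ => |(y : ℝ)| ^ 3) μ) : Integrable J.S μ :=
  (integrable_of_cube h).1.mono' AEStronglyMeasurable.of_discrete
    (Filter.Eventually.of_forall J.norm_S)

theorem integrable_S₂ (h : Integrable (fun y : ℤ => |(y : ℝ)| ^ 3) μ) : Integrable J.S₂ μ :=
  (integrable_of_cube h).2.mono' AEStronglyMeasurable.of_discrete
    (Filter.Eventually.of_forall J.norm_S₂)

theorem norm_smul_S_le (y : ℤ) : ‖(y : ℝ) • J.S y‖ ≤ |(y : ℝ)| ^ 2 := by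
  rw [norm_smul, Real.norm_eq_abs, sq]
  exact mul_le_mul_of_nonneg_left (J.norm_S y) (abs_nonneg _)

theorem norm_smul_S₂_le (y : ℤ) : ‖(y : ℝ) • J.S₂ y‖ ≤ |(y : ℝ)| ^ 3 := by
  rw [norm_smul, Real.norm_eq_abs, pow_succ' _ 2]
  exact mul_le_mul_of_nonneg_left (J.norm_S₂ y) (abs_nonneg _)

theorem integrable_smul_S (h : Integrable (fun y : ℤ => |(y : ℝ)| ^ 3) μ) :
    Integrable (fun y : ℤ => (y : ℝ) • J.S y) μ :=
  (integrable_of_cube h).2.mono' AEStronglyMeasurable.of_discrete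
    (Filter.Eventually.of_forall J.norm_smul_S_le)

theorem integrable_smul_S₂ (h : Integrable (fun y : ℤ => |(y : ℝ)| ^ 3) μ) :
    Integrable (fun y : ℤ => (y : ℝ) • J.S₂ y) μ :=
  h.mono' AEStronglyMeasurable.of_discrete (Filter.Eventually.of_forall J.norm_smul_S₂_le)

theorem integrable_cast (h : Integrable (fun y : ℤ => |(y : ℝ)| ^ 3) μ) :
    Integrable (fun y : ℤ => (y : ℝ)) μ :=
  (integrable_of_cube h).1.mono' AEStronglyMeasurable.of_discrete
    (Filter.Eventually.of_forall fun _ => le_rfl)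

theorem integrable_cast_sq (h : Integrable (fun y : ℤ => |(y : ℝ)| ^ 3) μ) :
    Integrable (fun y : ℤ => (y : ℝ) ^ 2) μ := by
  simpa using (integrable_of_cube h).2

theorem integrable_t (h : Integrable (fun y : ℤ => |(y : ℝ)| ^ 3) μ) : Integrable J.t μ := by
  rw [funext J.t_eq]
  exact (integrable_const _).add ((J.integrable_S h).const_mul _)

theorem smul_t_eq (y : ℤ) :
    (y : ℝ) • J.t y = algebraMap ℝ A y + J.D * ((y : ℝ) • J.S y) := by
  rw [J.t_eq, smul_add, mul_smul_comm, Algebra.algebraMap_eq_smul_one]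

theorem smul_S_eq (y : ℤ) :
    (y : ℝ) • J.S y = algebraMap ℝ A ((y : ℝ) ^ 2) + J.D * ((y : ℝ) • J.S₂ y) := by
  rw [J.S_eq, smul_add, mul_smul_comm, Algebra.algebraMap_eq_smul_one,
    Algebra.algebraMap_eq_smul_one, smul_smul, sq]

theorem integrable_smul_t (h : Integrable (fun y : ℤ => |(y : ℝ)| ^ 3) μ) :
    Integrable (fun y : ℤ => (y : ℝ) • J.t y) μ := by
  simp_rw [J.smul_t_eq, Algebra.algebraMap_eq_smul_one]
  exact ((integrable_cast h).smul_const 1).add ((J.integrable_smul_S h).const_mul _)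

end

variable [CompleteSpace A] {E : Type*} (ν : E → Measure ℤ) [∀ k, IsProbabilityMeasure (ν k)]

/-- The expansions of the transforms of a family of laws. -/
noncomputable def data (h : ∀ k, Integrable (fun y : ℤ => |(y : ℝ)| ^ 3) (ν k)) : JetData E A where
  D := J.D
  N k := ∫ y, J.t y ∂ν k
  I k := ∫ y, J.S y ∂ν k
  I₂ k := ∫ y, J.S₂ y ∂ν k
  N' k := ∫ y : ℤ, (y : ℝ) • J.t y ∂ν k
  J k := ∫ y : ℤ, (y : ℝ) • J.S y ∂ν k
  J₂ k := ∫ y : ℤ, (y : ℝ) • J.S₂ y ∂ν k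
  m k := ∫ y : ℤ, (y : ℝ) ∂ν k
  s k := ∫ y : ℤ, (y : ℝ) ^ 2 ∂ν k
  N_eq k := by
    simp_rw [J.t_eq]
    rw [integral_add (integrable_const _) ((J.integrable_S (h k)).const_mul _), integral_const,
      probReal_univ, one_smul, integral_const_mul_of_integrable (J.integrable_S (h k))]
  I_eq k := by
    simp_rw [J.S_eq, Algebra.algebraMap_eq_smul_one]
    rw [integral_add ((integrable_cast (h k)).smul_const _) ((J.integrable_S₂ (h k)).const_mul _),
      integral_smul_const, integral_const_mul_of_integrable (J.integrable_S₂ (h k))]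
  N'_eq k := by
    simp_rw [J.smul_t_eq, Algebra.algebraMap_eq_smul_one]
    rw [integral_add ((integrable_cast (h k)).smul_const _)
      ((J.integrable_smul_S (h k)).const_mul _),
      integral_smul_const, integral_const_mul_of_integrable (J.integrable_smul_S (h k))]
  J_eq k := by
    simp_rw [J.smul_S_eq, Algebra.algebraMap_eq_smul_one]
    rw [integral_add ((integrable_cast_sq (h k)).smul_const _)
      ((J.integrable_smul_S₂ (h k)).const_mul _),
      integral_smul_const, integral_const_mul_of_integrable (J.integrable_smul_S₂ (h k))]

theorem jetBound (h : ∀ k, Integrable (fun y : ℤ => |(y : ℝ)| ^ 3) (ν k)) {θ : ℝ} (hθ : 1 ≤ θ)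
    (h3 : ∀ k, ∫ y : ℤ, |(y : ℝ)| ^ 3 ∂ν k ≤ θ ^ 3) (ht : ∀ y, ‖J.t y‖ ≤ 1) (hD : ‖J.D‖ ≤ 2)
    (hD1 : 1 ≤ ‖J.D‖) : JetBound (J.data ν h) θ where
  one_le := hθ
  N k := by
    refine (norm_integral_le_of_norm_le (integrable_const (1 : ℝ))
      (Filter.Eventually.of_forall ht)).trans ?_
    simp
  I k := (norm_integral_le_of_norm_le (integrable_of_cube (h k)).1
    (Filter.Eventually.of_forall J.norm_S)).trans (integral_abs_le (by linarith) (h k) (h3 k))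
  I₂ k := (norm_integral_le_of_norm_le (integrable_of_cube (h k)).2
    (Filter.Eventually.of_forall J.norm_S₂)).trans (integral_sq_le (by linarith) (h k) (h3 k))
  N' k := by
    refine (norm_integral_le_of_norm_le (integrable_of_cube (h k)).1
      (Filter.Eventually.of_forall fun y => ?_)).trans (integral_abs_le (by linarith) (h k) (h3 k))
    rw [norm_smul, Real.norm_eq_abs]
    exact mul_le_of_le_one_right (abs_nonneg _) (ht y)
  J k := (norm_integral_le_of_norm_le (integrable_of_cube (h k)).2
    (Filter.Eventually.of_forall J.norm_smul_S_le)).trans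
      (integral_sq_le (by linarith) (h k) (h3 k))
  J₂ k := (norm_integral_le_of_norm_le (h k)
    (Filter.Eventually.of_forall J.norm_smul_S₂_le)).trans (h3 k)
  m k := (norm_integral_le_of_norm_le (f := fun y : ℤ => (y : ℝ)) (integrable_of_cube (h k)).1
    (Filter.Eventually.of_forall fun _ => le_rfl)).trans
      (integral_abs_le (by linarith) (h k) (h3 k))
  s k := (norm_integral_le_of_norm_le (f := fun y : ℤ => (y : ℝ) ^ 2) (integrable_of_cube (h k)).2
    (Filter.Eventually.of_forall fun y => by simp)).trans
      (integral_sq_le (by linarith) (h k) (h3 k))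
  D_le := hD
  le_D := hD1

end Jet

section

open scoped BoundedContinuousFunction

section PowerFamily

variable {A : Type*} [NormedCommRing A] [NormedAlgebra ℝ A] {t : ℤ → A}

theorem exists_second_order (h0 : t 0 = 1) (ha : ∀ a b, t (a + b) = t a * t b)
    (ht : ∀ y, ‖t y‖ ≤ 1) (y : ℤ) :
    ∃ S S₂ : A, t y = 1 + (t 1 - 1) * S ∧ S = algebraMap ℝ A y + (t 1 - 1) * S₂ ∧
      ‖S‖ ≤ |(y : ℝ)| ∧ ‖S₂‖ ≤ |(y : ℝ)| ^ 2 := by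
  have key : ∀ n : ℕ, ∃ S S₂ : A, t n = 1 + (t 1 - 1) * S ∧ S = n + (t 1 - 1) * S₂ ∧
      ‖S‖ ≤ n ∧ ‖S₂‖ ≤ n * (n - 1) / 2 ∧ ‖n * S - S₂‖ ≤ n * (n + 1) / 2 := by
    intro n
    induction n with
    | zero => exact ⟨0, 0, by simpa using h0, by simp, by simp, by simp, by simp⟩
    | succ n ih =>
      obtain ⟨S, S₂, h1, h2, h3, h4, h6⟩ := ih
      refine ⟨S + t n, S₂ + S, ?_, ?_, ?_, ?_, ?_⟩
      · push_cast
        rw [ha]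
        linear_combination h1
      · push_cast
        linear_combination h2 + h1
      · push_cast
        exact (norm_add_le _ _).trans (add_le_add h3 (ht _))
      · push_cast
        linarith [norm_add_le S₂ S]
      · have e : ((n + 1 : ℕ) : A) * (S + t n) - (S₂ + S) = (n * S - S₂) + (n + 1 : ℝ) • t n := by
          rw [Algebra.smul_def]
          simp only [map_add, map_natCast, map_one]
          push_cast
          ring
        rw [e]
        refine (norm_add_le _ _).trans ?_
        have h7 : ‖(n + 1 : ℝ) • t n‖ ≤ n + 1 := by
          rw [norm_smul, Real.norm_of_nonneg (by positivity)]
          exact mul_le_of_le_one_right (by positivity) (ht _)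
        push_cast
        linarith
  obtain ⟨n, rfl | rfl⟩ := y.eq_nat_or_neg
  · obtain ⟨S, S₂, h1, h2, h3, h4, h6⟩ := key n
    refine ⟨S, S₂, h1, by simpa using h2, by simpa using h3, h4.trans ?_⟩
    simp only [Int.cast_natCast, sq_abs]
    nlinarith [sq_nonneg (n : ℝ), Nat.cast_nonneg (α := ℝ) n]
  · obtain ⟨S, S₂, h1, h2, h3, h4, h6⟩ := key n
    have h5 := ha (-n) n
    rw [neg_add_cancel, h0] at h5
    refine ⟨-(t (-n) * S), t (-n) * (n * S - S₂), ?_, ?_, ?_, ?_⟩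
    · linear_combination -h5 - t (-n) * h1
    · simp only [Int.cast_neg, Int.cast_natCast, map_neg, map_natCast]
      linear_combination - t (-n) * h2 + (n : A) * h5 + (n : A) * t (-n) * h1
    · rw [norm_neg]
      refine (norm_mul_le _ _).trans ?_
      have := mul_le_mul (ht (-n)) h3 (norm_nonneg _) zero_le_one
      simpa using this
    · refine (norm_mul_le _ _).trans ((mul_le_of_le_one_left (norm_nonneg _) (ht _)).trans
        (h6.trans ?_))
      simp only [Int.cast_neg, Int.cast_natCast, abs_neg, sq_abs]
      have : (n : ℝ) ≤ (n : ℝ) ^ 2 := by exact_mod_cast Nat.le_self_pow two_ne_zero n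
      nlinarith

/-- The expansions of the powers of an element of norm one. -/
theorem exists_jet (h0 : t 0 = 1) (ha : ∀ a b, t (a + b) = t a * t b) (ht : ∀ y, ‖t y‖ ≤ 1) :
    ∃ J : Jet A, J.t = t ∧ J.D = t 1 - 1 := by
  choose S S₂ h using exists_second_order h0 ha ht
  exact ⟨⟨t 1 - 1, t, S, S₂, fun y => (h y).1, fun y => (h y).2.1, fun y => (h y).2.2.1,
    fun y => (h y).2.2.2⟩, rfl, rfl⟩

end PowerFamily

section Translations

/-- Bounded functions on the integers. -/
def BddFun := ℤ →ᵇ ℝ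

namespace BddFun

noncomputable instance : NormedAddCommGroup BddFun := inferInstanceAs (NormedAddCommGroup (ℤ →ᵇ ℝ))

noncomputable instance : NormedSpace ℝ BddFun := inferInstanceAs (NormedSpace ℝ (ℤ →ᵇ ℝ))

instance : CompleteSpace BddFun := inferInstanceAs (CompleteSpace (ℤ →ᵇ ℝ))

instance : FunLike BddFun ℤ ℝ := inferInstanceAs (FunLike (ℤ →ᵇ ℝ) ℤ ℝ)

@[ext]
theorem ext {f g : BddFun} (h : ∀ j, f j = g j) : f = g := DFunLike.ext f g h

@[simp]
theorem add_apply (f g : BddFun) (j : ℤ) : (f + g) j = f j + g j := rfl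

@[simp]
theorem sub_apply (f g : BddFun) (j : ℤ) : (f - g) j = f j - g j := rfl

@[simp]
theorem smul_apply (c : ℝ) (f : BddFun) (j : ℤ) : (c • f) j = c * f j := rfl

theorem abs_apply_le (f : BddFun) (j : ℤ) : |f j| ≤ ‖f‖ :=
  BoundedContinuousFunction.norm_coe_le_norm (α := ℤ) (β := ℝ) f j

theorem norm_le {f : BddFun} {c : ℝ} (hc : 0 ≤ c) (h : ∀ j, |f j| ≤ c) : ‖f‖ ≤ c :=
  (BoundedContinuousFunction.norm_le (α := ℤ) (β := ℝ) hc).2 h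

/-- A bounded function as an element of `BddFun`. -/
noncomputable def mk (f : ℤ → ℝ) (h : ∃ B, ∀ j, |f j| ≤ B) : BddFun :=
  BoundedContinuousFunction.ofNormedAddCommGroup f continuous_of_discreteTopology h.choose
    h.choose_spec

@[simp]
theorem mk_apply (f : ℤ → ℝ) (h : ∃ B, ∀ j, |f j| ≤ B) (j : ℤ) : mk f h j = f j := rfl

instance : Nontrivial BddFun := ⟨mk (fun _ => 1) ⟨1, by simp⟩, 0, fun h => by
  have h1 : (1 : ℝ) = 0 := DFunLike.congr_fun h 0
  exact one_ne_zero h1⟩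

end BddFun

/-- The translation operator. -/
noncomputable def translate (y : ℤ) : BddFun →L[ℝ] BddFun :=
  LinearMap.mkContinuous
    { toFun := fun f => BddFun.mk (fun j => f (j + y)) ⟨_, fun j => f.abs_apply_le _⟩
      map_add' := fun f g => by ext; simp
      map_smul' := fun c f => by ext; simp } 1 fun f => by
    rw [one_mul]
    exact BddFun.norm_le (norm_nonneg f) fun j => f.abs_apply_le _

@[simp]
theorem translate_apply (y : ℤ) (f : BddFun) (j : ℤ) : translate y f j = f (j + y) := rfl

theorem translate_zero : translate 0 = 1 := by
  ext; simp

theorem translate_add (a b : ℤ) : translate (a + b) = translate a * translate b := by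
  ext; simp [add_assoc]

theorem norm_translate_le (y : ℤ) : ‖translate y‖ ≤ 1 :=
  LinearMap.mkContinuous_norm_le _ zero_le_one _

/-- The bicommutant of the algebra generated by the translation operators. -/
noncomputable def convAlg : Subalgebra ℝ (BddFun →L[ℝ] BddFun) :=
  Subalgebra.centralizer ℝ (Subalgebra.centralizer ℝ (Set.range translate) : Set _)

theorem translate_mem (y : ℤ) : translate y ∈ convAlg := by
  rw [convAlg, Subalgebra.mem_centralizer_iff]
  intro g hg
  exact ((Subalgebra.mem_centralizer_iff ℝ).1 hg _ ⟨y, rfl⟩).symm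

theorem convAlg_mul_comm (a b : convAlg) : a * b = b * a := by
  have h : (Set.range translate) ⊆ (Set.range translate).centralizer := by
    rintro _ ⟨a, rfl⟩ _ ⟨b, rfl⟩
    rw [← translate_add, ← translate_add, add_comm]
  refine Subtype.ext ((Subalgebra.mem_centralizer_iff ℝ).1 b.2 _ ?_)
  have ha := a.2
  exact Set.centralizer_subset (show Set.range translate ⊆
    Set.centralizer (Set.range translate) from h) ha

noncomputable instance : NormedCommRing convAlg :=
  { Subalgebra.normedRing convAlg with mul_comm := convAlg_mul_comm }

noncomputable instance : NormedAlgebra ℝ convAlg := Subalgebra.toNormedAlgebra convAlg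

theorem norm_convAlg (a : convAlg) : ‖a‖ = ‖(a : BddFun →L[ℝ] BddFun)‖ := rfl

instance : NormOneClass convAlg := ⟨by
  rw [norm_convAlg]
  exact norm_one⟩

theorem isClosed_convAlg : IsClosed (convAlg : Set (BddFun →L[ℝ] BddFun)) :=
  Set.isClosed_centralizer _

instance : CompleteSpace convAlg := isClosed_convAlg.completeSpace_coe

/-- The translation operator as an element of the commutative algebra `convAlg`. -/
noncomputable def convShift (y : ℤ) : convAlg := ⟨translate y, translate_mem y⟩

theorem convShift_zero : convShift 0 = 1 := Subtype.ext translate_zero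

theorem convShift_add (a b : ℤ) : convShift (a + b) = convShift a * convShift b :=
  Subtype.ext (translate_add a b)

theorem norm_convShift_le (y : ℤ) : ‖convShift y‖ ≤ 1 := norm_translate_le y

/-- Evaluation at `0` of the image of a bounded function under an operator. -/
noncomputable def evalAt (f : BddFun) : convAlg →L[ℝ] ℝ :=
  LinearMap.mkContinuous
    { toFun := fun a => (a : BddFun →L[ℝ] BddFun) f 0
      map_add' := fun _ _ => rfl
      map_smul' := fun _ _ => rfl } ‖f‖ fun a => by
    refine (BddFun.abs_apply_le _ 0).trans ?_
    rw [mul_comm]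
    exact ContinuousLinearMap.le_opNorm _ f

theorem evalAt_convShift (f : BddFun) (y : ℤ) : evalAt f (convShift y) = f y := by
  change f (0 + y) = f y
  rw [zero_add]

theorem evalAt_mul (f : BddFun) (a b : convAlg) :
    evalAt f (a * b) = evalAt ((b : BddFun →L[ℝ] BddFun) f) a := rfl

theorem abs_evalAt_le (f : BddFun) (a : convAlg) : |evalAt f a| ≤ ‖a‖ * ‖f‖ := by
  rw [mul_comm]
  exact (evalAt f).le_of_opNorm_le (LinearMap.mkContinuous_norm_le _ (norm_nonneg f) _) a

theorem norm_convShift_sub_le : ‖convShift 1 - 1‖ ≤ 2 := by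
  refine (norm_sub_le _ _).trans ?_
  rw [norm_one]
  linarith [norm_convShift_le 1]

theorem one_le_norm_convShift_sub : 1 ≤ ‖convShift 1 - 1‖ := by
  have h0 : ∀ j : ℤ, |if j = 1 then (1 : ℝ) else 0| ≤ 1 := fun j => by split_ifs <;> simp
  set f : BddFun := BddFun.mk (fun j : ℤ => if j = 1 then (1 : ℝ) else 0) ⟨1, h0⟩ with hf
  have h1 : ‖f‖ ≤ 1 := BddFun.norm_le zero_le_one h0
  have h2 : evalAt f (convShift 1 - 1) = 1 := by
    rw [map_sub, ← convShift_zero, evalAt_convShift, evalAt_convShift]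
    simp [hf]
  have h3 := abs_evalAt_le f (convShift 1 - 1)
  rw [h2, abs_one] at h3
  nlinarith [norm_nonneg (convShift 1 - 1)]

end Translations

end

namespace RevChain

variable {E A : Type*} [Fintype E] [CommRing A] [Algebra ℝ A] (R : RevChain E)

theorem pathE_const (N : E → A) (M : ℕ) (k : E) :
    R.pathE M (fun _ => N) k = N k * R.ret N M k := by
  induction M generalizing k with
  | zero => simp [pathE, ret_zero]
  | succ M ih =>
    rw [pathE, ret_succ]
    simp_rw [ih]

theorem pathE_mark_zero (N N' : E → A) (M : ℕ) (k : E) :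
    R.pathE M (fun j => if j = 0 then N' else N) k = N' k * R.ret N M k := by
  cases M with
  | zero => simp [pathE, ret_zero]
  | succ M =>
    rw [pathE, ret_succ]
    simp only [if_true, Nat.add_eq_zero_iff, one_ne_zero, and_false, if_false]
    simp_rw [pathE_const]

theorem sum_π_pathE_mark (N N' : E → A) (i t M : ℕ) :
    ∑ k, R.π k • (R.symm.ret N t k * R.pathE (i + M) (fun j => if j = i then N' else N) k) =
      ∑ k, R.π k • (R.symm.ret N (t + i) k * (N' k * R.ret N M k)) := by
  induction i generalizing t with
  | zero => simp_rw [zero_add, pathE_mark_zero, add_zero]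
  | succ i ih =>
    rw [show t + (i + 1) = t + 1 + i by ring, ← ih, R.sum_π_ret_symm_succ,
      show i + 1 + M = i + M + 1 by ring]
    simp [pathE]

end RevChain

theorem JetData.total_eq_pathE {E A : Type*} [Fintype E] [CommRing A] [Algebra ℝ A]
    (T : JetData E A) (R : RevChain E) (M₁ M₂ : ℕ) :
    T.total R M₁ M₂ = ∑ k, R.π k • R.pathE (M₁ + M₂) (fun _ => T.N) k := by
  rw [T.total_eq R M₁ M₂ 0 (Nat.zero_le _)]
  simp_rw [R.pathE_const, RevChain.ret_zero, one_mul, Nat.sub_zero, R.fwd_succ]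

theorem JetData.marked_eq_pathE {E A : Type*} [Fintype E] [CommRing A] [Algebra ℝ A]
    (T : JetData E A) (R : RevChain E) (M₁ M₂ : ℕ) :
    T.marked R M₁ M₂ =
      ∑ k, R.π k • R.pathE (M₁ + M₂) (fun j => if j = M₁ then T.N' else T.N) k := by
  have := R.sum_π_pathE_mark T.N T.N' M₁ 0 M₂
  simp only [RevChain.ret_zero, one_mul, zero_add] at this
  rw [this, marked]
  simp_rw [mul_assoc]

section Expectations

variable {Ω E : Type*} [MeasurableSpace Ω] [MeasurableSpace E] [Fintype E]
  [MeasurableSingletonClass E] {Pr : Measure Ω} [IsProbabilityMeasure Pr]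
  {R : RevChain E} {ν : E → Measure ℤ} [∀ k, IsProbabilityMeasure (ν k)]
  {X : ℤ → Ω → E} {Y : ℤ → Ω → ℤ}

/-- The sum of the hidden variables of index `1, …, n`. -/
def hiddenSum (Y : ℤ → Ω → ℤ) (n : ℕ) (ω : Ω) : ℤ := ∑ i ∈ Finset.range n, Y (1 + i) ω

variable {A : Type*} [NormedCommRing A] [NormedAlgebra ℝ A] [CompleteSpace A] (J : Jet A)
  (h : ∀ k, Integrable (fun y : ℤ => |(y : ℝ)| ^ 3) (ν k))

theorem Jet.t_sum (h0 : J.t 0 = 1) (ha : ∀ a b, J.t (a + b) = J.t a * J.t b) {ι : Type*}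
    (s : Finset ι) (f : ι → ℤ) : J.t (∑ i ∈ s, f i) = ∏ i ∈ s, J.t (f i) := by
  classical
  induction s using Finset.induction_on with
  | empty => simpa using h0
  | insert a s has ih => rw [Finset.sum_insert has, Finset.prod_insert has, ha, ih]

theorem IsHMM.integral_t (H : IsHMM Pr R ν X Y) (h0 : J.t 0 = 1)
    (ha : ∀ a b, J.t (a + b) = J.t a * J.t b) (M₁ M₂ : ℕ) :
    Integrable (fun ω => J.t (hiddenSum Y (M₁ + M₂ + 1) ω)) Pr ∧
      ∫ ω, J.t (hiddenSum Y (M₁ + M₂ + 1) ω) ∂Pr = (J.data ν h).total R M₁ M₂ := by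
  simp_rw [hiddenSum, J.t_sum h0 ha]
  refine ⟨H.integrable_prod 1 _ (fun _ _ => J.t) fun _ k => J.integrable_t (h k), ?_⟩
  rw [H.integral_prod_eq 1 _ (fun _ _ => J.t) fun _ k => J.integrable_t (h k),
    JetData.total_eq_pathE]
  rfl

theorem IsHMM.integral_smul_t (H : IsHMM Pr R ν X Y) (h0 : J.t 0 = 1)
    (ha : ∀ a b, J.t (a + b) = J.t a * J.t b) (M₁ M₂ : ℕ) :
    Integrable (fun ω => (Y (1 + M₁) ω : ℝ) • J.t (hiddenSum Y (M₁ + M₂ + 1) ω)) Pr ∧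
      ∫ ω, (Y (1 + M₁) ω : ℝ) • J.t (hiddenSum Y (M₁ + M₂ + 1) ω) ∂Pr =
        (J.data ν h).marked R M₁ M₂ := by
  set ψ : ℕ → E → ℤ → A := fun i _ y => if i = M₁ then (y : ℝ) • J.t y else J.t y
  have hψ : ∀ i k, Integrable (ψ i k) (ν k) := by
    intro i k
    by_cases hi : i = M₁
    · simpa only [ψ, hi, if_true] using J.integrable_smul_t (h k)
    · simpa only [ψ, hi, if_false] using J.integrable_t (h k)
  have e : ∀ ω, (Y (1 + M₁) ω : ℝ) • J.t (hiddenSum Y (M₁ + M₂ + 1) ω) =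
      ∏ i ∈ Finset.range (M₁ + M₂ + 1), ψ i (X (1 + i) ω) (Y (1 + i) ω) := by
    intro ω
    have hm : M₁ ∈ Finset.range (M₁ + M₂ + 1) := by simp
    rw [hiddenSum, J.t_sum h0 ha, ← Finset.mul_prod_erase _ _ hm, ← Finset.mul_prod_erase _ _ hm,
      ← smul_mul_assoc]
    congr 1
    · simp [ψ]
    · exact Finset.prod_congr rfl fun i hi => by simp [ψ, Finset.ne_of_mem_erase hi]
  simp_rw [e]
  refine ⟨H.integrable_prod 1 _ ψ hψ, ?_⟩
  rw [H.integral_prod_eq 1 _ ψ hψ, JetData.marked_eq_pathE]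
  refine Finset.sum_congr rfl fun k _ => ?_
  congr 2
  ext i k
  by_cases hi : i = M₁
  · simp [ψ, hi, Jet.data]
  · simp [ψ, hi, Jet.data]

end Expectations

section Dual

open TrivSqZeroExt

/-- The expansions of the powers of `1 + ε` in the dual numbers. -/
noncomputable def dualJet : Jet (TrivSqZeroExt ℝ ℝ) where
  D := inr 1
  t y := inl 1 + inr (y : ℝ)
  S y := inl (y : ℝ)
  S₂ _ := 0
  t_eq y := by ext <;> simp
  S_eq y := by ext <;> simp
  norm_S y := by
    rw [norm_inl, Real.norm_eq_abs]
  norm_S₂ y := by simp [sq_nonneg]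

variable {E : Type*} [Fintype E] [DecidableEq E] (R : RevChain E) (ν : E → Measure ℤ)
  [∀ k, IsProbabilityMeasure (ν k)] (h : ∀ k, Integrable (fun y : ℤ => |(y : ℝ)| ^ 3) (ν k))

theorem fst_data_N (k : E) : fst ((dualJet.data ν h).N k) = 1 := by
  rw [(dualJet.data ν h).N_eq]
  simp [Jet.data, dualJet]

theorem fst_ret (M : ℕ) (k : E) : fst (R.ret (dualJet.data ν h).N M k) = 1 := by
  induction M generalizing k with
  | zero => simp [RevChain.ret_zero]
  | succ M ih => simp [RevChain.ret_succ, fst_sum, ih, fst_data_N, R.P_row]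

theorem fst_fwd (M : ℕ) (k : E) : fst (R.fwd (dualJet.data ν h).N M k) = 1 := by
  cases M with
  | zero => simp [RevChain.fwd_zero]
  | succ M => simp [RevChain.fwd_succ, fst_ret, fst_data_N]

theorem fst_marked (M₁ M₂ : ℕ) :
    fst ((dualJet.data ν h).marked R M₁ M₂) = (dualJet.data ν h).mean R := by
  rw [JetData.marked, fst_sum, JetData.mean]
  refine Finset.sum_congr rfl fun k _ => ?_
  rw [fst_smul, fst_mul, fst_mul, fst_ret, fst_ret, (dualJet.data ν h).N'_eq]
  simp [Jet.data, dualJet, algebraMap_eq_inl]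

theorem snd_marked (o : E) (M₁ M₂ : ℕ) :
    snd ((dualJet.data ν h).marked R M₁ M₂) -
      (dualJet.data ν h).mean R * snd ((dualJet.data ν h).total R M₁ M₂) =
        (dualJet.data ν h).cov R o M₁ M₂ := by
  have h1 := congrArg snd ((dualJet.data ν h).marked_sub R o M₁ M₂)
  rw [snd_sub, snd_smul, smul_eq_mul] at h1
  rw [h1]
  have hD : ∀ x : TrivSqZeroExt ℝ ℝ, snd ((dualJet.data ν h).D * x) = fst x := by
    intro x
    simp [Jet.data, dualJet]
  rw [hD, JetData.cov]
  have h2 := R.pair.map_joint (M₁ := M₁) (M₂ := M₂) (o, o) (fstHom ℝ ℝ ℝ).toLinearMap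
    (fun x u v => (dualJet.data ν h).swapA x.1 (JetData.sites₁ u v) (JetData.sites₂ x u v) *
      (dualJet.data ν h).tails R o M₁ M₂ u v)
  simp only [AlgHom.toLinearMap_apply, fstHom_apply] at h2
  rw [h2]
  refine RevChain.joint_congr _ _ fun x u v _ _ => ?_
  rw [fst_mul, JetData.tails, fst_mul, fst_ret, fst_fwd, JetData.swapA_eq]
  simp [Jet.data, dualJet, algebraMap_eq_inl]

end Dual

namespace IsHMM

variable {Ω E : Type*} [MeasurableSpace Ω] [MeasurableSpace E] [Fintype E]
  [MeasurableSingletonClass E] {Pr : Measure Ω} [IsProbabilityMeasure Pr]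
  {R : RevChain E} {ν : E → Measure ℤ} [∀ k, IsProbabilityMeasure (ν k)]
  {X : ℤ → Ω → E} {Y : ℤ → Ω → ℤ} (H : IsHMM Pr R ν X Y)
  (h : ∀ k, Integrable (fun y : ℤ => |(y : ℝ)| ^ 3) (ν k))

theorem dualJet_t_zero : dualJet.t 0 = 1 := by ext <;> simp [dualJet]

theorem dualJet_t_add (a b : ℤ) : dualJet.t (a + b) = dualJet.t a * dualJet.t b := by
  ext <;> simp [dualJet, add_comm]

theorem snd_dualJet_t (a : ℤ) : (dualJet.t a).snd = a := by simp [dualJet]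

theorem fst_dualJet_t (a : ℤ) : (dualJet.t a).fst = 1 := by simp [dualJet]

theorem integral_hiddenSum (H : IsHMM Pr R ν X Y)
    (h : ∀ k, Integrable (fun y : ℤ => |(y : ℝ)| ^ 3) (ν k)) (M₁ M₂ : ℕ) :
    Integrable (fun ω => (hiddenSum Y (M₁ + M₂ + 1) ω : ℝ)) Pr ∧
      ∫ ω, (hiddenSum Y (M₁ + M₂ + 1) ω : ℝ) ∂Pr =
        ((dualJet.data ν h).total R M₁ M₂).snd := by
  obtain ⟨h1, h2⟩ := H.integral_t dualJet h dualJet_t_zero dualJet_t_add M₁ M₂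
  have h3 := (TrivSqZeroExt.sndCLM ℝ ℝ).integrable_comp h1
  have h4 := (TrivSqZeroExt.sndCLM ℝ ℝ).integral_comp_comm h1
  simp only [TrivSqZeroExt.sndCLM_apply, snd_dualJet_t] at h3 h4
  exact ⟨h3, h4.trans (by rw [h2])⟩

variable [DecidableEq E]

theorem integral_hidden (H : IsHMM Pr R ν X Y)
    (h : ∀ k, Integrable (fun y : ℤ => |(y : ℝ)| ^ 3) (ν k)) (M₁ M₂ : ℕ) :
    Integrable (fun ω => (Y (1 + M₁) ω : ℝ)) Pr ∧
      ∫ ω, (Y (1 + M₁) ω : ℝ) ∂Pr = (dualJet.data ν h).mean R := by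
  obtain ⟨h1, h2⟩ := H.integral_smul_t dualJet h dualJet_t_zero dualJet_t_add M₁ M₂
  have h3 := (TrivSqZeroExt.fstCLM ℝ ℝ).integrable_comp h1
  have h4 := (TrivSqZeroExt.fstCLM ℝ ℝ).integral_comp_comm h1
  simp only [TrivSqZeroExt.fstCLM_apply, TrivSqZeroExt.fst_smul, fst_dualJet_t, smul_eq_mul,
    mul_one] at h3 h4
  exact ⟨h3, h4.trans (by rw [h2, fst_marked])⟩

theorem integral_hidden_mul (H : IsHMM Pr R ν X Y)
    (h : ∀ k, Integrable (fun y : ℤ => |(y : ℝ)| ^ 3) (ν k)) (o : E) (M₁ M₂ : ℕ) :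
    Integrable (fun ω => (Y (1 + M₁) ω : ℝ) * hiddenSum Y (M₁ + M₂ + 1) ω) Pr ∧
      ∫ ω, (Y (1 + M₁) ω : ℝ) * hiddenSum Y (M₁ + M₂ + 1) ω ∂Pr =
        (dualJet.data ν h).cov R o M₁ M₂ + (dualJet.data ν h).mean R *
          ∫ ω, (hiddenSum Y (M₁ + M₂ + 1) ω : ℝ) ∂Pr := by
  obtain ⟨h1, h2⟩ := H.integral_smul_t dualJet h dualJet_t_zero dualJet_t_add M₁ M₂
  have h3 := (TrivSqZeroExt.sndCLM ℝ ℝ).integrable_comp h1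
  have h4 := (TrivSqZeroExt.sndCLM ℝ ℝ).integral_comp_comm h1
  simp only [TrivSqZeroExt.sndCLM_apply, TrivSqZeroExt.snd_smul, snd_dualJet_t,
    smul_eq_mul] at h3 h4
  refine ⟨h3, h4.trans ?_⟩
  rw [h2, (H.integral_hiddenSum h M₁ M₂).2, ← snd_marked R ν h o]
  ring

/-- The identity behind the comparison of a hidden sum with its translated Poisson law. -/
theorem integral_hidden_comp (H : IsHMM Pr R ν X Y) (J : Jet convAlg) (hJt : J.t = convShift)
    (hJD : J.D = convShift 1 - 1)
    (h : ∀ k, Integrable (fun y : ℤ => |(y : ℝ)| ^ 3) (ν k)) (o : E) (M₁ M₂ : ℕ) (f : BddFun) :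
    Integrable (fun ω => (Y (1 + M₁) ω : ℝ) * f (hiddenSum Y (M₁ + M₂ + 1) ω)) Pr ∧
      ∫ ω, (Y (1 + M₁) ω : ℝ) * f (hiddenSum Y (M₁ + M₂ + 1) ω) ∂Pr -
        (J.data ν h).mean R * ∫ ω, f (hiddenSum Y (M₁ + M₂ + 1) ω) ∂Pr -
        (J.data ν h).cov R o M₁ M₂ * ∫ ω, (f (hiddenSum Y (M₁ + M₂ + 1) ω + 1) -
          f (hiddenSum Y (M₁ + M₂ + 1) ω)) ∂Pr =
        evalAt ((J.D : BddFun →L[ℝ] BddFun) f) ((J.data ν h).rem R o M₁ M₂) := by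
  have h0 : J.t 0 = 1 := hJt ▸ convShift_zero
  have ha : ∀ a b, J.t (a + b) = J.t a * J.t b := hJt ▸ convShift_add
  obtain ⟨h1, h2⟩ := H.integral_smul_t J h h0 ha M₁ M₂
  obtain ⟨h3, h4⟩ := H.integral_t J h h0 ha M₁ M₂
  have e1 := (evalAt f).integral_comp_comm h1
  have e2 := (evalAt f).integral_comp_comm h3
  have e3 := (evalAt ((J.D : BddFun →L[ℝ] BddFun) f)).integral_comp_comm h3
  have e4 := (evalAt f).integrable_comp h1
  simp only [hJt, map_smul, evalAt_convShift, smul_eq_mul] at e1 e2 e3 e4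
  have hD : ∀ j, (J.D : BddFun →L[ℝ] BddFun) f j = f (j + 1) - f j := by
    intro j
    rw [hJD]
    rfl
  simp only [hD] at e3
  refine ⟨e4, ?_⟩
  rw [e1, e2, e3, ← hJt, h2, h4, ← evalAt_mul, ← evalAt_mul, mul_comm _ J.D, mul_comm _ J.D]
  change _ = evalAt f ((J.data ν h).D * _)
  rw [← (J.data ν h).marked_sub_sub, map_sub, map_sub, map_smul, map_smul]
  rfl

theorem tv_bound (H : IsHMM Pr R ν X Y)
    (h : ∀ k, Integrable (fun y : ℤ => |(y : ℝ)| ^ 3) (ν k)) {θ : ℝ} (hθ : 1 ≤ θ)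
    (hν : ∀ k, ∫ y : ℤ, |(y : ℝ)| ^ 3 ∂ν k ≤ θ ^ 3) (o : E) (n : ℕ) {β q t₁ t₂ : ℝ}
    (hmix : ∀ J : Jet convAlg, J.t = convShift → J.D = convShift 1 - 1 →
      Mixing (J.data ν h) R o n β q t₁ t₂) :
    tvNormMeasure (Pr.map (hiddenSum Y n)) (translatedPoisson
        (∫ ω, (hiddenSum Y n ω : ℝ) ∂Pr)
        (∫ ω, ((hiddenSum Y n ω : ℝ) - ∫ ω', (hiddenSum Y n ω' : ℝ) ∂Pr) ^ 2 ∂Pr)).toMeasure ≤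
      2 * ((2 + n * (14 * θ ^ 3 * t₂ * (β + n * q))) /
        ∫ ω, ((hiddenSum Y n ω : ℝ) - ∫ ω', (hiddenSum Y n ω' : ℝ) ∂Pr) ^ 2 ∂Pr) := by
  obtain ⟨J, hJt, hJD⟩ := exists_jet (t := convShift) convShift_zero convShift_add
    norm_convShift_le
  have hM := hmix J hJt hJD
  have hB : JetBound (J.data ν h) θ := J.jetBound ν h hθ hν (hJt ▸ norm_convShift_le)
    (hJD ▸ norm_convShift_sub_le) (hJD ▸ one_le_norm_convShift_sub)
  set W : Ω → ℤ := hiddenSum Y n with hW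
  set μ := ∫ ω, (W ω : ℝ) ∂Pr with hμ
  have hn : ∀ i ∈ Finset.range n, n = i + (n - 1 - i) + 1 := fun i hi => by
    have := Finset.mem_range.1 hi
    omega
  have hWm : Measurable W := Finset.measurable_sum _ fun i _ => H.meas_Y _
  have hWsum : ∀ ω, (W ω : ℝ) = ∑ i ∈ Finset.range n, (Y (1 + i) ω : ℝ) := fun ω => by
    simp [hW, hiddenSum]
  set m := (J.data ν h).mean R with hm
  set c : ℕ → ℝ := fun i => (J.data ν h).cov R o i (n - 1 - i) with hc
  have hY : ∀ i ∈ Finset.range n, Integrable (fun ω => (Y (1 + i) ω : ℝ)) Pr ∧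
      ∫ ω, (Y (1 + i) ω : ℝ) ∂Pr = m := fun i _ => H.integral_hidden h i 0
  have hYW : ∀ i ∈ Finset.range n, Integrable (fun ω => (Y (1 + i) ω : ℝ) * W ω) Pr ∧
      ∫ ω, (Y (1 + i) ω : ℝ) * W ω ∂Pr = c i + m * μ := fun i hi => by
    have := H.integral_hidden_mul h o i (n - 1 - i)
    rwa [← hn i hi] at this
  have hWi : Integrable (fun ω => (W ω : ℝ)) Pr := by
    simp_rw [hWsum]
    exact integrable_finsetSum _ fun i hi => (hY i hi).1
  have hμm : μ = n * m := by
    rw [hμ]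
    simp_rw [hWsum]
    rw [integral_finsetSum _ fun i hi => (hY i hi).1, Finset.sum_congr rfl fun i hi => (hY i hi).2]
    simp
  have hW2 : Integrable (fun ω => (W ω : ℝ) * W ω) Pr ∧
      ∫ ω, (W ω : ℝ) * W ω ∂Pr = ∑ i ∈ Finset.range n, c i + μ * μ := by
    have e : ∀ ω, (W ω : ℝ) * W ω = ∑ i ∈ Finset.range n, (Y (1 + i) ω : ℝ) * W ω := fun ω => by
      rw [← Finset.sum_mul, ← hWsum]
    simp_rw [e]
    refine ⟨integrable_finsetSum _ fun i hi => (hYW i hi).1, ?_⟩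
    rw [integral_finsetSum _ fun i hi => (hYW i hi).1,
      Finset.sum_congr rfl fun i hi => (hYW i hi).2, Finset.sum_add_distrib]
    simp only [Finset.sum_const, Finset.card_range, nsmul_eq_mul]
    rw [← mul_assoc, ← hμm]
  have e2 : ∀ ω, ((W ω : ℝ) - μ) ^ 2 = (W ω : ℝ) * W ω - (2 * μ) * W ω + μ * μ := fun ω => by ring
  have hV2 : Integrable (fun ω => ((W ω : ℝ) - μ) ^ 2) Pr := by
    simp_rw [e2]
    exact (hW2.1.sub (hWi.const_mul _)).add (integrable_const _)
  have hV : ∫ ω, ((W ω : ℝ) - μ) ^ 2 ∂Pr = ∑ i ∈ Finset.range n, c i := by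
    have hi : Integrable (fun ω => (W ω : ℝ) * W ω - 2 * μ * W ω) Pr :=
      hW2.1.sub (hWi.const_mul _)
    simp_rw [e2]
    rw [integral_add hi (integrable_const _), integral_sub hW2.1 (hWi.const_mul _), hW2.2, integral_const_mul, ← hμ]
    simp
    ring
  have hκ : 0 ≤ n * (14 * θ ^ 3 * t₂ * (β + n * q)) := by
    have := hM.beta_nonneg
    have := hM.q_nonneg
    have : 0 ≤ t₂ := (sq_nonneg _).trans hM.sq_le
    positivity
  refine tvNorm_translatedPoisson_le Pr hWm hWi hV2 rfl hκ fun f hf L hL => ?_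
  rw [hV]
  set F := BddFun.mk f hf with hF
  have hL0 : 0 ≤ L := (abs_nonneg _).trans (hL 0)
  have hDF : ‖(J.D : BddFun →L[ℝ] BddFun) F‖ ≤ L := by
    refine BddFun.norm_le hL0 fun j => ?_
    rw [hJD]
    exact hL j
  have hterm : ∀ i ∈ Finset.range n, Integrable (fun ω => (Y (1 + i) ω : ℝ) * f (W ω)) Pr ∧
      |∫ ω, (Y (1 + i) ω : ℝ) * f (W ω) ∂Pr - m * ∫ ω, f (W ω) ∂Pr -
        c i * ∫ ω, (f (W ω + 1) - f (W ω)) ∂Pr| ≤ 14 * θ ^ 3 * t₂ * (β + n * q) * L := by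
    intro i hi
    have := H.integral_hidden_comp J hJt hJD h o i (n - 1 - i) F
    rw [← hn i hi] at this
    refine ⟨this.1, ?_⟩
    refine (le_of_eq (congrArg abs this.2)).trans ((abs_evalAt_le _ _).trans ?_)
    have hr := hM.norm_rem_le hB i (n - 1 - i) (hn i hi).symm
    exact mul_le_mul hr hDF (norm_nonneg _) ((norm_nonneg _).trans hr)
  have hfi : Integrable (fun ω => f (W ω)) Pr := by
    obtain ⟨B, hB⟩ := hf
    exact Integrable.of_bound ((measurable_of_countable f).comp hWm).aestronglyMeasurable B
      (Filter.Eventually.of_forall fun ω => hB _)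
  have e3 : ∀ ω, ((W ω : ℝ) - μ) * f (W ω) =
      ∑ i ∈ Finset.range n, (Y (1 + i) ω : ℝ) * f (W ω) - μ * f (W ω) := fun ω => by
    rw [← Finset.sum_mul, ← hWsum]
    ring
  simp_rw [e3]
  rw [integral_sub (integrable_finsetSum _ fun i hi => (hterm i hi).1) (hfi.const_mul _),
    integral_finsetSum _ fun i hi => (hterm i hi).1, integral_const_mul, hμm, Finset.sum_mul]
  calc _ = |∑ i ∈ Finset.range n, (∫ ω, (Y (1 + i) ω : ℝ) * f (W ω) ∂Pr -
        m * ∫ ω, f (W ω) ∂Pr - c i * ∫ ω, (f (W ω + 1) - f (W ω)) ∂Pr)| := by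
        rw [Finset.sum_sub_distrib, Finset.sum_sub_distrib]
        simp [mul_assoc]
    _ ≤ ∑ i ∈ Finset.range n, 14 * θ ^ 3 * t₂ * (β + n * q) * L :=
        (Finset.abs_sum_le_sum_abs _ _).trans (Finset.sum_le_sum fun i hi => (hterm i hi).2)
    _ = _ := by
        simp
        ring

end IsHMM

namespace RevChain

variable {E A : Type*} [Fintype E] [CommRing A] [Algebra ℝ A] (R : RevChain E)

theorem pathE_mul_ret (N : E → A) (j m : ℕ) (k : E) :
    R.pathE m (fun i k => N k * if i = m then R.ret N j k else 1) k = N k * R.ret N (m + j) k := by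
  induction m generalizing k with
  | zero => simp [pathE]
  | succ m ih =>
    rw [pathE, show m + 1 + j = m + j + 1 by ring, ret_succ]
    simp only [Nat.add_right_cancel_iff, ih]
    simp

theorem pathE_start [DecidableEq E] (N : E → A) (o : E) (j m : ℕ) (k : E) :
    R.pathE m (fun i k => (if i = 0 then (if k = o then 1 else 0) else N k) *
      if i = m then R.ret N j k else 1) k = if k = o then R.ret N (m + j) o else 0 := by
  cases m with
  | zero =>
    by_cases hk : k = o
    · simp [pathE, hk]
    · simp [pathE, hk]
  | succ m =>
    have h := R.pathE_mul_ret N j m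
    by_cases hk : k = o
    · rw [pathE, show m + 1 + j = m + j + 1 by ring, ret_succ]
      simp only [Nat.add_right_cancel_iff, Nat.add_eq_zero_iff, one_ne_zero, and_false, if_false, h]
      simp [hk]
    · simp [pathE, hk]

end RevChain

section Smoothing

variable {Ω E : Type*} [MeasurableSpace Ω] [MeasurableSpace E] [Fintype E] [DecidableEq E]
  [MeasurableSingletonClass E] {Pr : Measure Ω} [IsProbabilityMeasure Pr]
  {R : RevChain E} {ν : E → Measure ℤ} [∀ k, IsProbabilityMeasure (ν k)]
  {X : ℤ → Ω → E} {Y : ℤ → Ω → ℤ}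
  {A : Type*} [NormedCommRing A] [NormedAlgebra ℝ A] [CompleteSpace A] (J : Jet A)
  (h : ∀ k, Integrable (fun y : ℤ => |(y : ℝ)| ^ 3) (ν k))

theorem IsHMM.integral_start (H : IsHMM Pr R ν X Y) (h0 : J.t 0 = 1)
    (ha : ∀ a b, J.t (a + b) = J.t a * J.t b) (o : E) (m j : ℕ) :
    ∫ ω in {ω | X 0 ω = o}, J.t (hiddenSum Y m ω) * R.ret (J.data ν h).N j (X m ω) ∂Pr =
      R.π o • R.ret (J.data ν h).N (m + j) o := by
  set N := (J.data ν h).N with hN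
  set ψ : ℕ → E → ℤ → A := fun i k y =>
    (if i = 0 then (if k = o then 1 else 0) else J.t y) * if i = m then R.ret N j k else 1 with hψ
  have hi : ∀ i k, Integrable (fun y => if i = 0 then (if k = o then (1 : A) else 0) else J.t y)
      (ν k) := by
    intro i k
    split_ifs
    · exact integrable_const _
    · exact integrable_const _
    · exact J.integrable_t (h k)
  have hψi : ∀ i k, Integrable (ψ i k) (ν k) := fun i k => (hi i k).mul_const _
  have hs : MeasurableSet {ω | X 0 ω = o} := H.meas_X 0 (measurableSet_singleton o)
  have e : ∀ ω, {ω | X 0 ω = o}.indicator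
      (fun ω => J.t (hiddenSum Y m ω) * R.ret N j (X m ω)) ω =
      ∏ i ∈ Finset.range (m + 1), ψ i (X (0 + i) ω) (Y (0 + i) ω) := by
    intro ω
    simp only [hψ, Finset.prod_mul_distrib]
    rw [Finset.prod_range_succ', Finset.prod_ite_eq' (Finset.range (m + 1)) m]
    simp only [Nat.add_eq_zero_iff, one_ne_zero, and_false, if_false, if_true, hiddenSum,
      J.t_sum h0 ha, Set.indicator_apply, Set.mem_ofPred_eq, Nat.cast_zero, zero_add,
      Finset.mem_range, Nat.lt_succ_self]
    split_ifs
    · rw [mul_one]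
      congr 1
      exact Finset.prod_congr rfl fun i _ => by push_cast; rw [add_comm]
    · simp
  rw [← integral_indicator hs]
  simp_rw [e]
  rw [H.integral_prod_eq 0 m ψ hψi]
  have e2 : (fun (i : ℕ) (k : E) => ∫ y, ψ i k y ∂ν k) = fun i k =>
      (if i = 0 then (if k = o then 1 else 0) else N k) * if i = m then R.ret N j k else 1 := by
    funext i k
    rw [hψ]
    simp only
    rw [integral_mul_const_of_integrable (hi i k)]
    congr 1
    split_ifs
    · simp
    · simp
    · rfl
  rw [e2]
  simp_rw [R.pathE_start]
  simp

end Smoothing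

theorem norm_integral_sub_integral_le {G A : Type*} [MeasurableSpace G] [Countable G]
    [MeasurableSingletonClass G] [NormedAddCommGroup A] [NormedSpace ℝ A] [CompleteSpace A]
    (μ₁ μ₂ : Measure G) [IsFiniteMeasure μ₁] [IsFiniteMeasure μ₂] {g : G → A}
    (hg : ∀ p, ‖g p‖ ≤ 1) :
    ‖∫ p, g p ∂μ₁ - ∫ p, g p ∂μ₂‖ ≤ ∑' p, |μ₁.real {p} - μ₂.real {p}| := by
  have hi : ∀ (μ : Measure G) [IsFiniteMeasure μ], Integrable g μ := fun μ _ =>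
    Integrable.of_bound (StronglyMeasurable.of_discrete).aestronglyMeasurable 1
      (Filter.Eventually.of_forall hg)
  have hs : ∀ (μ : Measure G) [IsFiniteMeasure μ], Summable fun p => μ.real {p} := fun μ _ => by
    refine ENNReal.summable_toReal ?_
    have := μ.tsum_indicator_apply_singleton Set.univ MeasurableSet.univ
    simp only [Set.indicator_univ] at this
    exact this ▸ measure_ne_top μ _
  have hs' : ∀ (μ : Measure G) [IsFiniteMeasure μ], Summable fun p => μ.real {p} • g p :=
    fun μ _ => Summable.of_norm_bounded (hs μ) fun p => by
      rw [norm_smul, Real.norm_of_nonneg measureReal_nonneg]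
      exact mul_le_of_le_one_right measureReal_nonneg (hg p)
  rw [integral_countable (hi μ₁), integral_countable (hi μ₂), ← (hs' μ₁).tsum_sub (hs' μ₂)]
  refine tsum_of_norm_bounded (((hs μ₁).add (hs μ₂)).of_norm_bounded
    (g := fun p => μ₁.real {p} + μ₂.real {p}) (fun p => ?_)).hasSum fun p => ?_
  · rw [Real.norm_eq_abs, abs_abs]
    refine (abs_sub _ _).trans ?_
    rw [abs_of_nonneg measureReal_nonneg, abs_of_nonneg measureReal_nonneg]
  · rw [← sub_smul, norm_smul, Real.norm_eq_abs]
    exact mul_le_of_le_one_right (abs_nonneg _) (hg p)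

theorem sum_Icc_eq_hiddenSum {Ω : Type*} (Y : ℤ → Ω → ℤ) (m : ℕ) (ω : Ω) :
    ∑ i ∈ Finset.Icc (1 : ℤ) m, Y i ω = hiddenSum Y m ω := by
  rw [hiddenSum]
  refine (Finset.sum_nbij (fun i : ℕ => (1 : ℤ) + i) ?_ ?_ ?_ fun _ _ => rfl).symm
  · intro i hi
    simp at hi ⊢
    omega
  · intro i _ j _ hij
    simpa using hij
  · intro i hi
    simp at hi ⊢
    exact ⟨(i - 1).toNat, by omega, by omega⟩

variable {Ω : Type*} [MeasurableSpace Ω] {Pr : Measure Ω} [IsProbabilityMeasure Pr]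
  {K : ℕ} {R : RevChain (Fin (K + 1))} {ν : Fin (K + 1) → Measure ℤ}
  [∀ k, IsProbabilityMeasure (ν k)] {X : ℤ → Ω → Fin (K + 1)} {Y : ℤ → Ω → ℤ}
  {A : Type*} [NormedCommRing A] [NormedAlgebra ℝ A] [CompleteSpace A]

theorem IsHMM.measureReal_eq (H : IsHMM Pr R ν X Y) (o : Fin (K + 1)) :
    Pr.real {ω | X 0 ω = o} = R.π o := by
  have h := H.integral_prod_eq (A := ℝ) 0 0 (fun _ k _ => if k = o then 1 else 0)
    fun _ _ => integrable_const _
  simp [RevChain.pathE] at h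
  rw [← h, ← integral_indicator_one (show MeasurableSet {ω | X 0 ω = o} from
    H.meas_X 0 (measurableSet_singleton o))]
  exact integral_congr_ae (Filter.Eventually.of_forall fun ω => by simp [Set.indicator_apply])

theorem IsHMM.norm_smooth_le (H : IsHMM Pr R ν X Y) (J : Jet A)
    (h : ∀ k, Integrable (fun y : ℤ => |(y : ℝ)| ^ 3) (ν k)) (h0 : J.t 0 = 1)
    (ha : ∀ a b, J.t (a + b) = J.t a * J.t b) (ht : ∀ y, ‖J.t y‖ ≤ 1) (hD : J.D = J.t 1 - 1)
    (hret : ∀ j k, ‖R.ret (J.data ν h).N j k‖ ≤ 1) (hπ : 0 < R.π 0) {m M : ℕ} (hm : m ≤ M) :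
    ‖(J.data ν h).D * R.ret (J.data ν h).N M 0‖ ≤ betaFn2 Pr K X Y m := by
  obtain ⟨j, rfl⟩ := Nat.exists_eq_add_of_le hm
  set N := (J.data ν h).N with hN
  set s : Set Ω := {ω | X 0 ω = 0} with hs
  set c : Measure Ω := Pr[|s] with hc
  have hsr : Pr.real s = R.π 0 := H.measureReal_eq 0
  have hs0 : Pr s ≠ 0 := fun h' => by
    rw [measureReal_def, h'] at hsr
    simp at hsr
    exact hπ.ne hsr
  have : IsProbabilityMeasure c := cond_isProbabilityMeasure hs0
  have hmS : Measurable (hiddenSum Y m) := Finset.measurable_sum _ fun i _ => H.meas_Y _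
  set g : Fin (K + 1) × ℤ → A := fun p => J.t p.2 * R.ret N j p.1 with hg
  have hg1 : ∀ p, ‖g p‖ ≤ 1 := fun p =>
    (norm_mul_le _ _).trans (mul_le_one₀ (ht _) (norm_nonneg _) (hret _ _))
  set V₀ : Ω → Fin (K + 1) × ℤ := fun ω => (X m ω, hiddenSum Y m ω) with hV₀
  set V₁ : Ω → Fin (K + 1) × ℤ := fun ω => (X m ω, 1 + hiddenSum Y m ω) with hV₁
  have hmV₀ : Measurable V₀ := (H.meas_X m).prodMk hmS
  have hmV₁ : Measurable V₁ := (H.meas_X m).prodMk (hmS.const_add 1)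
  have hgm : StronglyMeasurable g := StronglyMeasurable.of_discrete
  have i0 : ∫ p, g p ∂(c.map V₀) = R.ret N (m + j) 0 := by
    rw [integral_map hmV₀.aemeasurable hgm.aestronglyMeasurable, hc, ProbabilityTheory.cond,
      integral_smul_measure, H.integral_start J h h0 ha 0 m j, ENNReal.toReal_inv,
      ← measureReal_def, hsr, smul_smul, inv_mul_cancel₀ hπ.ne', one_smul]
  have i1 : ∫ p, g p ∂(c.map V₁) = J.t 1 * R.ret N (m + j) 0 := by
    rw [← i0, integral_map hmV₁.aemeasurable hgm.aestronglyMeasurable,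
      integral_map hmV₀.aemeasurable hgm.aestronglyMeasurable,
      ← integral_const_mul_of_integrable]
    · simp only [hg, hV₀, hV₁, ha, mul_assoc]
    · exact Integrable.of_bound (hgm.comp_measurable hmV₀).aestronglyMeasurable 1
        (Filter.Eventually.of_forall fun ω => hg1 _)
  have hP : ∀ V : Ω → Fin (K + 1) × ℤ, Measurable V → IsFiniteMeasure (c.map V) := fun V hV => by
    have := Measure.isProbabilityMeasure_map (μ := c) hV.aemeasurable
    infer_instance
  have := hP V₀ hmV₀
  have := hP V₁ hmV₁
  have key := norm_integral_sub_integral_le (c.map V₁) (c.map V₀) hg1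
  rw [i0, i1] at key
  calc _ = ‖J.t 1 * R.ret N (m + j) 0 - R.ret N (m + j) 0‖ := by
        congr 1
        change J.D * _ = _
        rw [hD, sub_mul, one_mul]
    _ ≤ _ := key
    _ = _ := by
        rw [betaFn2]
        refine tsum_congr fun p => ?_
        rw [map_measureReal_apply hmV₁ (measurableSet_singleton p),
          map_measureReal_apply hmV₀ (measurableSet_singleton p)]
        have e0 : V₀ ⁻¹' {p} = {ω | X m ω = p.1 ∧ ∑ i ∈ Finset.Icc (1 : ℤ) m, Y i ω = p.2} := by
          ext ω
          simp [hV₀, Prod.ext_iff, sum_Icc_eq_hiddenSum]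
        have e1 : V₁ ⁻¹' {p} =
            {ω | X m ω = p.1 ∧ 1 + ∑ i ∈ Finset.Icc (1 : ℤ) m, Y i ω = p.2} := by
          ext ω
          simp [hV₁, Prod.ext_iff, sum_Icc_eq_hiddenSum]
        rw [e0, e1]
        rfl

section Coefficients

/-- The mixed second differences of `(a + b + 1) ^ 2`. -/
def sqCoeff (p : ℕ × ℕ) : ℝ := if p.1 = 0 then 2 * p.2 + 1 else if p.2 = 0 then 2 * p.1 + 1 else 2

theorem sqCoeff_nonneg (p : ℕ × ℕ) : 0 ≤ sqCoeff p := by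
  unfold sqCoeff
  split_ifs <;> positivity

theorem sqCoeff_le (p : ℕ × ℕ) : sqCoeff p ≤ 2 * ((p.1 + 1) * (p.2 + 1)) := by
  have h1 : (0 : ℝ) ≤ p.1 := Nat.cast_nonneg _
  have h2 : (0 : ℝ) ≤ p.2 := Nat.cast_nonneg _
  unfold sqCoeff
  split_ifs <;> nlinarith [mul_nonneg h1 h2]

theorem sum_sqCoeff (a b : ℕ) :
    ∑ p ∈ Finset.range (a + 1) ×ˢ Finset.range (b + 1), sqCoeff p = ((a : ℝ) + b + 1) ^ 2 := by
  rw [Finset.sum_product]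
  have h0 : ∀ b : ℕ, ∑ y ∈ Finset.range (b + 1), sqCoeff (0, y) = ((b : ℝ) + 1) ^ 2 := by
    intro b
    induction b with
    | zero => simp [sqCoeff]
    | succ b ih =>
      rw [Finset.sum_range_succ, ih]
      simp only [sqCoeff, if_true]
      push_cast
      ring
  have h1 : ∀ x b : ℕ, ∑ y ∈ Finset.range (b + 1), sqCoeff (x + 1, y) = 2 * x + 3 + 2 * b := by
    intro x b
    induction b with
    | zero =>
      simp [sqCoeff]
      ring
    | succ b ih =>
      rw [Finset.sum_range_succ, ih]
      simp [sqCoeff]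
      ring
  induction a with
  | zero => simp [h0]
  | succ a ih =>
    rw [Finset.sum_range_succ, ih, h1]
    push_cast
    ring

theorem sum_sqCoeff_ite {a b M₁ M₂ : ℕ} (ha : a ≤ M₁) (hb : b ≤ M₂) :
    ∑ p ∈ Finset.range (M₁ + 1) ×ˢ Finset.range (M₂ + 1),
      sqCoeff p * ((if p.1 ≤ a then (1 : ℝ) else 0) * if p.2 ≤ b then (1 : ℝ) else 0) =
        ((a : ℝ) + b + 1) ^ 2 := by
  rw [← sum_sqCoeff]
  have hsub : Finset.range (a + 1) ×ˢ Finset.range (b + 1) ⊆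
      Finset.range (M₁ + 1) ×ˢ Finset.range (M₂ + 1) :=
    Finset.product_subset_product (Finset.range_subset_range.2 (by omega))
      (Finset.range_subset_range.2 (by omega))
  rw [← Finset.sum_subset hsub]
  · refine Finset.sum_congr rfl fun p hp => ?_
    simp only [Finset.mem_product, Finset.mem_range] at hp
    rw [if_pos (by omega), if_pos (by omega), one_mul, mul_one]
  · intro p _ hp
    simp only [Finset.mem_product, Finset.mem_range, not_and_or, not_lt] at hp
    rcases hp with hp | hp
    · rw [if_neg (by omega), zero_mul, mul_zero]
    · rw [if_neg (show ¬ p.2 ≤ b by omega), mul_zero, mul_zero]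

end Coefficients

/-- The successive visits around the origin, in terms of the intervals without visits. -/
theorem exists_gap (V : ℤ → Prop) (h1 : ∃ k, 0 < k ∧ V k) (h2 : ∃ k, k ≤ 0 ∧ V k) :
    ∃ p q : ℕ, sInf {k : ℤ | 0 < k ∧ V k} - sSup {k : ℤ | k ≤ 0 ∧ V k} = p + q + 1 ∧
      ∀ s s' : ℕ, (∀ t ∈ Finset.Ioc (-(s : ℤ)) s', ¬ V t) ↔ s ≤ p ∧ s' ≤ q := by
  have b1 : BddBelow {k : ℤ | 0 < k ∧ V k} := ⟨0, fun k hk => hk.1.le⟩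
  have b2 : BddAbove {k : ℤ | k ≤ 0 ∧ V k} := ⟨0, fun k hk => hk.1⟩
  obtain ⟨a, ha⟩ : ∃ a, a = sInf {k : ℤ | 0 < k ∧ V k} := ⟨_, rfl⟩
  obtain ⟨b, hb⟩ : ∃ b, b = sSup {k : ℤ | k ≤ 0 ∧ V k} := ⟨_, rfl⟩
  have v1 : 0 < a ∧ V a := ha ▸ Int.csInf_mem h1 b1
  have v2 : b ≤ 0 ∧ V b := hb ▸ Int.csSup_mem h2 b2
  have l1 : ∀ t, 0 < t → V t → a ≤ t := fun t ht hV => ha ▸ csInf_le b1 ⟨ht, hV⟩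
  have l2 : ∀ t, t ≤ 0 → V t → t ≤ b := fun t ht hV => hb ▸ le_csSup b2 ⟨ht, hV⟩
  rw [← ha, ← hb]
  obtain ⟨m1, v1⟩ := v1
  obtain ⟨m2, v2⟩ := v2
  refine ⟨(-b).toNat, (a - 1).toNat, by omega, fun s s' => ⟨fun h => ?_, fun h t ht hV => ?_⟩⟩
  · have ha : ¬ (-(s : ℤ) < a ∧ a ≤ s') := fun h' => h a (Finset.mem_Ioc.2 h') v1
    have hb : ¬ (-(s : ℤ) < b ∧ b ≤ s') := fun h' => h b (Finset.mem_Ioc.2 h') v2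
    omega
  · have ht := Finset.mem_Ioc.1 ht
    rcases le_or_gt t 0 with h0 | h0
    · have := l2 t h0 hV
      omega
    · have := l1 t h0 hV
      omega

namespace RevChain

variable {S : Type*} [Fintype S] [DecidableEq S] (D : RevChain S) (z : S)

theorem pathE_taboo {m M : ℕ} (h : m ≤ M) (k : S) :
    D.pathE M (fun i k => if i < m ∧ k = z then (0 : ℝ) else 1) k = taboo D.P z m k := by
  induction m generalizing M k with
  | zero =>
    simp only [not_lt_zero, false_and, if_false, taboo]
    clear h
    induction M generalizing k with
    | zero => rfl
    | succ M ih => simp [pathE, ih, D.P_row]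
  | succ m ih =>
    obtain ⟨M, rfl⟩ : ∃ M', M = M' + 1 := ⟨M - 1, by omega⟩
    simp only [pathE, taboo, Nat.add_lt_add_iff_right, Nat.zero_lt_succ, true_and]
    by_cases hk : k = z
    · simp [hk]
    · simp only [hk, if_false, one_mul, smul_eq_mul]
      exact Finset.sum_congr rfl fun l _ => by rw [ih (by omega)]

theorem avoid_nonneg (m : ℕ) : 0 ≤ D.avoid z m :=
  Finset.sum_nonneg fun x _ => mul_nonneg (D.π_nonneg x) (taboo_nonneg D.P_nonneg _ _)

theorem avoid_zero : D.avoid z 0 = 1 := by simp [avoid, taboo, D.π_sum]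

theorem avoid_le_one (m : ℕ) : D.avoid z m ≤ 1 :=
  (D.avoid_antitone z (Nat.zero_le m)).trans (D.avoid_zero z).le

variable {C r : ℝ}

theorem summable_sqCoeff (hr0 : 0 ≤ r) (hr : r < 1) (hC : ∀ m, D.avoid z m ≤ C * r ^ m) :
    Summable fun p : ℕ × ℕ => sqCoeff p * D.avoid z (p.1 + p.2) := by
  have hs : Summable fun s : ℕ => ((s : ℝ) + 1) * r ^ s := by
    simp_rw [add_mul, one_mul]
    refine Summable.add ?_ (summable_geometric_of_lt_one hr0 hr)
    simpa using summable_pow_mul_geometric_of_norm_lt_one 1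
      (show ‖r‖ < 1 by rwa [Real.norm_of_nonneg hr0])
  have hp : ∀ s : ℕ, 0 ≤ ((s : ℝ) + 1) * r ^ s := fun s => by positivity
  refine ((hs.mul_of_nonneg hs hp hp).mul_left (2 * C)).of_nonneg_of_le
    (fun p => mul_nonneg (sqCoeff_nonneg p) (D.avoid_nonneg z _)) fun p => ?_
  calc _ ≤ 2 * (((p.1 : ℝ) + 1) * (p.2 + 1)) * (C * r ^ (p.1 + p.2)) :=
        mul_le_mul (sqCoeff_le p) (hC _) (D.avoid_nonneg z _) (by positivity)
    _ = _ := by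
        rw [pow_add]
        ring

theorem joint_sq_le (hs : Summable fun p : ℕ × ℕ => sqCoeff p * D.avoid z (p.1 + p.2))
    (M₁ M₂ : ℕ) :
    D.joint z M₁ M₂ (fun _ u v => ((u.length : ℝ) + v.length + 1) ^ 2) ≤
      ∑' p : ℕ × ℕ, sqCoeff p * D.avoid z (p.1 + p.2) := by
  rw [D.joint_congr z (G := fun _ u v => ∑ p ∈ Finset.range (M₁ + 1) ×ˢ Finset.range (M₂ + 1),
    sqCoeff p * ((if p.1 ≤ u.length then (1 : ℝ) else 0) *
      if p.2 ≤ v.length then (1 : ℝ) else 0)) fun x u v hu hv => (sum_sqCoeff_ite hu hv).symm,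
    joint_sum]
  simp_rw [joint_const_mul]
  refine (Finset.sum_le_sum fun p _ => mul_le_mul_of_nonneg_left (D.joint_ite_le z p.1 p.2)
    (sqCoeff_nonneg p)).trans ?_
  exact hs.sum_le_tsum _ fun p _ => mul_nonneg (sqCoeff_nonneg p) (D.avoid_nonneg z _)

theorem one_le_tsum (hs : Summable fun p : ℕ × ℕ => sqCoeff p * D.avoid z (p.1 + p.2)) :
    1 ≤ ∑' p : ℕ × ℕ, sqCoeff p * D.avoid z (p.1 + p.2) := by
  have := hs.sum_le_tsum {(0, 0)} fun p _ =>
    mul_nonneg (sqCoeff_nonneg p) (D.avoid_nonneg z _)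
  simpa [sqCoeff, avoid_zero] using this

theorem sum_avoid_sq_le (hs : Summable fun p : ℕ × ℕ => sqCoeff p * D.avoid z (p.1 + p.2))
    (M : ℕ) :
    (∑ s ∈ Finset.range M, D.avoid z (s + 1)) ^ 2 ≤
      ∑' p : ℕ × ℕ, sqCoeff p * D.avoid z (p.1 + p.2) := by
  have h1 : ∀ M, 0 ≤ ∑ s ∈ Finset.range M, D.avoid z (s + 1) ∧
      ∑ s ∈ Finset.range M, D.avoid z (s + 1) ≤ M := fun M =>
    ⟨Finset.sum_nonneg fun s _ => D.avoid_nonneg z _,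
      (Finset.sum_le_sum fun s _ => D.avoid_le_one z (s + 1)).trans (by simp)⟩
  have h2 : (∑ s ∈ Finset.range M, D.avoid z (s + 1)) ^ 2 ≤
      ∑ s ∈ Finset.range M, sqCoeff (0, s + 1) * D.avoid z (0 + (s + 1)) := by
    induction M with
    | zero => simp
    | succ M ih =>
      rw [Finset.sum_range_succ, Finset.sum_range_succ]
      have ha := D.avoid_nonneg z (M + 1)
      have ha1 := D.avoid_le_one z (M + 1)
      have := (h1 M).2
      simp only [zero_add, sqCoeff, if_true] at ih ⊢
      push_cast at ih ⊢
      nlinarith [mul_nonneg ha (sub_nonneg.2 this), mul_nonneg ha (sub_nonneg.2 ha1)]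
  refine h2.trans ?_
  have e := Finset.sum_image (s := Finset.range M) (g := fun s : ℕ => ((0, s + 1) : ℕ × ℕ))
    (f := fun p => sqCoeff p * D.avoid z (p.1 + p.2)) (fun a _ b _ h => by simpa using h)
  rw [← e]
  exact hs.sum_le_tsum _ fun p _ => mul_nonneg (sqCoeff_nonneg p) (D.avoid_nonneg z _)

end RevChain

namespace IsHMM

variable {Ω S G : Type*} [MeasurableSpace Ω] [MeasurableSpace S] [MeasurableSpace G]
  [Fintype S] [DecidableEq S] {Pr : Measure Ω} {R : RevChain S} {ν : S → Measure G}
  {X : ℤ → Ω → S} {Y : ℤ → Ω → G} [MeasurableSingletonClass S] [MeasurableSingletonClass G]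
  [Countable G] [IsProbabilityMeasure Pr] [∀ k, IsProbabilityMeasure (ν k)]

theorem measurableSet_noVisit (H : IsHMM Pr R ν X Y) (z : S) (I : Finset ℤ) :
    MeasurableSet {ω | ∀ t ∈ I, X t ω ≠ z} := by
  simp only [Set.ofPred_forall]
  exact Finset.measurableSet_biInter I fun t _ =>
    (H.meas_X t (measurableSet_singleton z)).compl

theorem integral_noVisit (H : IsHMM Pr R ν X Y) (z : S) (g : S → ℝ) (j : ℤ) (m : ℕ) :
    ∫ ω in {ω | ∀ t ∈ Finset.Ico j (j + m), X t ω ≠ z}, g (X j ω) ∂Pr =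
      ∑ k, R.π k * (g k * taboo R.P z m k) := by
  have h := H.integral_prod_eq (A := ℝ) j m
    (fun i k _ => (if i = 0 then g k else 1) * if i < m ∧ k = z then (0 : ℝ) else 1)
    fun _ _ => integrable_const _
  simp only [integral_const, probReal_univ, one_smul] at h
  have e : ∀ k, R.pathE m (fun i k => (if i = 0 then g k else 1) *
      if i < m ∧ k = z then (0 : ℝ) else 1) k = g k * taboo R.P z m k := by
    intro k
    rw [← R.pathE_taboo z le_rfl k]
    cases m with
    | zero => simp [RevChain.pathE]
    | succ m => simp [RevChain.pathE]
  simp only [e, smul_eq_mul] at h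
  rw [← h, ← integral_indicator (H.measurableSet_noVisit z _)]
  refine integral_congr_ae (Filter.Eventually.of_forall fun ω => ?_)
  simp only [Finset.prod_mul_distrib, Set.indicator_apply, Set.mem_ofPred_eq]
  rw [Finset.prod_ite_eq_of_mem' _ _ _ (by simp)]
  by_cases hv : ∀ t ∈ Finset.Ico j (j + m), X t ω ≠ z
  · rw [if_pos hv, Finset.prod_eq_one]
    · simp
    · intro i hi
      refine if_neg fun hc => hv (j + i) (Finset.mem_Ico.2 ⟨by omega, by omega⟩) hc.2
  · rw [if_neg hv]
    push Not at hv
    obtain ⟨t, ht, htz⟩ := hv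
    have ht := Finset.mem_Ico.1 ht
    rw [Finset.prod_eq_zero (i := (t - j).toNat) (Finset.mem_range.2 (by omega)), mul_zero]
    refine if_pos ⟨by omega, ?_⟩
    rwa [show j + ((t - j).toNat : ℤ) = t by omega]

theorem measureReal_noVisit (H : IsHMM Pr R ν X Y) (z : S) (s s' : ℕ) :
    Pr.real {ω | ∀ t ∈ Finset.Ioc (-(s : ℤ)) s', X t ω ≠ z} = R.avoid z (s + s') := by
  have h := H.integral_noVisit z (fun _ => 1) (1 - s) (s + s')
  rw [show Finset.Ico (1 - (s : ℤ)) (1 - s + (s + s' : ℕ)) = Finset.Ioc (-(s : ℤ)) s' by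
    ext t; simp only [Finset.mem_Ico, Finset.mem_Ioc]; omega] at h
  simpa [RevChain.avoid] using h

theorem taboo_le_of_forall (H : IsHMM Pr R ν X Y) (z : S) (hπ : ∀ k, 0 < R.π k) {c : ℝ} {j : ℤ}
    {m : ℕ} (k : S)
    (h : Pr.real ({ω | ∀ t ∈ Finset.Ico j (j + m), X t ω ≠ z} ∩ {ω | X j ω = k}) ≤
      c * Pr.real {ω | X j ω = k}) :
    taboo R.P z m k ≤ c := by
  have hk : MeasurableSet {ω | X j ω = k} := H.meas_X j (measurableSet_singleton k)
  have e : ∀ m : ℕ, Pr.real ({ω | ∀ t ∈ Finset.Ico j (j + m), X t ω ≠ z} ∩ {ω | X j ω = k}) =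
      R.π k * taboo R.P z m k := by
    intro m
    have := H.integral_noVisit z (fun l => if l = k then 1 else 0) j m
    simp only [ite_mul, one_mul, zero_mul, mul_ite, mul_zero, Finset.sum_ite_eq',
      Finset.mem_univ, if_true] at this
    rw [← this, Set.inter_comm, ← measureReal_restrict_apply hk, ← integral_indicator_one hk]
    exact integral_congr_ae (Filter.Eventually.of_forall fun ω => by simp [Set.indicator_apply])
  have e0 := e 0
  simp only [Nat.cast_zero, add_zero, Finset.Ico_self, Finset.notMem_empty, false_imp_iff,
    forall_const, Set.ofPred_true, Set.univ_inter, taboo, mul_one] at e0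
  rw [e, e0, mul_comm c] at h
  exact le_of_mul_le_mul_left h (hπ k)

theorem ae_exists_visit (H : IsHMM Pr R ν X Y) (z : S)
    (h : Filter.Tendsto (R.avoid z) Filter.atTop (nhds 0)) :
    ∀ᵐ ω ∂Pr, (∃ k, 0 < k ∧ X k ω = z) ∧ ∃ k, k ≤ 0 ∧ X k ω = z := by
  have key : ∀ A : Set Ω, (∀ m, Pr.real A ≤ R.avoid z m) → Pr A = 0 := by
    intro A hA
    have : Pr.real A ≤ 0 := ge_of_tendsto' h hA
    exact (measureReal_eq_zero_iff).1 (le_antisymm this measureReal_nonneg)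
  refine Filter.Eventually.and ?_ ?_
  · refine key _ fun m => ?_
    rw [← zero_add m, ← H.measureReal_noVisit]
    refine measureReal_mono fun ω hω t ht hz => hω ⟨t, ?_, hz⟩
    simpa using (Finset.mem_Ioc.1 ht).1
  · refine key _ fun m => ?_
    rw [← add_zero m, ← H.measureReal_noVisit]
    refine measureReal_mono fun ω hω t ht hz => hω ⟨t, ?_, hz⟩
    simpa using (Finset.mem_Ioc.1 ht).2

theorem integral_gap_sq (H : IsHMM Pr R ν X Y) (z : S)
    (h : Filter.Tendsto (R.avoid z) Filter.atTop (nhds 0))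
    (hs : Summable fun p : ℕ × ℕ => sqCoeff p * R.avoid z (p.1 + p.2)) :
    ∫ ω, ((sInf {k : ℤ | 0 < k ∧ X k ω = z} - sSup {k : ℤ | k ≤ 0 ∧ X k ω = z} : ℤ) : ℝ) ^ 2 ∂Pr =
      ∑' p : ℕ × ℕ, sqCoeff p * R.avoid z (p.1 + p.2) := by
  set N : ℕ × ℕ → Set Ω := fun p => {ω | ∀ t ∈ Finset.Ioc (-(p.1 : ℤ)) p.2, X t ω ≠ z} with hN
  have hNm : ∀ p, MeasurableSet (N p) := fun p => H.measurableSet_noVisit z _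
  set F : ℕ × ℕ → Ω → ℝ := fun p => (N p).indicator fun _ => sqCoeff p with hF
  have hFi : ∀ p, Integrable (F p) Pr := fun p => (integrable_const _).indicator (hNm p)
  have hFint : ∀ p, ∫ ω, F p ω ∂Pr = sqCoeff p * R.avoid z (p.1 + p.2) := fun p => by
    rw [hF, integral_indicator_const _ (hNm p), H.measureReal_noVisit, smul_eq_mul, mul_comm]
  have hFn : ∀ p ω, ‖F p ω‖ = F p ω := fun p ω =>
    Real.norm_of_nonneg (Set.indicator_nonneg (fun _ _ => sqCoeff_nonneg p) ω)
  have hsum := hasSum_integral_of_summable_integral_norm hFi (by simpa only [hFn, hFint] using hs)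
  simp only [hFint] at hsum
  rw [hsum.tsum_eq]
  refine integral_congr_ae ?_
  filter_upwards [H.ae_exists_visit z h] with ω hω
  obtain ⟨p, q, h1, h2⟩ := exists_gap (fun t => X t ω = z) hω.1 hω.2
  rw [h1]
  push_cast
  rw [← sum_sqCoeff_ite (le_refl p) (le_refl q), tsum_eq_sum]
  · refine Finset.sum_congr rfl fun x _ => ?_
    have := h2 x.1 x.2
    by_cases hx : x.1 ≤ p ∧ x.2 ≤ q
    · have hm : ω ∈ N x := this.2 hx
      rw [if_pos hx.1, if_pos hx.2, one_mul, mul_one]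
      exact (Set.indicator_of_mem hm fun _ => sqCoeff x).symm
    · have hm : ω ∉ N x := fun h' => hx (this.1 h')
      refine Eq.trans ?_ (Set.indicator_of_notMem hm fun _ => sqCoeff x).symm
      rcases not_and_or.1 hx with h' | h'
      · rw [if_neg h', zero_mul, mul_zero]
      · rw [if_neg h', mul_zero, mul_zero]
  · intro x hx
    refine Set.indicator_of_notMem (fun h' => hx ?_) _
    have := (h2 x.1 x.2).1 h'
    simp only [Finset.mem_product, Finset.mem_range]
    omega

end IsHMM

theorem stationary_pos {E : Type*} [Fintype E] [DecidableEq E] {P : Matrix E E ℝ} {π : E → ℝ}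
    (hπ : ∀ k, 0 ≤ π k) (hsum : ∑ k, π k = 1) (hP : ∀ i j, 0 ≤ P i j)
    (hstat : ∀ j, ∑ k, π k * P k j = π j)
    (hirr : ∀ i j, ∃ m : ℕ, 0 < m ∧ 0 < (P ^ m) i j) (k : E) : 0 < π k := by
  have hpow : ∀ m : ℕ, ∀ j, ∑ i, π i * (P ^ m) i j = π j := by
    intro m
    induction m with
    | zero => simp [Matrix.one_apply]
    | succ m ih =>
      intro j
      simp_rw [pow_succ, Matrix.mul_apply, Finset.mul_sum]
      rw [Finset.sum_comm]
      simp_rw [← mul_assoc, ← Finset.sum_mul, ih, hstat]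
  have hnn : ∀ m : ℕ, ∀ i j, 0 ≤ (P ^ m) i j := by
    intro m
    induction m with
    | zero => intro i j; simp only [pow_zero, Matrix.one_apply]; split_ifs <;> norm_num
    | succ m ih =>
      intro i j
      rw [pow_succ, Matrix.mul_apply]
      exact Finset.sum_nonneg fun l _ => mul_nonneg (ih _ _) (hP _ _)
  obtain ⟨j, hj⟩ : ∃ j, 0 < π j := by
    by_contra! h
    exact absurd hsum ((Finset.sum_nonpos fun j _ => h j).trans_lt one_pos).ne
  obtain ⟨m, -, hm⟩ := hirr j k
  rw [← hpow m k]
  exact (mul_pos hj hm).trans_le (Finset.single_le_sum (f := fun i => π i * (P ^ m) i k)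
    (fun i _ => mul_nonneg (hπ i) (hnn m i k)) (Finset.mem_univ j))

/-- The chain with the given transition probabilities and stationary distribution. -/
noncomputable def RevChain.ofStationary {E : Type*} [Fintype E] (P : E → E → ℝ) (π : E → ℝ)
    (hP : ∀ i j, 0 ≤ P i j) (hrow : ∀ i, ∑ j, P i j = 1) (hπ : ∀ k, 0 < π k)
    (hsum : ∑ k, π k = 1) (hstat : ∀ j, ∑ k, π k * P k j = π j) : RevChain E where
  P := P
  Pb k l := π l * P l k / π k
  π := π
  P_nonneg := hP
  Pb_nonneg k l := div_nonneg (mul_nonneg (hπ l).le (hP l k)) (hπ k).le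
  P_row := hrow
  Pb_row k := by rw [← Finset.sum_div, hstat, div_self (hπ k).ne']
  π_nonneg k := (hπ k).le
  π_sum := hsum
  rev k l := by rw [mul_div_cancel₀ _ (hπ l).ne']

namespace IsHMM

variable {Ω S G : Type*} [MeasurableSpace Ω] [MeasurableSpace S] [MeasurableSpace G]
  [Fintype S] {Pr : Measure Ω} {R : RevChain S} {ν : S → Measure G}
  {X X' : ℤ → Ω → S} {Y Y' : ℤ → Ω → G}

theorem of_path (hX : ∀ i, Measurable (X i)) (hY : ∀ i, Measurable (Y i))
    (h : ∀ (a : ℤ) (m : ℕ) (x : ℕ → S) (y : ℕ → G),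
      Pr.real (⋂ i ∈ Finset.range (m + 1), {ω | X (a + i) ω = x i ∧ Y (a + i) ω = y i}) =
        R.π (x 0) * (∏ i ∈ Finset.range m, R.P (x i) (x (i + 1))) *
          ∏ i ∈ Finset.range (m + 1), (ν (x i)).real {y i}) :
    IsHMM Pr R ν X Y where
  meas_X := hX
  meas_Y := hY
  path a M x y := by
    have := h a M (fun i => x (Fin.ofNat (M + 1) i)) (fun i => y (Fin.ofNat (M + 1) i))
    have e : ∀ i : Fin (M + 1), Fin.ofNat (M + 1) (i : ℕ) = i := fun i => by simp
    have e1 : ∀ i : Fin M, Fin.ofNat (M + 1) (i : ℕ) = i.castSucc := fun i => e i.castSucc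
    have e2 : ∀ i : Fin M, Fin.ofNat (M + 1) ((i : ℕ) + 1) = i.succ := fun i => e i.succ
    have e0 : Fin.ofNat (M + 1) 0 = 0 := e 0
    rw [Finset.prod_range, Finset.prod_range] at this
    simp only [e, e1, e2, e0] at this
    rw [RevChain.weight, ← this]
    congr 1
    ext ω
    simp only [Set.mem_ofPred_eq, Set.mem_iInter, Finset.mem_range]
    constructor
    · intro hω i hi
      rw [show Fin.ofNat (M + 1) i = ⟨i, hi⟩ from e ⟨i, hi⟩]
      exact hω ⟨i, hi⟩
    · intro hω i
      have := hω i i.2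
      rwa [e] at this

theorem prod_of_path [∀ k, SFinite (ν k)] (hX : ∀ i, Measurable (X i)) (hY : ∀ i, Measurable (Y i))
    (hX' : ∀ i, Measurable (X' i)) (hY' : ∀ i, Measurable (Y' i))
    (h : ∀ (a : ℤ) (m : ℕ) (x : ℕ → S) (y : ℕ → G),
      Pr.real (⋂ i ∈ Finset.range (m + 1), {ω | X (a + i) ω = x i ∧ Y (a + i) ω = y i}) =
        R.π (x 0) * (∏ i ∈ Finset.range m, R.P (x i) (x (i + 1))) *
          ∏ i ∈ Finset.range (m + 1), (ν (x i)).real {y i})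
    (h' : ∀ (a : ℤ) (m : ℕ) (x : ℕ → S) (y : ℕ → G),
      Pr.real (⋂ i ∈ Finset.range (m + 1), {ω | X' (a + i) ω = x i ∧ Y' (a + i) ω = y i}) =
        R.π (x 0) * (∏ i ∈ Finset.range m, R.P (x i) (x (i + 1))) *
          ∏ i ∈ Finset.range (m + 1), (ν (x i)).real {y i})
    (hindep : ∀ (a : ℤ) (m : ℕ) (x x' : ℕ → S) (y y' : ℕ → G),
      Pr.real (⋂ i ∈ Finset.range (m + 1), {ω | (X (a + i) ω = x i ∧ Y (a + i) ω = y i) ∧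
        X' (a + i) ω = x' i ∧ Y' (a + i) ω = y' i}) =
      Pr.real (⋂ i ∈ Finset.range (m + 1), {ω | X (a + i) ω = x i ∧ Y (a + i) ω = y i}) *
        Pr.real (⋂ i ∈ Finset.range (m + 1), {ω | X' (a + i) ω = x' i ∧ Y' (a + i) ω = y' i})) :
    IsHMM Pr R.pair (fun k => (ν k.1).prod (ν k.2)) (fun i ω => (X i ω, X' i ω))
      fun i ω => (Y i ω, Y' i ω) := by
  refine of_path (fun i => (hX i).prodMk (hX' i)) (fun i => (hY i).prodMk (hY' i))
    fun a m x y => ?_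
  have := hindep a m (fun i => (x i).1) (fun i => (x i).2) (fun i => (y i).1) fun i => (y i).2
  rw [h, h'] at this
  simp only [Prod.ext_iff, RevChain.pair]
  rw [show (⋂ i ∈ Finset.range (m + 1), {ω | (X (a + i) ω = (x i).1 ∧ X' (a + i) ω = (x i).2) ∧
      Y (a + i) ω = (y i).1 ∧ Y' (a + i) ω = (y i).2}) =
    ⋂ i ∈ Finset.range (m + 1), {ω | (X (a + i) ω = (x i).1 ∧ Y (a + i) ω = (y i).1) ∧
      X' (a + i) ω = (x i).2 ∧ Y' (a + i) ω = (y i).2} by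
    simp only [and_and_and_comm], this]
  have hs : ∀ i, ((ν (x i).1).prod (ν (x i).2)).real {y i} =
      (ν (x i).1).real {(y i).1} * (ν (x i).2).real {(y i).2} := fun i => by
    rw [← measureReal_prod_prod, Set.singleton_prod_singleton]
  simp only [hs, Finset.prod_mul_distrib]
  ring

end IsHMM

section Joint

variable {Ω : Type*} [MeasurableSpace Ω] {Pr : Measure Ω} [IsProbabilityMeasure Pr]
  {K : ℕ} {R : RevChain (Fin (K + 1))} {ν : Fin (K + 1) → Measure ℤ}
  [∀ k, IsProbabilityMeasure (ν k)] {X X' : ℤ → Ω → Fin (K + 1)} {Y Y' : ℤ → Ω → ℤ}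
  {ρ C : ℝ}

theorem taboo_pair_le
    (HH : IsHMM Pr R.pair (fun k => (ν k.1).prod (ν k.2)) (fun i ω => (X i ω, X' i ω))
      fun i ω => (Y i ω, Y' i ω)) (hπ : ∀ k, 0 < R.π k)
    (hC : ∀ (j : ℤ) (m : ℕ) (k k' : Fin (K + 1)),
      (Pr ({ω | ∀ t ∈ Finset.Ico j (j + m), ¬(X t ω = 0 ∧ X' t ω = 0)}
          ∩ {ω | X j ω = k ∧ X' j ω = k'})).toReal
        ≤ C / ρ ^ m * (Pr {ω | X j ω = k ∧ X' j ω = k'}).toReal)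
    (m : ℕ) (k : Fin (K + 1) × Fin (K + 1)) : taboo R.pair.P (0, 0) m k ≤ C / ρ ^ m := by
  refine HH.taboo_le_of_forall (0, 0) (fun k => mul_pos (hπ _) (hπ _)) (j := 0) k ?_
  simp only [ne_eq, Prod.ext_iff]
  exact hC 0 m k.1 k.2

theorem taboo_symm_pair_le
    (HH : IsHMM Pr R.pair (fun k => (ν k.1).prod (ν k.2)) (fun i ω => (X i ω, X' i ω))
      fun i ω => (Y i ω, Y' i ω)) (hπ : ∀ k, 0 < R.π k)
    (hC : ∀ (j : ℤ) (m : ℕ) (k k' : Fin (K + 1)),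
      (Pr ({ω | ∀ t ∈ Finset.Ioc (j - m) j, ¬(X t ω = 0 ∧ X' t ω = 0)}
          ∩ {ω | X j ω = k ∧ X' j ω = k'})).toReal
        ≤ C / ρ ^ m * (Pr {ω | X j ω = k ∧ X' j ω = k'}).toReal)
    (m : ℕ) (k : Fin (K + 1) × Fin (K + 1)) : taboo R.symm.pair.P (0, 0) m k ≤ C / ρ ^ m := by
  refine HH.symm.taboo_le_of_forall (0, 0) (fun k => mul_pos (hπ _) (hπ _)) (j := 0) k ?_
  simp only [ne_eq, Prod.ext_iff, neg_zero]
  have hset : {ω | ∀ t ∈ Finset.Ico (0 : ℤ) (0 + m), ¬(X (-t) ω = 0 ∧ X' (-t) ω = 0)} =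
      {ω | ∀ t ∈ Finset.Ioc (0 - (m : ℤ)) 0, ¬(X t ω = 0 ∧ X' t ω = 0)} := by
    ext ω
    simp only [Set.mem_ofPred_eq, Finset.mem_Ico, Finset.mem_Ioc]
    refine ⟨fun h t ht => ?_, fun h t ht => h (-t) (by omega)⟩
    have := h (-t) (by omega)
    rwa [neg_neg] at this
  rw [hset]
  exact hC 0 m k.1 k.2

end Joint

theorem div_pow_le_rpow {ρ c : ℝ} (hρ : 1 < ρ) (hc : 0 ≤ c) {n s : ℕ} (h : (n + 3) / 4 ≤ s) :
    c / ρ ^ s ≤ c * ρ ^ (-(n : ℝ) / 4) := by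
  rw [div_eq_mul_inv, ← Real.rpow_natCast, ← Real.rpow_neg (by linarith)]
  refine mul_le_mul_of_nonneg_left (Real.rpow_le_rpow_of_exponent_le hρ.le ?_) hc
  have : n ≤ 4 * s := by omega
  have : (n : ℝ) ≤ 4 * s := by exact_mod_cast this
  linarith

theorem RevChain.mixing {E A : Type*} [Fintype E] [DecidableEq E] [NormedCommRing A]
    [NormedAlgebra ℝ A] {T : JetData E A} {R : RevChain E} {o : E} {n : ℕ} {β ρ C Cbar : ℝ}
    (hρ : 1 < ρ) (hC0 : 0 ≤ C)
    (hs : Summable fun p : ℕ × ℕ => sqCoeff p * R.pair.avoid (o, o) (p.1 + p.2))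
    (h1 : ∀ M, n / 4 ≤ M → ‖T.D * R.ret T.N M o‖ ≤ β)
    (h2 : ∀ M, n / 4 ≤ M → ‖T.D * R.symm.ret T.N M o‖ ≤ β)
    (h3 : ∀ m k, taboo R.pair.P (o, o) m k ≤ C / ρ ^ m)
    (h4 : ∀ m k, taboo R.symm.pair.P (o, o) m k ≤ Cbar / ρ ^ m) :
    Mixing T R o n β (max C Cbar * ρ ^ (-(n : ℝ) / 4))
      (√(∑' p : ℕ × ℕ, sqCoeff p * R.pair.avoid (o, o) (p.1 + p.2)))
      (∑' p : ℕ × ℕ, sqCoeff p * R.pair.avoid (o, o) (p.1 + p.2)) := by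
  have h := R.pair.one_le_tsum (o, o) hs
  have hp : ∀ m : ℕ, 0 < ρ ^ m := fun m => pow_pos (by linarith) m
  have hc : 0 ≤ max C Cbar := hC0.trans (le_max_left _ _)
  refine ⟨h1, h2, fun s x hsn => (h3 s x).trans ?_, fun s x hsn => (h4 s x).trans ?_,
    fun M _ => Real.le_sqrt_of_sq_le (R.pair.sum_avoid_sq_le _ hs M),
    fun M₁ M₂ _ => R.pair.joint_sq_le _ hs M₁ M₂, Real.one_le_sqrt.2 h,
    (Real.sq_sqrt (by linarith)).le⟩
  · exact (div_le_div_of_nonneg_right (le_max_left _ _) (hp s).le).trans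
      (div_pow_le_rpow hρ hc hsn)
  · exact (div_le_div_of_nonneg_right (le_max_right _ _) (hp s).le).trans
      (div_pow_le_rpow hρ hc hsn)

end HiddenMarkov

/-- Theorem 4.2 (Theorem 1): in the stationary hidden Markov setting, if
`L(Σ_{i=1}^{S₁} Y_i | X₀ = 0)` is strongly aperiodic and the conditional distributions of
the `Y_i` are dominated by a positive integer-valued `Z` with `E Z³ < ∞`, then
`‖L(W) - TP(E W, Var W)‖ ≤ 4 (1 + 14 n φ(n) E τ² E Z³) / Var W`, where
`φ(n) := β̃(n/4) + (C ∨ C̄) n ρ^{-n/4}`. -/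
theorem translatedPoisson_approx_stationary
    {Ω : Type*} [MeasurableSpace Ω] (Pr : Measure Ω) [IsProbabilityMeasure Pr]
    (K : ℕ) (n : ℕ) (hn : 1 ≤ n)
    -- two-sided stationary chains and hidden variables:
    (X X' : ℤ → Ω → Fin (K + 1)) (Y Y' : ℤ → Ω → ℤ)
    (hmX : ∀ i, Measurable (X i)) (hmX' : ∀ i, Measurable (X' i))
    (hmY : ∀ i, Measurable (Y i)) (hmY' : ∀ i, Measurable (Y' i))
    (P : Matrix (Fin (K + 1)) (Fin (K + 1)) ℝ) (π : Fin (K + 1) → ℝ)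
    (ν : Fin (K + 1) → PMF ℤ)
    (hPnn : ∀ i j, 0 ≤ P i j) (hProw : ∀ i, ∑ j, P i j = 1)
    (hπnn : ∀ k, 0 ≤ π k) (hπsum : ∑ k, π k = 1)
    (hstat : ∀ j, ∑ k, π k * P k j = π j)
    -- `(X, Y)` is the (two-sided) stationary hidden Markov chain:
    (hpathXY : ∀ (a : ℤ) (m : ℕ) (x : ℕ → Fin (K + 1)) (y : ℕ → ℤ),
      (Pr (⋂ i ∈ Finset.range (m + 1), {ω | X (a + i) ω = x i ∧ Y (a + i) ω = y i})).toReal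
        = π (x 0) * (∏ i ∈ Finset.range m, P (x i) (x (i + 1)))
          * ∏ i ∈ Finset.range (m + 1), ((ν (x i)) (y i)).toReal)
    -- `(X', Y')` is an identically distributed copy:
    (hpathXY' : ∀ (a : ℤ) (m : ℕ) (x : ℕ → Fin (K + 1)) (y : ℕ → ℤ),
      (Pr (⋂ i ∈ Finset.range (m + 1),
          {ω | X' (a + i) ω = x i ∧ Y' (a + i) ω = y i})).toReal
        = π (x 0) * (∏ i ∈ Finset.range m, P (x i) (x (i + 1)))
          * ∏ i ∈ Finset.range (m + 1), ((ν (x i)) (y i)).toReal)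
    -- `(X, Y)` and `(X', Y')` are independent:
    (hindep : ∀ (a : ℤ) (m : ℕ) (x x' : ℕ → Fin (K + 1)) (y y' : ℕ → ℤ),
      (Pr (⋂ i ∈ Finset.range (m + 1),
          {ω | (X (a + i) ω = x i ∧ Y (a + i) ω = y i)
            ∧ X' (a + i) ω = x' i ∧ Y' (a + i) ω = y' i})).toReal
        = (Pr (⋂ i ∈ Finset.range (m + 1),
            {ω | X (a + i) ω = x i ∧ Y (a + i) ω = y i})).toReal
          * (Pr (⋂ i ∈ Finset.range (m + 1),
              {ω | X' (a + i) ω = x' i ∧ Y' (a + i) ω = y' i})).toReal)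
    -- the chain is irreducible and aperiodic:
    (hirr : ∀ i j : Fin (K + 1), ∃ m : ℕ, 0 < m ∧ 0 < (P ^ m) i j)
    (haper : ∀ d : ℕ, (∀ m : ℕ, 0 < m → 0 < (P ^ m) 0 0 → d ∣ m) → d = 1)
    -- `L(Σ_{i=1}^{S₁} Y_i | X₀ = 0)` is strongly aperiodic (`S₁` the first return to `0`):
    (hQaper : ∀ k d : ℤ,
      (∀ i : ℤ,
        (Pr[|{ω | X 0 ω = 0}])
          {ω | ∑ j ∈ Finset.Icc (1 : ℤ) (sInf {m : ℤ | 1 ≤ m ∧ X m ω = 0}), Y j ω = i}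
            ≠ 0 →
        d ∣ (k + i)) → IsUnit d)
    -- domination of the conditional distributions by `Z`, with `E Z³ < ∞`:
    (Z : Ω → ℕ) (hmZ : Measurable Z) (hZpos : ∀ ω, 1 ≤ Z ω)
    (hZ3 : Integrable (fun ω => ((Z ω : ℝ)) ^ 3) Pr)
    (hdom : ∀ (l : Fin (K + 1)) (r : ℕ),
      ((ν l).toMeasure {y : ℤ | (r : ℤ) ≤ y}).toReal ≤ (Pr {ω | r ≤ Z ω}).toReal ∧
      ((ν l).toMeasure {y : ℤ | y ≤ -(r : ℤ)}).toReal ≤ (Pr {ω | r ≤ Z ω}).toReal)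
    -- constants `ρ > 1`, `C`, `C̄` bounding the tails of the waiting times until the next
    -- (resp., for the time reversal, the previous) common visit of `(X, X')` to `(0,0)`:
    (ρ C Cbar : ℝ) (hρ : 1 < ρ)
    (hC : ∀ (j : ℤ) (m : ℕ) (k k' : Fin (K + 1)),
      (Pr ({ω | ∀ t ∈ Finset.Ico j (j + m), ¬(X t ω = 0 ∧ X' t ω = 0)}
          ∩ {ω | X j ω = k ∧ X' j ω = k'})).toReal
        ≤ C / ρ ^ m * (Pr {ω | X j ω = k ∧ X' j ω = k'}).toReal)
    (hCbar : ∀ (j : ℤ) (m : ℕ) (k k' : Fin (K + 1)),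
      (Pr ({ω | ∀ t ∈ Finset.Ioc (j - m) j, ¬(X t ω = 0 ∧ X' t ω = 0)}
          ∩ {ω | X j ω = k ∧ X' j ω = k'})).toReal
        ≤ Cbar / ρ ^ m * (Pr {ω | X j ω = k ∧ X' j ω = k'}).toReal) :
    tvNormMeasure (Pr.map (fun ω => ∑ i ∈ Finset.Icc (1 : ℤ) n, Y i ω))
        (translatedPoisson
          (∫ ω, ((∑ i ∈ Finset.Icc (1 : ℤ) n, Y i ω : ℤ) : ℝ) ∂Pr)
          (∫ ω, (((∑ i ∈ Finset.Icc (1 : ℤ) n, Y i ω : ℤ) : ℝ)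
              - ∫ ω', ((∑ i ∈ Finset.Icc (1 : ℤ) n, Y i ω' : ℤ) : ℝ) ∂Pr) ^ 2 ∂Pr)).toMeasure
      ≤ 4 * (1
          + 14 * n
            * (tildeBetaFn2 Pr K X Y (n / 4) + max C Cbar * n * ρ ^ (-(n : ℝ) / 4))
            * (∫ ω, ((tauRV K X X' ω : ℤ) : ℝ) ^ 2 ∂Pr)
            * ∫ ω, ((Z ω : ℝ)) ^ 3 ∂Pr)
        / ∫ ω, (((∑ i ∈ Finset.Icc (1 : ℤ) n, Y i ω : ℤ) : ℝ)
            - ∫ ω', ((∑ i ∈ Finset.Icc (1 : ℤ) n, Y i ω' : ℤ) : ℝ) ∂Pr) ^ 2 ∂Pr := by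
  have hπ := HiddenMarkov.stationary_pos hπnn hπsum hPnn hstat hirr
  set R : HiddenMarkov.RevChain (Fin (K + 1)) :=
    HiddenMarkov.RevChain.ofStationary P π hPnn hProw hπ hπsum hstat with hR
  set μ : Fin (K + 1) → Measure ℤ := fun k => (ν k).toMeasure with hμ
  have hμ1 : ∀ k y, (μ k).real {y} = (ν k y).toReal := fun k y => by
    rw [hμ, measureReal_def, PMF.toMeasure_apply_singleton _ _ (measurableSet_singleton y)]
  have h1 : ∀ (a : ℤ) (m : ℕ) (x : ℕ → Fin (K + 1)) (y : ℕ → ℤ),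
      Pr.real (⋂ i ∈ Finset.range (m + 1), {ω | X (a + i) ω = x i ∧ Y (a + i) ω = y i}) =
        R.π (x 0) * (∏ i ∈ Finset.range m, R.P (x i) (x (i + 1))) *
          ∏ i ∈ Finset.range (m + 1), (μ (x i)).real {y i} := fun a m x y => by
    simp only [hμ1]
    exact hpathXY a m x y
  have h1' : ∀ (a : ℤ) (m : ℕ) (x : ℕ → Fin (K + 1)) (y : ℕ → ℤ),
      Pr.real (⋂ i ∈ Finset.range (m + 1), {ω | X' (a + i) ω = x i ∧ Y' (a + i) ω = y i}) =
        R.π (x 0) * (∏ i ∈ Finset.range m, R.P (x i) (x (i + 1))) *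
          ∏ i ∈ Finset.range (m + 1), (μ (x i)).real {y i} := fun a m x y => by
    simp only [hμ1]
    exact hpathXY' a m x y
  have H : HiddenMarkov.IsHMM Pr R μ X Y := .of_path hmX hmY h1
  have HH := HiddenMarkov.IsHMM.prod_of_path hmX hmY hmX' hmY' h1 h1' hindep
  have ht := HiddenMarkov.taboo_pair_le HH hπ hC
  have ht' := HiddenMarkov.taboo_symm_pair_le HH hπ hCbar
  have hC0 : 0 ≤ C := by
    have := ht 0 (0, 0)
    simp only [HiddenMarkov.taboo, pow_zero, div_one] at this
    linarith
  have hav : ∀ m, R.pair.avoid (0, 0) m ≤ C * ρ⁻¹ ^ m := fun m => by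
    have := R.pair.avoid_le (0, 0) (ht m)
    rwa [div_eq_mul_inv, ← inv_pow] at this
  have hr0 : 0 ≤ ρ⁻¹ := inv_nonneg.2 (by linarith)
  have hr1 : ρ⁻¹ < 1 := inv_lt_one_of_one_lt₀ hρ
  have hs := R.pair.summable_sqCoeff (0, 0) hr0 hr1 hav
  have htend : Filter.Tendsto (R.pair.avoid (0, 0)) Filter.atTop (nhds 0) :=
    squeeze_zero (fun m => R.pair.avoid_nonneg _ m) hav
      (by simpa using (tendsto_pow_atTop_nhds_zero_of_lt_one hr0 hr1).const_mul C)
  have hτ := HH.integral_gap_sq (0, 0) htend hs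
  simp only [Prod.ext_iff] at hτ
  have hint := fun k => (HiddenMarkov.moment_le (μ := μ k) hmZ hZ3 (hdom k)).1
  have hEZ : 1 ≤ ∫ ω, ((Z ω : ℝ)) ^ 3 ∂Pr := by
    have := integral_mono (integrable_const (1 : ℝ)) hZ3 fun ω =>
      one_le_pow₀ (n := 3) (by exact_mod_cast hZpos ω : (1 : ℝ) ≤ Z ω)
    simpa using this
  obtain ⟨θ, hθ, hθ3⟩ : ∃ θ : ℝ, 1 ≤ θ ∧ θ ^ 3 = 2 * ∫ ω, ((Z ω : ℝ)) ^ 3 ∂Pr :=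
    ⟨(2 * ∫ ω, ((Z ω : ℝ)) ^ 3 ∂Pr) ^ ((3 : ℕ) : ℝ)⁻¹,
      Real.one_le_rpow (by linarith) (by positivity),
      Real.rpow_inv_natCast_pow (by linarith) (by norm_num)⟩
  have hm3 : ∀ k, ∫ y : ℤ, |(y : ℝ)| ^ 3 ∂μ k ≤ θ ^ 3 := fun k =>
    hθ3 ▸ (HiddenMarkov.moment_le (μ := μ k) hmZ hZ3 (hdom k)).2
  have key := H.tv_bound hint hθ hm3 0 n
    (β := tildeBetaFn2 Pr K X Y (n / 4)) (q := max C Cbar * ρ ^ (-(n : ℝ) / 4))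
    fun J hJt hJD => by
      have h0 : J.t 0 = 1 := hJt ▸ HiddenMarkov.convShift_zero
      have ha : ∀ a b, J.t (a + b) = J.t a * J.t b := hJt ▸ HiddenMarkov.convShift_add
      have hn1 : ∀ y, ‖J.t y‖ ≤ 1 := hJt ▸ HiddenMarkov.norm_convShift_le
      have hB : HiddenMarkov.JetBound (J.data μ hint) θ := J.jetBound μ hint hθ hm3 hn1
        (hJD ▸ HiddenMarkov.norm_convShift_sub_le) (hJD ▸ HiddenMarkov.one_le_norm_convShift_sub)
      refine HiddenMarkov.RevChain.mixing hρ hC0 hs (fun M hM => ?_) (fun M hM => ?_) ht ht'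
      · exact (H.norm_smooth_le J hint h0 ha hn1 (by rw [hJD, hJt]) (hB.norm_ret_le R) (hπ 0)
          hM).trans (le_max_left _ _)
      · exact (H.symm.norm_smooth_le J hint h0 ha hn1 (by rw [hJD, hJt]) (hB.norm_ret_le R.symm)
          (hπ 0) hM).trans (le_max_right _ _)
  simp only [HiddenMarkov.sum_Icc_eq_hiddenSum]
  refine key.trans (le_of_eq ?_)
  rw [hθ3, ← hτ]
  simp only [tauRV]
  ring
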